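/- Let h be a Brouwer homeomorphism and let x, y be two points not in the same orbit of h. Then d_h(x,y) equals the minimal h-length of an arc joining x to y, where the h-length of an arc is the smallest k such that the arc can be written as a concatenation γ₁ * … * γ_k of k free subarcs. -/

import Mathlib

open Set Filter Topology

/-- The plane. -/
abbrev Plane : Type := ℝ × ℝ

/-- A homeomorphism of the plane preserves orientation iff it is isotopic to the identity. -/
def IsotopicToId (h : Plane ≃ₜ Plane) : Prop :=
  ∃ H : ℝ → Plane ≃ₜ Plane,
    Continuous (fun p : ℝ × Plane => H p.1 p.2) ∧
    H 0 = Homeomorph.refl Plane ∧ H 1 = h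

/-- A Brouwer homeomorphism: an orientation-preserving (i.e. isotopic to the identity),
fixed-point-free homeomorphism of the plane. -/
structure BrouwerHomeo where
  toHomeomorph : Plane ≃ₜ Plane
  orientationPreserving : IsotopicToId toHomeomorph
  fixedPointFree : ∀ x : Plane, toHomeomorph x ≠ x

/-- The integer iterate `h^n`. -/
def BrouwerHomeo.iter (h : BrouwerHomeo) (n : ℤ) : Plane → Plane :=
  ⇑(h.toHomeomorph.toEquiv ^ n)

/-- A set is free if it is disjoint from its image under `h`. -/
def IsFree (h : BrouwerHomeo) (E : Set Plane) : Prop :=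
  Disjoint (h.toHomeomorph '' E) E

/-- A closed topological disk: a subset of the plane homeomorphic to the closed unit disk. -/
def IsClosedDisk (D : Set Plane) : Prop :=
  Nonempty (D ≃ₜ (Metric.closedBall (0 : Plane) 1 : Set Plane))
/-- A translation domain for `h`: an open, connected, simply connected, invariant subset
of the plane on which `h` is conjugate to the translation `(x, y) ↦ (x + 1, y)`. -/
def IsTranslationDomain (h : BrouwerHomeo) (O : Set Plane) : Prop :=
  IsOpen O ∧ IsConnected O ∧ SimplyConnectedSpace O ∧
  h.toHomeomorph '' O = O ∧
  ∃ Φ : O ≃ₜ Plane, ∀ (x : Plane) (hx : x ∈ O) (hx' : h.toHomeomorph x ∈ O),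
    Φ ⟨h.toHomeomorph x, hx'⟩ = ((Φ ⟨x, hx⟩).1 + 1, (Φ ⟨x, hx⟩).2)

/-- `x` and `y` are contained in the connected union of `k` translation domains. -/
def ConnectsBy (h : BrouwerHomeo) (x y : Plane) (k : ℕ) : Prop :=
  ∃ O : Fin k → Set Plane, (∀ i, IsTranslationDomain h (O i)) ∧
    IsConnected (⋃ i, O i) ∧ x ∈ ⋃ i, O i ∧ y ∈ ⋃ i, O i

open Classical in
/-- The translation distance of `h`: the minimal number of translation domains whose
union is connected and contains both points. -/
noncomputable def transDist (h : BrouwerHomeo) (x y : Plane) : ℕ :=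
  if x = y then 0 else sInf {k : ℕ | ConnectsBy h x y k}

/-- `x` and `y` lie in the same orbit of `h`. -/
def SameOrbit (h : BrouwerHomeo) (x y : Plane) : Prop :=
  ∃ n : ℤ, h.iter n x = y

/-- `x` and `y` are joined by an arc admitting a decomposition into `k` free subarcs
(that is, an arc of `h`-length at most `k`). -/
def ArcLenLe (h : BrouwerHomeo) (x y : Plane) (k : ℕ) : Prop :=
  ∃ f : unitInterval → Plane, Continuous f ∧ Function.Injective f ∧
    f 0 = x ∧ f 1 = y ∧
    ∃ t : Fin (k + 1) → unitInterval, Monotone t ∧ t 0 = 0 ∧ t (Fin.last k) = 1 ∧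
      ∀ i : Fin k, IsFree h (f '' Set.Icc (t i.castSucc) (t i.succ))

namespace BrouwerPlane

/-- Every continuous nonvanishing complex function on `U` has a continuous logarithm on `U`. -/
def HasLog {X : Type*} [TopologicalSpace X] (U : Set X) : Prop :=
  ∀ f : X → ℂ, ContinuousOn f U → (∀ z ∈ U, f z ≠ 0) →
    ∃ g : X → ℂ, ContinuousOn g U ∧ ∀ z ∈ U, Complex.exp (g z) = f z

theorem exists_log {A : Type*} [TopologicalSpace A] [SimplyConnectedSpace A]
    [LocallyPathConnectedSpace A] {f : A → ℂ} (hf : Continuous f) (h0 : ∀ a, f a ≠ 0) :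
    ∃ g : A → ℂ, Continuous g ∧ ∀ a, Complex.exp (g a) = f a := by
  obtain ⟨a₀⟩ : Nonempty A := inferInstance
  obtain ⟨F, ⟨-, hF⟩, -⟩ := Complex.isCoveringMapOn_exp.existsUnique_continuousMap_lifts
    ⟨f, hf⟩ (Complex.exp_log (h0 a₀)) (by simpa using h0)
  exact ⟨F, F.continuous, fun a => congrFun hF a⟩

theorem log_sub_const {X : Type*} [TopologicalSpace X] {S : Set X} (hS : IsPreconnected S)
    {f g : X → ℂ} (hf : ContinuousOn f S) (hg : ContinuousOn g S)
    (h : ∀ x ∈ S, Complex.exp (f x) = Complex.exp (g x)) {x y : X} (hx : x ∈ S) (hy : y ∈ S) :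
    f x - g x = f y - g y := by
  have key : ∀ z ∈ S, ∃ n : ℤ, f z - g z = n * (2 * Real.pi * Complex.I) := by
    intro z hz
    obtain ⟨n, hn⟩ := Complex.exp_eq_exp_iff_exists_int.1 (h z hz)
    exact ⟨n, by rw [hn]; ring⟩
  choose! n hn using key
  have h2 : (2 * Real.pi * Complex.I : ℂ) ≠ 0 := Complex.two_pi_I_ne_zero
  have hc : ContinuousOn (fun z => (n z : ℝ)) S := by
    have : ContinuousOn (fun z => ((f z - g z) / (2 * Real.pi * Complex.I)).re) S :=
      Complex.continuous_re.comp_continuousOn ((hf.sub hg).div_const _)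
    refine this.congr fun z hz => ?_
    simp only []
    rw [hn z hz, mul_div_cancel_right₀ _ h2]
    simp
  have hc' : ContinuousOn n S := by
    have := Int.isClosedEmbedding_coe_real.isInducing.continuousOn_iff (f := n) (s := S)
    exact this.2 hc
  have := hS.constant hc' hx hy
  rw [hn x hx, hn y hy, this]

theorem log_sub_const_univ {X : Type*} [TopologicalSpace X] [PreconnectedSpace X]
    {f g : X → ℂ} (hf : Continuous f) (hg : Continuous g)
    (h : ∀ x, Complex.exp (f x) = Complex.exp (g x)) (x y : X) :
    f x - g x = f y - g y :=
  log_sub_const isPreconnected_univ hf.continuousOn hg.continuousOn (fun x _ => h x)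
    (mem_univ x) (mem_univ y)

/-- A continuous bounded self-map of the complex plane has a fixed point. -/
theorem exists_fixedPoint_of_bounded {f : ℂ → ℂ} (hf : Continuous f) {M : ℝ}
    (hM : ∀ w, ‖f w‖ ≤ M) : ∃ w, f w = w := by
  by_contra! hne
  have hM0 : 0 ≤ M := (norm_nonneg _).trans (hM 0)
  set R : ℝ := M + 1 with hR
  have hR0 : 0 < R := by linarith
  let c : ℝ → ℝ := fun s => max 0 (min 1 s)
  have hc0 : ∀ s, 0 ≤ c s := fun s => le_max_left _ _
  have hc1 : ∀ s, c s ≤ 1 := fun s => max_le zero_le_one (min_le_left _ _)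
  have hcc : Continuous c := by fun_prop
  let e : ℝ → ℂ := fun t => Complex.exp (Real.log R + t * Complex.I)
  have he : ∀ t, ‖e t‖ = R := fun t => by
    simp [e, Complex.norm_exp, Real.exp_log hR0]
  have hec : Continuous e := by fun_prop
  have he2 : e (2 * Real.pi) = e 0 := by
    simp only [e]
    rw [Complex.exp_eq_exp_iff_exists_int]
    exact ⟨1, by push_cast; ring⟩
  obtain ⟨L, hL, hLe⟩ := exists_log (A := ℝ × ℝ)
    (f := fun p => e p.2 - (c p.1 : ℂ) * f (e p.2)) (by fun_prop) (by
      intro p h0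
      have h1 : ‖e p.2‖ = ‖(c p.1 : ℂ) * f (e p.2)‖ := congrArg norm (sub_eq_zero.1 h0)
      rw [he, norm_mul, Complex.norm_real, Real.norm_of_nonneg (hc0 _)] at h1
      have := mul_le_mul (hc1 p.1) (hM (e p.2)) (norm_nonneg _) zero_le_one
      linarith)
  obtain ⟨m, hm, hme⟩ := exists_log (A := ℂ) (f := fun w => w - f w) (by fun_prop)
    (fun w h0 => hne w (sub_eq_zero.1 h0).symm)
  have h1 : L (0, 2 * Real.pi) - L (0, 0) = L (1, 2 * Real.pi) - L (1, 0) :=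
    log_sub_const_univ (f := fun s : ℝ => L (s, 2 * Real.pi)) (g := fun s : ℝ => L (s, 0))
      (by fun_prop) (by fun_prop) (fun s => by rw [hLe, hLe]; simp only [he2]) 0 1
  have h2 := log_sub_const_univ (f := fun t : ℝ => L (0, t))
      (g := fun t : ℝ => (Real.log R + t * Complex.I : ℂ))
      (by fun_prop) (by fun_prop) (fun t => by rw [hLe]; simp [c, e]) (2 * Real.pi) 0
  have h3 := log_sub_const_univ (f := fun t : ℝ => L (1, t))
      (g := fun t : ℝ => m (e t))
      (by fun_prop) (by fun_prop) (fun t => by rw [hLe, hme]; simp [c]) (2 * Real.pi) 0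
  simp only [he2] at h3
  push_cast at h2
  apply Complex.two_pi_I_ne_zero
  linear_combination h3 + h1 - h2

end BrouwerPlane

namespace BrouwerPlane

/-- `h` is isotopic to the identity through homeomorphisms. -/
def IsotopicId (h : ℂ ≃ₜ ℂ) : Prop :=
  ∃ H : ℝ → ℂ ≃ₜ ℂ, Continuous (fun p : ℝ × ℂ => H p.1 p.2) ∧
    H 0 = Homeomorph.refl ℂ ∧ H 1 = h

theorem IsotopicId.trans {h g : ℂ ≃ₜ ℂ} (hh : IsotopicId h) (hg : IsotopicId g) :
    IsotopicId (h.trans g) := by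
  obtain ⟨H, hc, h0, h1⟩ := hh
  obtain ⟨G, gc, g0, g1⟩ := hg
  refine ⟨fun s => (H s).trans (G s), ?_, by simp only [h0, g0]; rfl, by simp only [h1, g1]⟩
  exact gc.comp (continuous_fst.prodMk hc)

theorem IsotopicId.conj {h : ℂ ≃ₜ ℂ} (hh : IsotopicId h) (k : ℂ ≃ₜ ℂ) :
    IsotopicId ((k.symm.trans h).trans k) := by
  obtain ⟨H, hc, h0, h1⟩ := hh
  refine ⟨fun s => (k.symm.trans (H s)).trans k, ?_, ?_, by simp only [h1]⟩
  · exact k.continuous.comp (hc.comp (continuous_fst.prodMk (k.symm.continuous.comp continuous_snd)))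
  · ext z; simp [h0]

/-- A fixed-point-free homeomorphism of the complex plane, isotopic to the identity. -/
def IsBrouwer (h : ℂ ≃ₜ ℂ) : Prop := IsotopicId h ∧ ∀ z, h z ≠ z

/-- `X` is disjoint from its image by `h`. -/
def Free (h : ℂ → ℂ) (X : Set ℂ) : Prop := ∀ z ∈ X, h z ∉ X

theorem IsBrouwer.apply_apply_ne {h : ℂ ≃ₜ ℂ} (hh : IsBrouwer h) (x : ℂ) : h (h x) ≠ x := by
  obtain ⟨⟨H, hc, h0, h1⟩, hf⟩ := hh
  intro hx
  obtain ⟨L, hL, hLe⟩ := exists_log (A := ℝ × ℂ) (f := fun p => H p.1 (h p.2) - H p.1 p.2)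
    ((hc.comp (continuous_fst.prodMk (h.continuous.comp continuous_snd))).sub hc)
    (fun p h0 => hf p.2 ((H p.1).injective (sub_eq_zero.1 h0)))
  have e1 := log_sub_const_univ (f := fun z => L (1, z)) (g := fun z => L (0, h z))
    (by fun_prop) (hL.comp (continuous_const.prodMk h.continuous))
    (fun z => by rw [hLe, hLe]; simp [h0, h1]) x (h x)
  have e2 := log_sub_const_univ (f := fun s : ℝ => L (s, h x))
    (g := fun s : ℝ => L (s, x) + Real.pi * Complex.I)
    (by fun_prop) (by fun_prop)
    (fun s => by rw [Complex.exp_add, hLe, hLe, Complex.exp_pi_mul_I]; simp [hx]) 0 1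
  have e3 : Complex.exp (L (0, h x)) = Complex.exp (L (0, x)) := by
    simp only [hx] at e1
    congr 1
    linear_combination (1 / 2) * e2 - (1 / 2) * e1
  rw [hLe, hLe] at e3
  simp only [h0, hx, Homeomorph.refl_apply, id_eq] at e3
  exact hf x (by linear_combination (-1 / 2) * e3)

theorem exists_isotopicId_of_lipschitz {u : ℂ → ℂ} {K : NNReal} (hK : K < 1)
    (hu : LipschitzWith K u) : ∃ φ : ℂ ≃ₜ ℂ, IsotopicId φ ∧ ∀ z, φ z = z + u z := by
  have key : ∀ c : ℝ, 0 ≤ c → c ≤ 1 → ∃ φ : ℂ ≃ₜ ℂ, ∀ z, φ z = z + c * u z := by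
    intro c hc0 hc1
    have happ : ApproximatesLinearOn (fun z => z + c * u z)
        ((ContinuousLinearEquiv.refl ℝ ℂ : ℂ ≃L[ℝ] ℂ) : ℂ →L[ℝ] ℂ) univ K := by
      intro a _ b _
      have h1 := hu.dist_le_mul a b
      rw [dist_eq_norm, dist_eq_norm] at h1
      have h2 : (a + c * u a - (b + c * u b)) - (a - b) = c * (u a - u b) := by ring
      simp only [ContinuousLinearEquiv.coe_coe, ContinuousLinearEquiv.refl_apply, h2, norm_mul,
        Complex.norm_real, Real.norm_of_nonneg hc0]
      nlinarith [norm_nonneg (u a - u b)]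
    refine ⟨happ.toHomeomorph _ (Or.inr ?_), fun z => rfl⟩
    refine lt_of_lt_of_le hK ?_
    rw [one_le_inv₀ ?_]
    · exact ContinuousLinearMap.norm_id_le
    · simp [ContinuousLinearEquiv.refl_symm, ContinuousLinearEquiv.coe_refl]
  let c : ℝ → ℝ := fun s => max 0 (min 1 s)
  have hc0 : ∀ s, 0 ≤ c s := fun s => le_max_left _ _
  have hc1 : ∀ s, c s ≤ 1 := fun s => max_le zero_le_one (min_le_left _ _)
  have hcc : Continuous c := by fun_prop
  choose! φ hφ using key
  have huc := hu.continuous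
  refine ⟨φ 1, ⟨fun s => φ (c s), ?_, ?_, ?_⟩, fun z => ?_⟩
  · simp only [fun s => hφ (c s) (hc0 s) (hc1 s)]
    fun_prop
  · ext z
    rw [hφ _ (hc0 0) (hc1 0)]
    simp [c]
  · simp [c]
  · simp [hφ 1 zero_le_one le_rfl]

theorem exists_ball_push {c d : ℂ} {r : ℝ} (hd : ‖d - c‖ < r) :
    ∃ φ : ℂ ≃ₜ ℂ, IsotopicId φ ∧ φ c = d ∧ ∀ z ∉ Metric.ball c r, φ z = z := by
  have hr : 0 < r := (norm_nonneg _).trans_lt hd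
  have hK : ‖d - c‖ / r < 1 := (div_lt_one hr).2 hd
  have hK0 : 0 ≤ ‖d - c‖ / r := by positivity
  have hu : LipschitzWith ⟨‖d - c‖ / r, hK0⟩
      (fun z : ℂ => ((max 0 (1 - ‖z - c‖ / r) : ℝ) : ℂ) * (d - c)) := by
    refine LipschitzWith.of_dist_le_mul fun a b => ?_
    rw [dist_eq_norm, ← sub_mul, norm_mul, ← Complex.ofReal_sub, Complex.norm_real]
    have h1 : ‖max 0 (1 - ‖a - c‖ / r) - max 0 (1 - ‖b - c‖ / r)‖
        ≤ |(1 - ‖a - c‖ / r) - (1 - ‖b - c‖ / r)| := by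
      rw [Real.norm_eq_abs]
      have := abs_max_sub_max_le_max (0 : ℝ) (1 - ‖a - c‖ / r) 0 (1 - ‖b - c‖ / r)
      simpa using this
    have h2 : |(1 - ‖a - c‖ / r) - (1 - ‖b - c‖ / r)| ≤ dist a b / r := by
      have : (1 - ‖a - c‖ / r) - (1 - ‖b - c‖ / r) = (‖b - c‖ - ‖a - c‖) / r := by ring
      rw [this, abs_div, abs_of_pos hr]
      gcongr
      have := abs_norm_sub_norm_le (b - c) (a - c)
      rw [dist_comm, dist_eq_norm]
      simpa using this
    calc _ ≤ dist a b / r * ‖d - c‖ := by gcongr; exact h1.trans h2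
      _ = ‖d - c‖ / r * dist a b := by ring
  obtain ⟨φ, hφ, hφe⟩ := exists_isotopicId_of_lipschitz (K := ⟨‖d - c‖ / r, hK0⟩) hK hu
  refine ⟨φ, hφ, by simp [hφe], fun z hz => ?_⟩
  have : 1 ≤ ‖z - c‖ / r := by
    rw [one_le_div hr]
    simpa [dist_eq_norm] using hz
  rw [hφe, max_eq_left (by linarith)]
  simp

/-- An isotopy class of the identity acts transitively on an open connected set, with support
in this set. -/
theorem exists_push {X : Set ℂ} (hX : IsOpen X) (hc : IsPreconnected X) {p q : ℂ}
    (hp : p ∈ X) (hq : q ∈ X) :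
    ∃ φ : ℂ ≃ₜ ℂ, IsotopicId φ ∧ φ p = q ∧ ∀ z ∉ X, φ z = z := by
  refine hc.induction₂' (fun p q => ∃ φ : ℂ ≃ₜ ℂ, IsotopicId φ ∧ φ p = q ∧ ∀ z ∉ X, φ z = z)
    ?_ ?_ hp hq
  · intro x hx
    obtain ⟨r, hr, hb⟩ := Metric.isOpen_iff.1 hX x hx
    filter_upwards [mem_nhdsWithin_of_mem_nhds (Metric.ball_mem_nhds x (half_pos hr))] with y hy
    rw [Metric.mem_ball, dist_eq_norm] at hy
    refine ⟨?_, ?_⟩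
    · obtain ⟨φ, h1, h2, h3⟩ := exists_ball_push (c := x) (d := y) (r := r) (by linarith)
      exact ⟨φ, h1, h2, fun z hz => h3 z fun h => hz (hb h)⟩
    · obtain ⟨φ, h1, h2, h3⟩ := exists_ball_push (c := y) (d := x) (r := r / 2)
        (by rwa [norm_sub_rev])
      refine ⟨φ, h1, h2, fun z hz => h3 z fun h => hz (hb ?_)⟩
      rw [Metric.mem_ball, dist_eq_norm] at h ⊢
      have := norm_sub_le_norm_sub_add_norm_sub z y x
      linarith
  · rintro x y z - - - ⟨φ, h1, h2, h3⟩ ⟨ψ, k1, k2, k3⟩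
    exact ⟨φ.trans ψ, h1.trans k1, by simp [h2, k2], fun w hw => by simp [h3 w hw, k3 w hw]⟩

theorem Free.mono {h : ℂ → ℂ} {X Y : Set ℂ} (hX : Free h X) (hYX : Y ⊆ X) : Free h Y :=
  fun z hz hz' => hX z (hYX hz) (hYX hz')

theorem exists_free_nhd {h : ℂ ≃ₜ ℂ} {K : Set ℂ} (hK : IsCompact K) (hc : IsConnected K)
    (hf : Free h K) : ∃ X : Set ℂ, IsOpen X ∧ IsConnected X ∧ Bornology.IsBounded X ∧
      Free h X ∧ K ⊆ X := by
  have hd : Disjoint (h '' K) K := by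
    rw [Set.disjoint_left]
    rintro _ ⟨z, hz, rfl⟩ h'
    exact hf z hz h'
  obtain ⟨δ, hδ, hdis⟩ := hd.exists_thickenings (hK.image h.continuous) hK.isClosed
  set O : Set ℂ := Metric.thickening δ K ∩ h ⁻¹' Metric.thickening δ (h '' K) with hO
  have hOo : IsOpen O :=
    Metric.isOpen_thickening.inter (Metric.isOpen_thickening.preimage h.continuous)
  have hKO : K ⊆ O := fun z hz => ⟨Metric.self_subset_thickening hδ _ hz,
    Metric.self_subset_thickening hδ _ (mem_image_of_mem _ hz)⟩
  have hOf : Free h O := fun z hz hz' => Set.disjoint_left.1 hdis hz.2 hz'.1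
  obtain ⟨x, hx⟩ := hc.nonempty
  have hs := connectedComponentIn_subset O x
  refine ⟨connectedComponentIn O x, hOo.connectedComponentIn,
    isConnected_connectedComponentIn_iff.2 (hKO hx),
    (hK.isBounded.thickening.subset (hs.trans inter_subset_left)), hOf.mono hs,
    hc.isPreconnected.subset_connectedComponentIn hx hKO⟩

/-- Around every point there is a maximal free round disc. -/
theorem exists_critical {h : ℂ ≃ₜ ℂ} (hf : ∀ z, h z ≠ z) (x : ℂ) :
    ∃ (z : ℂ) (r : ℝ), 0 < r ∧ ‖z - x‖ = r ∧ ‖h z - x‖ = r ∧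
      ∀ w, r ≤ max ‖w - x‖ ‖h w - x‖ := by
  have hc := h.continuous
  obtain ⟨z, hz⟩ := (show Continuous fun w => max ‖w - x‖ ‖h w - x‖ by fun_prop).exists_forall_le
    (by
      refine tendsto_atTop_mono (fun w => le_max_left _ _) ?_
      exact tendsto_norm_cocompact_atTop.comp
        (Homeomorph.subRight x).isClosedEmbedding.tendsto_cocompact)
  set r := max ‖z - x‖ ‖h z - x‖ with hr
  have hr0 : 0 < r := by
    by_contra! h0
    have h1 : ‖z - x‖ ≤ 0 := (le_max_left _ _).trans h0
    have h2 : ‖h z - x‖ ≤ 0 := (le_max_right _ _).trans h0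
    rw [norm_le_zero_iff, sub_eq_zero] at h1 h2
    exact hf z (h2.trans h1.symm)
  have key : ∀ u ∈ Metric.closedBall x r, ∀ U ∈ 𝓝 u, ∃ v ∈ U, ‖v - x‖ < r := by
    intro u hu U hU
    rw [← closure_ball x hr0.ne'] at hu
    obtain ⟨v, hv, hv'⟩ := mem_closure_iff_nhds.1 hu U hU
    exact ⟨v, hv, by simpa [dist_eq_norm] using hv'⟩
  refine ⟨z, r, hr0, ?_, ?_, hz⟩
  · by_contra hne
    have hlt : ‖z - x‖ < r := lt_of_le_of_ne (le_max_left _ _) hne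
    have hU : h.symm ⁻¹' Metric.ball x r ∈ 𝓝 (h z) := by
      refine (Metric.isOpen_ball.preimage h.symm.continuous).mem_nhds ?_
      simpa [dist_eq_norm] using hlt
    obtain ⟨v, hv, hv'⟩ := key (h z) (by
      rw [Metric.mem_closedBall, dist_eq_norm]; exact le_max_right _ _) _ hU
    have h1 := hz (h.symm v)
    rw [mem_preimage, Metric.mem_ball, dist_eq_norm] at hv
    rw [h.apply_symm_apply] at h1
    exact absurd h1 (not_le.2 (max_lt hv hv'))
  · by_contra hne
    have hlt : ‖h z - x‖ < r := lt_of_le_of_ne (le_max_right _ _) hne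
    have hU : h ⁻¹' Metric.ball x r ∈ 𝓝 z := by
      refine (Metric.isOpen_ball.preimage h.continuous).mem_nhds ?_
      simpa [dist_eq_norm] using hlt
    obtain ⟨v, hv, hv'⟩ := key z (by
      rw [Metric.mem_closedBall, dist_eq_norm]; exact le_max_left _ _) _ hU
    rw [mem_preimage, Metric.mem_ball, dist_eq_norm] at hv
    exact absurd (hz v) (not_le.2 (max_lt hv' hv))

theorem apply_mem_iff_of_eqOn_compl {φ : ℂ ≃ₜ ℂ} {X : Set ℂ} (hφ : ∀ z ∉ X, φ z = z) (z : ℂ) :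
    φ z ∈ X ↔ z ∈ X := by
  refine ⟨fun h => ?_, fun h => ?_⟩
  · by_contra hz
    rw [hφ z hz] at h
    exact hz h
  · by_contra hz
    have := φ.injective (hφ _ hz)
    rw [this] at hz
    exact hz h

theorem IsBrouwer.trans_of_free {h φ : ℂ ≃ₜ ℂ} (hh : IsBrouwer h) (hφ : IsotopicId φ) {X : Set ℂ}
    (hX : Free h X) (hs : ∀ z ∉ X, φ z = z) : IsBrouwer (h.trans φ) := by
  refine ⟨hh.1.trans hφ, fun w hw => ?_⟩
  rw [Homeomorph.trans_apply] at hw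
  by_cases hX' : h w ∈ X
  · have : w ∈ X := by
      rw [← hw]; exact (apply_mem_iff_of_eqOn_compl hs _).2 hX'
    exact hX w this hX'
  · rw [hs _ hX'] at hw
    exact hh.2 w hw

theorem iterate_trans_eq {h φ : ℂ ≃ₜ ℂ} {X : Set ℂ} (hs : ∀ z ∉ X, φ z = z) {x : ℂ} {m : ℕ}
    (hm : ∀ i, 0 < i → i < m → h^[i] x ∉ X) {i : ℕ} (hi : i < m) :
    (h.trans φ)^[i] x = h^[i] x := by
  induction i with
  | zero => rfl
  | succ i ih =>
    rw [Function.iterate_succ_apply', ih (by omega), Homeomorph.trans_apply,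
      ← Function.iterate_succ_apply' h, hs _ (hm _ (by omega) hi)]

theorem iterate_notMem_of_noPeriodic {N : ℕ}
    (hN : ∀ m, 1 ≤ m → m ≤ N → ∀ h : ℂ ≃ₜ ℂ, IsBrouwer h → ∀ x, h^[m] x ≠ x)
    {h : ℂ ≃ₜ ℂ} (hh : IsBrouwer h) {X : Set ℂ} (hX : IsOpen X) (hc : IsPreconnected X)
    (hf : Free h X) {m : ℕ} (hm : 1 ≤ m) (hmN : m ≤ N) : Free h^[m] X := by
  intro x hx hx'
  have hex : ∃ k, 1 ≤ k ∧ h^[k] x ∈ X := ⟨m, hm, hx'⟩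
  classical
  obtain ⟨hk1, hk2⟩ := Nat.find_spec hex
  have hmin : ∀ i, 0 < i → i < Nat.find hex → h^[i] x ∉ X := fun i hi hi' hiX =>
    Nat.find_min hex hi' ⟨hi, hiX⟩
  have hkm : Nat.find hex ≤ m := Nat.find_min' hex ⟨hm, hx'⟩
  obtain ⟨φ, hφ, hφx, hφs⟩ := exists_push hX hc hk2 hx
  refine hN _ hk1 (hkm.trans hmN) _ (hh.trans_of_free hφ hf hφs) x ?_
  obtain ⟨k, hk⟩ : ∃ k, Nat.find hex = k + 1 := ⟨_, (Nat.succ_pred_eq_of_pos hk1).symm⟩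
  rw [hk] at hmin hφx ⊢
  rw [Function.iterate_succ_apply', iterate_trans_eq hφs hmin (Nat.lt_succ_self _),
    Homeomorph.trans_apply, ← Function.iterate_succ_apply' h, hφx]

theorem segment_subset_ball_union {x a b : ℂ} {r : ℝ} (ha : ‖a - x‖ < r) (hb : ‖b - x‖ = r) :
    segment ℝ a b ⊆ Metric.ball x r ∪ {b} := by
  rintro _ ⟨s, t, hs, ht, hst, rfl⟩
  rcases hs.eq_or_lt with rfl | hs
  · right
    have : t = 1 := by linarith
    simp [this]
  · left
    rw [Metric.mem_ball, dist_eq_norm]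
    have : s • a + t • b - x = s • (a - x) + t • (b - x) := by
      have : x = (s + t) • x := by rw [hst, one_smul]
      conv_lhs => rw [this]
      module
    rw [this]
    calc _ ≤ ‖s • (a - x)‖ + ‖t • (b - x)‖ := norm_add_le _ _
      _ = s * ‖a - x‖ + t * r := by
        rw [norm_smul, norm_smul, hb, Real.norm_of_nonneg hs.le, Real.norm_of_nonneg ht]
      _ < s * r + t * r := by nlinarith
      _ = r := by rw [← add_mul, hst, one_mul]

theorem notMem_periodic {n : ℕ} (hn : 1 ≤ n) :
    ∀ h : ℂ ≃ₜ ℂ, IsBrouwer h → ∀ x, h^[n] x ≠ x := by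
  induction n using Nat.strong_induction_on with
  | _ n ih =>
  intro h hh x hx
  rcases (show n = 1 ∨ n = 2 ∨ 3 ≤ n by omega) with rfl | rfl | hn3
  · exact hh.2 x hx
  · exact hh.apply_apply_ne x hx
  have hN : ∀ m, 1 ≤ m → m ≤ n - 1 → ∀ h : ℂ ≃ₜ ℂ, IsBrouwer h → ∀ x, h^[m] x ≠ x :=
    fun m h1 h2 => ih m (by omega) h1
  obtain ⟨z, r, hr, hz, hhz, hmin⟩ := exists_critical hh.2 x
  set B := Metric.ball x r with hB
  have hBo : IsOpen B := Metric.isOpen_ball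
  have hBc : IsPreconnected B := (convex_ball x r).isPreconnected
  have hxB : x ∈ B := Metric.mem_ball_self hr
  have memB : ∀ w, w ∈ B ↔ ‖w - x‖ < r := fun w => by rw [hB, Metric.mem_ball, dist_eq_norm]
  have hzB : z ∉ B := by rw [memB, hz]; exact lt_irrefl _
  have hhzB : h z ∉ B := by rw [memB, hhz]; exact lt_irrefl _
  have hBf : Free h B := fun w hw hw' =>
    absurd (hmin w) (not_le.2 (max_lt ((memB _).1 hw) ((memB _).1 hw')))
  have hBf2 : ∀ w ∈ B, h w ∉ Metric.closedBall x r := by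
    intro w hw hw'
    rw [← closure_ball x hr.ne'] at hw'
    have hU : h.symm ⁻¹' B ∈ 𝓝 (h w) :=
      (hBo.preimage h.symm.continuous).mem_nhds (by simpa using hw)
    obtain ⟨v, hv, hv'⟩ := mem_closure_iff_nhds.1 hw' _ hU
    exact hBf _ hv (by rw [h.apply_symm_apply]; exact hv')
  have hclos := fun m h1 h2 => iterate_notMem_of_noPeriodic hN hh hBo hBc hBf (m := m) h1 h2
  have hhhz : h (h z) ∉ B := by
    intro hcon
    have hU : (fun w => h (h w)) ⁻¹' B ∈ 𝓝 z :=
      (hBo.preimage (h.continuous.comp h.continuous)).mem_nhds hcon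
    have hzc : z ∈ closure B := by
      rw [hB, closure_ball x hr.ne', Metric.mem_closedBall, dist_eq_norm, hz]
    obtain ⟨v, hv, hv'⟩ := mem_closure_iff_nhds.1 hzc _ hU
    exact hclos 2 (by norm_num) (by omega) v hv' hv
  set x' : ℂ := x + (1 / 2 : ℝ) • (h z - x) with hx'
  have hx'n : ‖x' - x‖ = r / 2 := by
    rw [hx', add_sub_cancel_left, norm_smul, hhz]; norm_num; ring
  have hx'B : x' ∈ B := by rw [memB, hx'n]; linarith
  obtain ⟨φ, hφ, hφx, hφs⟩ := exists_push hBo hBc hxB hx'B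
  have hg : IsBrouwer (h.trans φ) := hh.trans_of_free hφ hBf hφs
  set g := h.trans φ with hgdef
  have hgw : ∀ w, g w = φ (h w) := fun w => rfl
  have hgz : g z = h z := by rw [hgw, hφs _ hhzB]
  have hgB : ∀ w ∈ B, g w = h w := fun w hw => by rw [hgw, hφs _ (hBf w hw)]
  have hφB := apply_mem_iff_of_eqOn_compl hφs
  obtain ⟨k, rfl⟩ : ∃ k, n = k + 1 := ⟨n - 1, by omega⟩
  have hit : g^[k] x = h^[k] x :=
    iterate_trans_eq hφs (m := k + 1) (fun i h1 h2 => hclos i h1 (by omega) x hxB)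
      (Nat.lt_succ_self k)
  have hgy : g (g^[k] x) = x' := by
    rw [hit, hgw, ← Function.iterate_succ_apply' h, hx, hφx]
  have hS1 : segment ℝ x' (h z) ⊆ B ∪ {h z} := segment_subset_ball_union (by rw [hx'n]; linarith) hhz
  have hS2 : segment ℝ x z ⊆ B ∪ {z} := segment_subset_ball_union (by simpa using hr) hz
  set D : Set ℂ := g.symm '' segment ℝ x' (h z) ∪ segment ℝ x z with hD
  have hcs : ∀ a b : ℂ, IsCompact (segment ℝ a b) := fun a b => by
    rw [segment_eq_image_lineMap]
    exact isCompact_Icc.image AffineMap.lineMap_continuous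
  have hDK : IsCompact D := ((hcs _ _).image g.symm.continuous).union (hcs _ _)
  have hns : ∀ a b : ℂ, IsConnected (segment ℝ a b) := fun a b =>
    ⟨⟨a, left_mem_segment ℝ a b⟩, (convex_segment a b).isPreconnected⟩
  have hDc : IsConnected D := by
    refine IsConnected.union ⟨z, ⟨h z, right_mem_segment _ _ _, ?_⟩, right_mem_segment _ _ _⟩
      ((hns _ _).image _ g.symm.continuous.continuousOn) (hns _ _)
    rw [← hgz, g.symm_apply_apply]
  have hghz : g (h z) ∉ B ∪ {h z} := by
    rintro (hc | hc)
    · exact hhhz ((hφB _).1 hc)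
    · exact hg.2 (h z) hc
  have hDf : Free g D := by
    rintro w hw hw'
    have hwD : g w ∈ segment ℝ x' (h z) ∨ w ∈ segment ℝ x z := by
      rcases hw with ⟨v, hv, rfl⟩ | hw
      · left; rwa [g.apply_symm_apply]
      · right; exact hw
    have hwD' : g (g w) ∈ segment ℝ x' (h z) ∨ g w ∈ segment ℝ x z := by
      rcases hw' with ⟨v, hv, hv'⟩ | hw
      · left; rw [← hv', g.apply_symm_apply]; exact hv
      · right; exact hw
    have hB2 : ∀ w ∈ B, ∀ v ∈ B ∪ {h z}, g w = v → False := by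
      rintro w hw v hv hgv
      rw [hgB w hw] at hgv
      refine hBf2 w hw ?_
      rw [hgv, Metric.mem_closedBall, dist_eq_norm]
      rcases hv with hv | hv
      · exact ((memB _).1 hv).le
      · rw [mem_singleton_iff.1 hv, hhz]
    have hB3 : ∀ w ∈ B, ∀ v ∈ B ∪ {z}, g w = v → False := by
      rintro w hw v hv hgv
      rw [hgB w hw] at hgv
      refine hBf2 w hw ?_
      rw [hgv, Metric.mem_closedBall, dist_eq_norm]
      rcases hv with hv | hv
      · exact ((memB _).1 hv).le
      · rw [mem_singleton_iff.1 hv, hz]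
    rcases hwD with hwD | hwD <;> rcases hwD' with hwD' | hwD'
    · rcases hS1 hwD with hm | hm
      · exact hB2 _ hm _ (hS1 hwD') rfl
      · rw [mem_singleton_iff.1 hm] at hwD'
        exact hghz (hS1 hwD')
    · obtain ⟨s, hs, hs'⟩ := (segment_eq_image' ℝ x' (h z)).subset hwD
      obtain ⟨t, ht, ht'⟩ := (segment_eq_image' ℝ x z).subset hwD'
      simp only at hs' ht'
      have e : t • (z - x) = ((1 + s) / 2) • (h z - x) := by
        have := ht'.trans hs'.symm
        rw [hx'] at this
        have e2 : t • (z - x) = x + (1 / 2 : ℝ) • (h z - x)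
            + s • (h z - (x + (1 / 2 : ℝ) • (h z - x))) - x := by
          rw [← this]; module
        rw [e2]; module
      have e' := congrArg norm e
      rw [norm_smul, norm_smul, hz, hhz, Real.norm_of_nonneg ht.1,
        Real.norm_of_nonneg (by linarith [hs.1])] at e'
      have e3 := mul_right_cancel₀ hr.ne' e'
      rw [e3] at e
      have e4 := smul_right_injective ℂ (r := (1 + s) / 2) (by linarith [hs.1]) e
      exact hh.2 z (sub_left_injective e4).symm
    · rcases hS2 hwD with hm | hm
      · by_cases hgwB : h w ∈ B
        · exact hBf w hm hgwB
        · have hv := hS1 hwD'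
          rw [hgB w hm, hgw] at hv
          have : h (h w) ∉ B := hclos 2 (by norm_num) (by omega) w hm
          rw [hφs _ this] at hv
          rcases hv with hv | hv
          · exact this hv
          · have := h.injective (mem_singleton_iff.1 hv)
            exact hBf2 w hm (by rw [this, Metric.mem_closedBall, dist_eq_norm, hz])
      · rw [mem_singleton_iff.1 hm, hgz] at hwD'
        exact hghz (hS1 hwD')
    · rcases hS2 hwD with hm | hm
      · exact hB3 _ hm _ (hS2 hwD') rfl
      · rw [mem_singleton_iff.1 hm, hgz] at hwD'
        rcases hS2 hwD' with hm | hm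
        · exact hhzB hm
        · exact hh.2 z hm
  obtain ⟨X, hXo, hXc, -, hXf, hDX⟩ := exists_free_nhd hDK hDc hDf
  refine iterate_notMem_of_noPeriodic hN hg hXo hXc.isPreconnected hXf (m := k) (by omega)
    (by omega) x (hDX (Or.inr (left_mem_segment _ _ _))) (hDX (Or.inl ⟨x', left_mem_segment _ _ _, ?_⟩))
  rw [← hgy, g.symm_apply_apply]

theorem IsBrouwer.iterate_ne {h : ℂ ≃ₜ ℂ} (hh : IsBrouwer h) {n : ℕ} (hn : 1 ≤ n) (x : ℂ) :
    h^[n] x ≠ x :=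
  notMem_periodic hn h hh x

theorem IsBrouwer.free_iterate {h : ℂ ≃ₜ ℂ} (hh : IsBrouwer h) {X : Set ℂ} (hX : IsOpen X)
    (hc : IsPreconnected X) (hf : Free h X) {n : ℕ} (hn : 1 ≤ n) : Free h^[n] X :=
  iterate_notMem_of_noPeriodic (fun _ h1 _ _ hh x => hh.iterate_ne h1 x) hh hX hc hf hn le_rfl

end BrouwerPlane

namespace BrouwerPlane

/-- The function `f` has a continuous logarithm on `S`. -/
def LogOn {X : Type*} [TopologicalSpace X] (f : X → ℂ) (S : Set X) : Prop :=
  ∃ g : X → ℂ, ContinuousOn g S ∧ ∀ z ∈ S, Complex.exp (g z) = f z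

theorem LogOn.mono {X : Type*} [TopologicalSpace X] {f : X → ℂ} {S T : Set X}
    (h : LogOn f T) (hST : S ⊆ T) : LogOn f S := by
  obtain ⟨g, h1, h2⟩ := h
  exact ⟨g, h1.mono hST, fun z hz => h2 z (hST hz)⟩

theorem LogOn.union {X : Type*} [TopologicalSpace X] {f : X → ℂ} {A B : Set X}
    (hA : LogOn f A) (hB : LogOn f B) (cA : IsClosed A) (cB : IsClosed B)
    (hAB : (A ∩ B).Subsingleton) : LogOn f (A ∪ B) := by
  classical
  obtain ⟨g, g1, g2⟩ := hA
  obtain ⟨k, k1, k2⟩ := hB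
  obtain ⟨c, hc, hc'⟩ : ∃ c : ℂ, Complex.exp c = 1 ∧ ∀ z ∈ A ∩ B, k z + c = g z := by
    rcases hAB.eq_empty_or_singleton with h | ⟨x, h⟩
    · exact ⟨0, by simp, by simp [h]⟩
    · have hx : x ∈ A ∩ B := by rw [h]; rfl
      refine ⟨g x - k x, ?_, ?_⟩
      · rw [Complex.exp_sub, g2 x hx.1, k2 x hx.2, div_self]
        rw [← g2 x hx.1]; exact Complex.exp_ne_zero _
      · intro z hz
        rw [h] at hz
        rw [mem_singleton_iff.1 hz]; ring
  refine ⟨fun z => if z ∈ A then g z else k z + c, ?_, ?_⟩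
  · refine ContinuousOn.union_of_isClosed ?_ ?_ cA cB
    · exact g1.congr fun z hz => by simp [hz]
    · refine (k1.add continuousOn_const).congr (f := fun z => k z + c) fun z hz => ?_
      by_cases h : z ∈ A
      · simp [h, hc' z ⟨h, hz⟩]
      · simp [h]
  · intro z hz
    by_cases h : z ∈ A
    · simp [h, g2 z h]
    · simp [h, Complex.exp_add, hc, k2 z (hz.resolve_left h)]

theorem logOn_real {f : ℝ → ℂ} {T : Set ℝ} (hT : IsCompact T) (hf : ContinuousOn f T)
    (h0 : ∀ t ∈ T, f t ≠ 0) : LogOn f T := by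
  rcases T.eq_empty_or_nonempty with rfl | hne
  · exact ⟨0, by simp, by simp⟩
  obtain ⟨t₀, ht₀, hmin⟩ := hT.exists_isMinOn hne hf.norm
  have hm : 0 < ‖f t₀‖ := norm_pos_iff.2 (h0 t₀ ht₀)
  obtain ⟨δ, hδ, hu⟩ := Metric.uniformContinuousOn_iff.1
    (hT.uniformContinuousOn_of_continuous hf) _ hm
  obtain ⟨R, hR⟩ := hT.isBounded.subset_closedBall 0
  have step : ∀ a, LogOn f (T ∩ Icc a (a + δ / 2)) := by
    intro a
    rcases (T ∩ Icc a (a + δ / 2)).eq_empty_or_nonempty with h | ⟨b, hbT, hb⟩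
    · exact ⟨0, by simp [h], by simp [h]⟩
    have hslit : ∀ t ∈ T ∩ Icc a (a + δ / 2), f t / f b ∈ Complex.slitPlane := by
      rintro t ⟨htT, ht⟩
      suffices h : ‖f t / f b - 1‖ < 1 by simpa using Complex.mem_slitPlane_of_norm_lt_one h
      have h1 := hu t htT b hbT (by
        rw [Real.dist_eq, abs_lt]; constructor <;> linarith [ht.1, ht.2, hb.1, hb.2])
      have h2 : ‖f t₀‖ ≤ ‖f b‖ := hmin hbT
      rw [div_sub_one (h0 b hbT), norm_div, div_lt_one (norm_pos_iff.2 (h0 b hbT)),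
        ← dist_eq_norm]
      exact h1.trans_le h2
    refine ⟨fun t => Complex.log (f t / f b) + Complex.log (f b), ?_, ?_⟩
    · exact (((hf.mono inter_subset_left).div_const _).clog hslit).add continuousOn_const
    · rintro t ht
      rw [Complex.exp_add, Complex.exp_log (Complex.slitPlane_ne_zero (hslit t ht)),
        Complex.exp_log (h0 b hbT), div_mul_cancel₀ _ (h0 b hbT)]
  have hind : ∀ n : ℕ, LogOn f (T ∩ Icc (-R) (-R + n * (δ / 2))) := by
    intro n
    induction n with
    | zero =>
      refine (step (-R)).mono (inter_subset_inter_right _ (Icc_subset_Icc_right ?_))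
      simp only [Nat.cast_zero]; linarith
    | succ n ih =>
      refine (ih.union (step (-R + n * (δ / 2))) (hT.isClosed.inter isClosed_Icc)
        (hT.isClosed.inter isClosed_Icc) ?_).mono ?_
      · rintro x ⟨⟨-, hx⟩, -, hx'⟩ y ⟨⟨-, hy⟩, -, hy'⟩
        linarith [hx.2, hx'.1, hy.2, hy'.1]
      · rintro x ⟨hx, hx'⟩
        push_cast at hx'
        rcases le_total x (-R + n * (δ / 2)) with h | h
        · exact Or.inl ⟨hx, hx'.1, h⟩
        · exact Or.inr ⟨hx, h, by linarith [hx'.2]⟩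
  obtain ⟨n, hn⟩ := exists_nat_gt (2 * R / (δ / 2))
  refine (hind n).mono fun x hx => ⟨hx, ?_⟩
  have h1 := hR hx
  rw [mem_closedBall_zero_iff, Real.norm_eq_abs, abs_le] at h1
  rw [div_lt_iff₀ (by linarith)] at hn
  exact ⟨h1.1, by linarith [h1.2]⟩

theorem logOn_of_section {f : ℂ → ℂ} {M : Set ℂ} (hM : IsCompact M) (hf : ContinuousOn f M)
    (h0 : ∀ z ∈ M, f z ≠ 0) {p : ℂ → ℝ} {i : ℝ → ℂ} (hp : Continuous p) (hi : Continuous i)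
    (hip : ∀ z ∈ M, i (p z) = z) : LogOn f M := by
  have hmaps : MapsTo i (p '' M) M := by
    rintro _ ⟨z, hz, rfl⟩
    rwa [hip z hz]
  obtain ⟨g, g1, g2⟩ := logOn_real (hM.image hp) (hf.comp hi.continuousOn hmaps)
    (fun t ht => h0 _ (hmaps ht))
  refine ⟨g ∘ p, g1.comp hp.continuousOn (mapsTo_image _ _), fun z hz => ?_⟩
  rw [Function.comp_apply, g2 _ (mem_image_of_mem _ hz), Function.comp_apply, hip z hz]

theorem logOn_inter_re {f : ℂ → ℂ} {M : Set ℂ} (hM : IsCompact M) (hf : ContinuousOn f M)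
    (h0 : ∀ z ∈ M, f z ≠ 0) (a : ℝ) : LogOn f (M ∩ {z | z.re = a}) := by
  refine logOn_of_section (hM.inter_right (isClosed_eq Complex.continuous_re continuous_const))
    (hf.mono inter_subset_left) (fun z hz => h0 z hz.1) (i := fun t => (a : ℂ) + t * Complex.I)
    Complex.continuous_im (by fun_prop) ?_
  rintro z ⟨-, hz⟩
  apply Complex.ext <;> simp
  exact hz.symm

theorem logOn_inter_im {f : ℂ → ℂ} {M : Set ℂ} (hM : IsCompact M) (hf : ContinuousOn f M)
    (h0 : ∀ z ∈ M, f z ≠ 0) (a : ℝ) : LogOn f (M ∩ {z | z.im = a}) := by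
  refine logOn_of_section (hM.inter_right (isClosed_eq Complex.continuous_im continuous_const))
    (hf.mono inter_subset_left) (fun z hz => h0 z hz.1) (i := fun t => (t : ℂ) + a * Complex.I)
    Complex.continuous_re (by fun_prop) ?_
  rintro z ⟨-, hz⟩
  apply Complex.ext <;> simp
  exact hz.symm

theorem logOn_three_sides_re {f : ℂ → ℂ} {M : Set ℂ} (hM : IsCompact M) (hf : ContinuousOn f M)
    (h0 : ∀ z ∈ M, f z ≠ 0) {a b c : ℝ} (hbc : b ≠ c)
    (hs : ∀ z ∈ M, z.re = a ∨ z.im = b ∨ z.im = c) : LogOn f M := by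
  have c1 : IsClosed (M ∩ {z | z.re = a}) :=
    hM.isClosed.inter (isClosed_eq Complex.continuous_re continuous_const)
  have c2 : ∀ d, IsClosed (M ∩ {z | z.im = d}) := fun d =>
    hM.isClosed.inter (isClosed_eq Complex.continuous_im continuous_const)
  refine ((((logOn_inter_re hM hf h0 a).union (logOn_inter_im hM hf h0 b) c1 (c2 b) ?_).union
    (logOn_inter_im hM hf h0 c) (c1.union (c2 b)) (c2 c) ?_)).mono ?_
  · rintro x ⟨⟨-, hx⟩, -, hx'⟩ y ⟨⟨-, hy⟩, -, hy'⟩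
    exact Complex.ext (hx.trans hy.symm) (hx'.trans hy'.symm)
  · rintro x ⟨hx, -, hx'⟩ y ⟨hy, -, hy'⟩
    have e : ∀ x, x ∈ M ∩ {z | z.re = a} ∪ M ∩ {z | z.im = b} → x.im = c → x.re = a := by
      rintro x (⟨-, h⟩ | ⟨-, h⟩) h'
      · exact h
      · exact absurd (h.symm.trans h') hbc
    exact Complex.ext ((e x hx hx').trans (e y hy hy').symm) (hx'.trans hy'.symm)
  · intro z hz
    rcases hs z hz with h | h | h
    · exact Or.inl (Or.inl ⟨hz, h⟩)
    · exact Or.inl (Or.inr ⟨hz, h⟩)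
    · exact Or.inr ⟨hz, h⟩

theorem logOn_three_sides_im {f : ℂ → ℂ} {M : Set ℂ} (hM : IsCompact M) (hf : ContinuousOn f M)
    (h0 : ∀ z ∈ M, f z ≠ 0) {a b c : ℝ} (hbc : b ≠ c)
    (hs : ∀ z ∈ M, z.im = a ∨ z.re = b ∨ z.re = c) : LogOn f M := by
  have c1 : IsClosed (M ∩ {z | z.im = a}) :=
    hM.isClosed.inter (isClosed_eq Complex.continuous_im continuous_const)
  have c2 : ∀ d, IsClosed (M ∩ {z | z.re = d}) := fun d =>
    hM.isClosed.inter (isClosed_eq Complex.continuous_re continuous_const)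
  refine ((((logOn_inter_im hM hf h0 a).union (logOn_inter_re hM hf h0 b) c1 (c2 b) ?_).union
    (logOn_inter_re hM hf h0 c) (c1.union (c2 b)) (c2 c) ?_)).mono ?_
  · rintro x ⟨⟨-, hx⟩, -, hx'⟩ y ⟨⟨-, hy⟩, -, hy'⟩
    exact Complex.ext (hx'.trans hy'.symm) (hx.trans hy.symm)
  · rintro x ⟨hx, -, hx'⟩ y ⟨hy, -, hy'⟩
    have e : ∀ x, x ∈ M ∩ {z | z.im = a} ∪ M ∩ {z | z.re = b} → x.re = c → x.im = a := by
      rintro x (⟨-, h⟩ | ⟨-, h⟩) h'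
      · exact h
      · exact absurd (h.symm.trans h') hbc
    exact Complex.ext (hx'.trans hy'.symm) ((e x hx hx').trans (e y hy hy').symm)
  · intro z hz
    rcases hs z hz with h | h | h
    · exact Or.inl (Or.inl ⟨hz, h⟩)
    · exact Or.inl (Or.inr ⟨hz, h⟩)
    · exact Or.inr ⟨hz, h⟩

/-- A nonvanishing function extends over a closed set as soon as it has a logarithm on the
intersection. -/
theorem exists_extension_of_logOn {f : ℂ → ℂ} {A Q : Set ℂ} (hA : IsClosed A) (hQ : IsClosed Q)
    (hf : ContinuousOn f A) (h0 : ∀ z ∈ A, f z ≠ 0) (hl : LogOn f (A ∩ Q)) :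
    ∃ f' : ℂ → ℂ, ContinuousOn f' (A ∪ Q) ∧ (∀ z ∈ A ∪ Q, f' z ≠ 0) ∧ EqOn f' f A := by
  classical
  obtain ⟨g, g1, g2⟩ := hl
  obtain ⟨G, hG⟩ := ContinuousMap.exists_restrict_eq (hA.inter hQ)
    ⟨(A ∩ Q).domRestrict g, g1.domRestrict⟩
  have hG' : ∀ z ∈ A ∩ Q, G z = g z := fun z hz => DFunLike.congr_fun hG ⟨z, hz⟩
  refine ⟨fun z => if z ∈ A then f z else Complex.exp (G z), ?_, ?_, fun z hz => by simp [hz]⟩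
  · refine ContinuousOn.union_of_isClosed ?_ ?_ hA hQ
    · exact hf.congr fun z hz => by simp [hz]
    · have : Continuous fun z => Complex.exp (G z) := by fun_prop
      refine this.continuousOn.congr fun z hz => ?_
      by_cases h : z ∈ A
      · simp [h, hG' z ⟨h, hz⟩, g2 z ⟨h, hz⟩]
      · simp [h]
  · intro z hz
    by_cases h : z ∈ A
    · simp [h, h0 z h]
    · simp [h]

end BrouwerPlane

namespace BrouwerPlane

/-- The closed square of index `p` in the grid of mesh `s`. -/
def gridSq (s : ℝ) (p : ℤ × ℤ) : Set ℂ :=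
  {z | (p.1 ≤ z.re / s ∧ z.re / s ≤ p.1 + 1) ∧ (p.2 ≤ z.im / s ∧ z.im / s ≤ p.2 + 1)}

/-- Two indices of squares sharing a side. -/
def GridAdj (p q : ℤ × ℤ) : Prop :=
  (p.2 = q.2 ∧ (p.1 = q.1 + 1 ∨ q.1 = p.1 + 1)) ∨ (p.1 = q.1 ∧ (p.2 = q.2 + 1 ∨ q.2 = p.2 + 1))

theorem GridAdj.symm {p q : ℤ × ℤ} (h : GridAdj p q) : GridAdj q p := by
  unfold GridAdj at *; omega

theorem isClosed_gridSq (s : ℝ) (p : ℤ × ℤ) : IsClosed (gridSq s p) := by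
  have h1 : Continuous fun z : ℂ => z.re / s := by fun_prop
  have h2 : Continuous fun z : ℂ => z.im / s := by fun_prop
  exact (isClosed_Icc.preimage h1).inter (isClosed_Icc.preimage h2)

theorem isBounded_gridSq {s : ℝ} (hs : 0 < s) (p : ℤ × ℤ) : Bornology.IsBounded (gridSq s p) := by
  refine isBounded_iff_forall_norm_le.2 ⟨s * (|(p.1 : ℝ)| + 1) + s * (|(p.2 : ℝ)| + 1),
    fun z hz => ?_⟩
  refine (Complex.norm_le_abs_re_add_abs_im z).trans (add_le_add ?_ ?_)
  · have : |z.re / s| ≤ |(p.1 : ℝ)| + 1 := by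
      rw [abs_le]
      constructor <;> [linarith [neg_abs_le (p.1 : ℝ), hz.1.1]; linarith [le_abs_self (p.1 : ℝ), hz.1.2]]
    rwa [abs_div, abs_of_pos hs, div_le_iff₀ hs, mul_comm] at this
  · have : |z.im / s| ≤ |(p.2 : ℝ)| + 1 := by
      rw [abs_le]
      constructor <;> [linarith [neg_abs_le (p.2 : ℝ), hz.2.1]; linarith [le_abs_self (p.2 : ℝ), hz.2.2]]
    rwa [abs_div, abs_of_pos hs, div_le_iff₀ hs, mul_comm] at this

theorem isCompact_gridSq {s : ℝ} (hs : 0 < s) (p : ℤ × ℤ) : IsCompact (gridSq s p) :=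
  Metric.isCompact_of_isClosed_isBounded (isClosed_gridSq s p) (isBounded_gridSq hs p)

/-- A nonvanishing function on a union of grid squares extends to one further square with a side
which is not a side of any of these squares. -/
theorem exists_extension_gridSq {s : ℝ} (hs : 0 < s) {S : Finset (ℤ × ℤ)} {p q : ℤ × ℤ}
    (hp : p ∉ S) (hq : q ∉ S) (hpq : GridAdj p q) {f : ℂ → ℂ}
    (hf : ContinuousOn f (⋃ a ∈ S, gridSq s a)) (h0 : ∀ z ∈ ⋃ a ∈ S, gridSq s a, f z ≠ 0) :
    ∃ f' : ℂ → ℂ, ContinuousOn f' (⋃ a ∈ insert q S, gridSq s a) ∧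
      (∀ z ∈ ⋃ a ∈ insert q S, gridSq s a, f' z ≠ 0) ∧ EqOn f' f (⋃ a ∈ S, gridSq s a) := by
  rw [Finset.set_biUnion_insert, union_comm]
  set A := ⋃ a ∈ S, gridSq s a with hA
  have hAc : IsClosed A := S.finite_toSet.isClosed_biUnion fun a _ => isClosed_gridSq s a
  refine exists_extension_of_logOn hAc (isClosed_gridSq s q) hf h0 ?_
  have hM : IsCompact (A ∩ gridSq s q) := (isCompact_gridSq hs q).inter_left hAc
  have hMf := hf.mono (inter_subset_left (t := gridSq s q))
  have hM0 : ∀ z ∈ A ∩ gridSq s q, f z ≠ 0 := fun z hz => h0 z hz.1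
  have key : ∀ z ∈ A ∩ gridSq s q, ∃ a ∈ S, z ∈ gridSq s a := by
    rintro z ⟨hz, -⟩
    simpa [hA] using hz
  have hne : ∀ k : ℤ, s * k ≠ s * (k + 1) := fun k h => by
    have := mul_left_cancel₀ hs.ne' h
    linarith
  have hS : ∀ z ∈ A ∩ gridSq s q, (p.1 = q.1 → p.2 = q.2 + 1 → z.re / s = q.1 ∨ z.re / s = q.1 + 1 ∨
      z.im / s = q.2) ∧ (p.1 = q.1 → q.2 = p.2 + 1 → z.re / s = q.1 ∨ z.re / s = q.1 + 1 ∨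
      z.im / s = q.2 + 1) ∧ (p.2 = q.2 → p.1 = q.1 + 1 → z.im / s = q.2 ∨ z.im / s = q.2 + 1 ∨
      z.re / s = q.1) ∧ (p.2 = q.2 → q.1 = p.1 + 1 → z.im / s = q.2 ∨ z.im / s = q.2 + 1 ∨
      z.re / s = q.1 + 1) := by
    intro z hz
    obtain ⟨a, ha, hza⟩ := key z hz
    have hap : a ≠ p := fun h => hp (h ▸ ha)
    have haq : a ≠ q := fun h => hq (h ▸ ha)
    obtain ⟨⟨z1, z2⟩, z3, z4⟩ := hza
    obtain ⟨-, ⟨w1, w2⟩, w3, w4⟩ := hz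
    have ltc : ∀ m n : ℤ, (m : ℝ) < n + 1 → m ≤ n := fun m n h => by
      have : (m : ℝ) < ((n + 1 : ℤ) : ℝ) := by push_cast; exact h
      exact Int.lt_add_one_iff.1 (by exact_mod_cast this)
    have lec : ∀ m n : ℤ, (m : ℝ) ≤ n + 1 → m ≤ n + 1 := fun m n h => by exact_mod_cast h
    have i1 := lec _ _ (z1.trans w2)
    have i2 := lec _ _ (w1.trans z2)
    have i3 := lec _ _ (z3.trans w4)
    have i4 := lec _ _ (w3.trans z4)
    have j1 : z.re / s ≠ q.1 → q.1 ≤ a.1 := fun h =>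
      ltc _ _ ((lt_of_le_of_ne w1 (Ne.symm h)).trans_le z2)
    have j2 : z.re / s ≠ q.1 + 1 → a.1 ≤ q.1 := fun h =>
      ltc _ _ (z1.trans_lt (lt_of_le_of_ne w2 h))
    have j3 : z.im / s ≠ q.2 → q.2 ≤ a.2 := fun h =>
      ltc _ _ ((lt_of_le_of_ne w3 (Ne.symm h)).trans_le z4)
    have j4 : z.im / s ≠ q.2 + 1 → a.2 ≤ q.2 := fun h =>
      ltc _ _ (z3.trans_lt (lt_of_le_of_ne w4 h))
    have hap' : ¬ (a.1 = p.1 ∧ a.2 = p.2) := fun h => hap (Prod.ext h.1 h.2)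
    have haq' : ¬ (a.1 = q.1 ∧ a.2 = q.2) := fun h => haq (Prod.ext h.1 h.2)
    refine ⟨fun h1 h2 => ?_, fun h1 h2 => ?_, fun h1 h2 => ?_, fun h1 h2 => ?_⟩ <;>
    · by_contra! hcon
      obtain ⟨k1, k2, k3⟩ := hcon
      first
      | (have := j1 k1; have := j2 k2; have := j3 k3; omega)
      | (have := j1 k1; have := j2 k2; have := j4 k3; omega)
      | (have := j3 k1; have := j4 k2; have := j1 k3; omega)
      | (have := j3 k1; have := j4 k2; have := j2 k3; omega)
  have conv : ∀ (u k : ℝ), u / s = k → u = s * k := fun u k h => by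
    rw [← h]; field_simp
  rcases hpq with ⟨h1, h2 | h2⟩ | ⟨h1, h2 | h2⟩
  · refine logOn_three_sides_re hM hMf hM0 (hne q.2) (a := s * q.1) fun z hz => ?_
    rcases (hS z hz).2.2.1 h1 h2 with h | h | h <;> simp [conv _ _ h]
  · refine logOn_three_sides_re hM hMf hM0 (hne q.2) (a := s * (q.1 + 1)) fun z hz => ?_
    rcases (hS z hz).2.2.2 h1 h2 with h | h | h <;> simp [conv _ _ h]
  · refine logOn_three_sides_im hM hMf hM0 (hne q.1) (a := s * q.2) fun z hz => ?_
    rcases (hS z hz).1 h1 h2 with h | h | h <;> simp [conv _ _ h]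
  · refine logOn_three_sides_im hM hMf hM0 (hne q.1) (a := s * (q.2 + 1)) fun z hz => ?_
    rcases (hS z hz).2.1 h1 h2 with h | h | h <;> simp [conv _ _ h]

/-- Indices of squares from which one escapes from `G` and `T` in `n` steps. -/
def escape (G T : Set (ℤ × ℤ)) : ℕ → Set (ℤ × ℤ)
  | 0 => Tᶜ
  | n + 1 => {q | q ∉ G ∧ ∃ p ∈ escape G T n, GridAdj p q}

theorem exists_extension_of_escape {s : ℝ} (hs : 0 < s) {G T : Finset (ℤ × ℤ)} (hGT : G ⊆ T)
    (hesc : ∀ q ∈ T \ G, ∃ n, q ∈ escape (G : Set (ℤ × ℤ)) T n) {f : ℂ → ℂ}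
    (hf : ContinuousOn f (⋃ a ∈ G, gridSq s a)) (h0 : ∀ z ∈ ⋃ a ∈ G, gridSq s a, f z ≠ 0) :
    ∃ f' : ℂ → ℂ, ContinuousOn f' (⋃ a ∈ T, gridSq s a) ∧
      (∀ z ∈ ⋃ a ∈ T, gridSq s a, f' z ≠ 0) ∧ EqOn f' f (⋃ a ∈ G, gridSq s a) := by
  classical
  let d : ℤ × ℤ → ℕ := fun q => sInf {n | q ∈ escape (G : Set (ℤ × ℤ)) T n}
  have key : ∀ S : Finset (ℤ × ℤ), S ⊆ T \ G → ∃ f' : ℂ → ℂ,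
      ContinuousOn f' (⋃ a ∈ G ∪ S, gridSq s a) ∧
      (∀ z ∈ ⋃ a ∈ G ∪ S, gridSq s a, f' z ≠ 0) ∧ EqOn f' f (⋃ a ∈ G, gridSq s a) := by
    intro S
    induction S using Finset.induction_on_min_value d with
    | empty => exact fun _ => ⟨f, by simpa using hf, by simpa using h0, fun _ _ => rfl⟩
    | insert q S hqS hmin ih =>
      intro hsub
      obtain ⟨f₁, c1, c2, c3⟩ := ih ((Finset.subset_insert _ _).trans hsub)
      have hq := hsub (Finset.mem_insert_self q S)
      have hqd : q ∈ escape (G : Set (ℤ × ℤ)) T (d q) := Nat.sInf_mem (hesc q hq)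
      obtain ⟨hqT, hqG⟩ := Finset.mem_sdiff.1 hq
      obtain ⟨p, hpG, hpS, hpq⟩ : ∃ p, p ∉ G ∧ p ∉ S ∧ GridAdj p q := by
        obtain h | ⟨n, h⟩ : d q = 0 ∨ ∃ n, d q = n + 1 := by
          rcases d q with _ | n
          · exact Or.inl rfl
          · exact Or.inr ⟨n, rfl⟩
        · rw [h] at hqd
          exact absurd hqT hqd
        · rw [h] at hqd
          obtain ⟨-, p, hp, hpq⟩ := hqd
          refine ⟨p, ?_, fun hpS => ?_, hpq⟩
          · rcases n with _ | n
            · exact fun h => hp (hGT h)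
            · exact hp.1
          · have h1 := hmin p hpS
            have h2 : d p ≤ n := Nat.sInf_le hp
            omega
      obtain ⟨f', e1, e2, e3⟩ := exists_extension_gridSq hs (S := G ∪ S) (p := p) (q := q)
        (by simp [hpG, hpS]) (by simp [hqG, hqS]) hpq c1 c2
      rw [← Finset.union_insert] at e1 e2
      refine ⟨f', e1, e2, fun z hz => ?_⟩
      rw [← c3 hz]
      refine e3 ?_
      simp only [mem_iUnion] at hz ⊢
      obtain ⟨a, ha, hz⟩ := hz
      exact ⟨a, Finset.mem_union_left _ ha, hz⟩
  have := key (T \ G) le_rfl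
  rwa [Finset.union_sdiff_of_subset hGT] at this

/-- The index of a grid square containing a point. -/
noncomputable def gridIndex (s : ℝ) (z : ℂ) : ℤ × ℤ := (⌊z.re / s⌋, ⌊z.im / s⌋)

theorem mem_gridSq_gridIndex (s : ℝ) (z : ℂ) : z ∈ gridSq s (gridIndex s z) :=
  ⟨⟨Int.floor_le _, (Int.lt_floor_add_one _).le⟩, ⟨Int.floor_le _, (Int.lt_floor_add_one _).le⟩⟩

theorem eventually_mem_gridSq_gridIndex (s : ℝ) (z : ℂ) :
    ∀ᶠ w in 𝓝 z, z ∈ gridSq s (gridIndex s w) := by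
  have key : ∀ u v : ℝ, v ∈ Ioo ((⌈u⌉ : ℝ) - 1) (⌊u⌋ + 1) → (⌊v⌋ : ℝ) ≤ u ∧ u ≤ ⌊v⌋ + 1 := by
    rintro u v ⟨h1, h2⟩
    constructor
    · have : ⌊v⌋ ≤ ⌊u⌋ := by
        rw [← Int.lt_add_one_iff, Int.floor_lt]; push_cast; exact h2
      exact (Int.cast_le.2 this).trans (Int.floor_le u)
    · have : ⌈u⌉ - 1 ≤ ⌊v⌋ := by
        rw [Int.le_floor]; push_cast; exact h1.le
      have h3 : ((⌈u⌉ - 1 : ℤ) : ℝ) ≤ ⌊v⌋ := Int.cast_le.2 this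
      push_cast at h3
      linarith [Int.le_ceil u]
  have hI : ∀ u : ℝ, Ioo ((⌈u⌉ : ℝ) - 1) (⌊u⌋ + 1) ∈ 𝓝 u := fun u =>
    Ioo_mem_nhds (by linarith [Int.ceil_lt_add_one u]) (Int.lt_floor_add_one u)
  have h1 : Continuous fun z : ℂ => z.re / s := by fun_prop
  have h2 : Continuous fun z : ℂ => z.im / s := by fun_prop
  filter_upwards [h1.continuousAt (hI (z.re / s)), h2.continuousAt (hI (z.im / s))] with w k1 k2
  exact ⟨key _ _ k1, key _ _ k2⟩

theorem exists_log_of_isCompact {U : Set ℂ} (hUo : IsOpen U) (hUb : Bornology.IsBounded U)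
    (hout : ∀ z ∉ U, ∃ C : Set ℂ, IsPreconnected C ∧ ¬ Bornology.IsBounded C ∧ C ⊆ Uᶜ ∧ z ∈ C)
    {f : ℂ → ℂ} (hf : ContinuousOn f U) (h0 : ∀ z ∈ U, f z ≠ 0) {K : Set ℂ} (hK : IsCompact K)
    (hKU : K ⊆ U) : ∃ g : ℂ → ℂ, Continuous g ∧ ∀ z ∈ K, Complex.exp (g z) = f z := by
  classical
  obtain ⟨δ, hδ, hthick⟩ := hK.exists_cthickening_subset_open hUo hKU
  obtain ⟨R, hR0, hR⟩ := hUb.exists_pos_norm_le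
  obtain ⟨s, hs, hsδ⟩ : ∃ s : ℝ, 0 < s ∧ s + s = δ := ⟨δ / 2, half_pos hδ, add_halves δ⟩
  obtain ⟨M, hM⟩ := exists_nat_gt (R / s)
  set T : Finset (ℤ × ℤ) := Finset.Icc (-(M : ℤ)) M ×ˢ Finset.Icc (-(M : ℤ)) M with hT
  set G := T.filter fun a => gridSq s a ⊆ U with hG
  have hGU : ∀ a ∈ G, gridSq s a ⊆ U := fun a ha => (Finset.mem_filter.1 ha).2
  have hfl : ∀ u : ℝ, |u| ≤ R → ⌊u / s⌋ ∈ Finset.Icc (-(M : ℤ)) M := by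
    intro u hu
    rw [abs_le] at hu
    have h1 : u / s ≤ R / s := by gcongr; exact hu.2
    have h2 : -(R / s) ≤ u / s := by rw [← neg_div]; gcongr; exact hu.1
    rw [Finset.mem_Icc, Int.le_floor]
    refine ⟨by push_cast; linarith, ?_⟩
    have : (⌊u / s⌋ : ℝ) ≤ (M : ℤ) := by push_cast; linarith [Int.floor_le (u / s)]
    exact_mod_cast this
  have hidx : ∀ z : ℂ, |z.re| ≤ R → |z.im| ≤ R → gridIndex s z ∈ T := fun z h1 h2 =>
    Finset.mem_product.2 ⟨hfl _ h1, hfl _ h2⟩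
  have hidx' : ∀ z ∈ U, gridIndex s z ∈ T := fun z hz => hidx z
    ((Complex.abs_re_le_norm z).trans (hR z hz)) ((Complex.abs_im_le_norm z).trans (hR z hz))
  have hKG : K ⊆ ⋃ a ∈ G, gridSq s a := by
    intro z hz
    refine mem_biUnion (x := gridIndex s z) (Finset.mem_filter.2 ⟨hidx' z (hKU hz), ?_⟩)
      (mem_gridSq_gridIndex s z)
    intro w hw
    refine hthick (Metric.mem_cthickening_of_dist_le w z δ K hz ?_)
    rw [dist_eq_norm, ← hsδ]
    refine (Complex.norm_le_abs_re_add_abs_im _).trans (add_le_add ?_ ?_)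
    · have h1 := hw.1
      have h2 := (mem_gridSq_gridIndex s z).1
      have : |(w - z).re / s| ≤ 1 := by
        rw [Complex.sub_re, sub_div, abs_le]
        constructor <;> linarith [h1.1, h1.2, h2.1, h2.2]
      rwa [abs_div, abs_of_pos hs, div_le_one hs] at this
    · have h1 := hw.2
      have h2 := (mem_gridSq_gridIndex s z).2
      have : |(w - z).im / s| ≤ 1 := by
        rw [Complex.sub_im, sub_div, abs_le]
        constructor <;> linarith [h1.1, h1.2, h2.1, h2.2]
      rwa [abs_div, abs_of_pos hs, div_le_one hs] at this
  let Adj' : ℤ × ℤ → ℤ × ℤ → Prop := fun p q => p ∉ G ∧ q ∉ G ∧ GridAdj p q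
  have hA : ∀ z ∉ U, ∀ p q, z ∈ gridSq s p → z ∈ gridSq s q → Relation.ReflTransGen Adj' p q := by
    intro z hz p q hp hq
    have hbad : ∀ a, z ∈ gridSq s a → a ∉ G := fun a ha haG => hz (hGU a haG ha)
    have hm : z ∈ gridSq s (q.1, p.2) := ⟨hq.1, hp.2⟩
    have lec : ∀ m n : ℤ, (m : ℝ) ≤ n + 1 → m ≤ n + 1 := fun m n h => by exact_mod_cast h
    have i1 := lec _ _ (hp.1.1.trans hq.1.2)
    have i2 := lec _ _ (hq.1.1.trans hp.1.2)
    have i3 := lec _ _ (hp.2.1.trans hq.2.2)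
    have i4 := lec _ _ (hq.2.1.trans hp.2.2)
    have s1 : Relation.ReflTransGen Adj' p (q.1, p.2) := by
      by_cases h : p.1 = q.1
      · rw [← h]
      · exact Relation.ReflTransGen.single ⟨hbad _ hp, hbad _ hm, Or.inl ⟨rfl, by simp only; omega⟩⟩
    have s2 : Relation.ReflTransGen Adj' (q.1, p.2) q := by
      by_cases h : p.2 = q.2
      · rw [h]
      · exact Relation.ReflTransGen.single ⟨hbad _ hm, hbad _ hq, Or.inr ⟨rfl, by simp only; omega⟩⟩
    exact s1.trans s2
  have hC : ∀ p q, p ∉ T → Relation.ReflTransGen Adj' q p →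
      ∃ n, q ∈ escape (G : Set (ℤ × ℤ)) T n := by
    intro p q hp h
    induction h using Relation.ReflTransGen.head_induction_on with
    | refl => exact ⟨0, hp⟩
    | head h _ ih =>
      obtain ⟨n, hn⟩ := ih
      exact ⟨n + 1, h.1, _, hn, h.2.2.symm⟩
  obtain ⟨F, F1, F2, F3⟩ := exists_extension_of_escape hs (G := G) (T := T)
    (Finset.filter_subset _ _) (by
      intro q hq
      obtain ⟨hqT, hqG⟩ := Finset.mem_sdiff.1 hq
      have : ¬ gridSq s q ⊆ U := fun h => hqG (Finset.mem_filter.2 ⟨hqT, h⟩)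
      obtain ⟨w, hwq, hwU⟩ := not_subset.1 this
      obtain ⟨C, hCc, hCb, hCU, hwC⟩ := hout w hwU
      obtain ⟨w', hw'C, hw'⟩ : ∃ w' ∈ C, s * (M + 1) + s * (M + 1) < ‖w'‖ := by
        by_contra! hcon
        exact hCb (isBounded_iff_forall_norm_le.2 ⟨_, hcon⟩)
      have h1 := hCc.induction₂' (fun x y => Relation.ReflTransGen Adj' (gridIndex s x) (gridIndex s y))
        (fun x hx => by
          filter_upwards [mem_nhdsWithin_of_mem_nhds (eventually_mem_gridSq_gridIndex s x)] with y hy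
          exact ⟨hA x (hCU hx) _ _ (mem_gridSq_gridIndex s x) hy,
            hA x (hCU hx) _ _ hy (mem_gridSq_gridIndex s x)⟩)
        (fun x y z _ _ _ h1 h2 => h1.trans h2) hwC hw'C
      refine hC (gridIndex s w') q ?_ ((hA w hwU _ _ hwq (mem_gridSq_gridIndex s w)).trans h1)
      intro hT'
      obtain ⟨t1, t2⟩ := Finset.mem_product.1 hT'
      rw [Finset.mem_Icc] at t1 t2
      have hbd : ∀ (u : ℝ), -(M : ℤ) ≤ ⌊u / s⌋ → ⌊u / s⌋ ≤ M → |u| ≤ s * (M + 1) := by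
        intro u h1 h2
        have h1' : ((-(M : ℤ) : ℤ) : ℝ) ≤ ⌊u / s⌋ := Int.cast_le.2 h1
        have h2' : (⌊u / s⌋ : ℝ) ≤ (M : ℤ) := Int.cast_le.2 h2
        push_cast at h1' h2'
        have : |u / s| ≤ M + 1 := by
          rw [abs_le]
          constructor <;> linarith [Int.floor_le (u / s), Int.lt_floor_add_one (u / s)]
        rwa [abs_div, abs_of_pos hs, div_le_iff₀ hs, mul_comm] at this
      have := Complex.norm_le_abs_re_add_abs_im w'
      linarith [hbd _ t1.1 t1.2, hbd _ t2.1 t2.2])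
    (hf.mono (iUnion₂_subset hGU)) (fun z hz => h0 z (iUnion₂_subset hGU hz))
  let c : ℂ → ℂ := fun z =>
    ((max (-R) (min R z.re) : ℝ) : ℂ) + ((max (-R) (min R z.im) : ℝ) : ℂ) * Complex.I
  have hc : Continuous c := by fun_prop
  have hcl : ∀ u : ℝ, |max (-R) (min R u)| ≤ R := fun u => by
    rw [abs_le]; exact ⟨le_max_left _ _, max_le (by linarith) (min_le_left _ _)⟩
  have hcT : ∀ z, c z ∈ ⋃ a ∈ T, gridSq s a := fun z =>
    mem_biUnion (x := gridIndex s (c z))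
      (hidx _ (by simpa [c] using hcl z.re) (by simpa [c] using hcl z.im))
      (mem_gridSq_gridIndex s _)
  obtain ⟨g, hg, hge⟩ := exists_log (A := ℂ) (f := fun z => F (c z))
    (F1.comp_continuous hc hcT) (fun z => F2 _ (hcT z))
  refine ⟨g, hg, fun z hz => ?_⟩
  have hcz : c z = z := by
    have e : ∀ u : ℝ, |u| ≤ R → max (-R) (min R u) = u := fun u hu => by
      rw [abs_le] at hu
      rw [min_eq_right hu.2, max_eq_right hu.1]
    simp only [c]
    rw [e _ ((Complex.abs_re_le_norm z).trans (hR z (hKU hz))),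
      e _ ((Complex.abs_im_le_norm z).trans (hR z (hKU hz))), Complex.re_add_im]
  rw [hge, hcz, F3 (hKG hz)]

/-- A bounded domain of the plane all whose complementary points are connected to infinity in the
complement carries logarithms. -/
theorem hasLog_of_outer {U : Set ℂ} (hUo : IsOpen U) (hUb : Bornology.IsBounded U)
    (hUc : IsConnected U)
    (hout : ∀ z ∉ U, ∃ C : Set ℂ, IsPreconnected C ∧ ¬ Bornology.IsBounded C ∧ C ⊆ Uᶜ ∧ z ∈ C) :
    HasLog U := by
  intro f hf h0
  obtain ⟨z₀, hz₀⟩ := hUc.nonempty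
  have hpc : IsPathConnected U := hUo.isConnected_iff_isPathConnected.1 hUc
  have hKex : ∀ z ∈ U, ∃ K : Set ℂ, IsCompact K ∧ IsPreconnected K ∧ K ⊆ U ∧ z₀ ∈ K ∧ K ∈ 𝓝 z := by
    intro z hz
    obtain ⟨γ, hγ⟩ := hpc.joinedIn z₀ hz₀ z hz
    obtain ⟨r, hr, hb⟩ := Metric.nhds_basis_closedBall.mem_iff.1 (hUo.mem_nhds hz)
    refine ⟨range γ ∪ Metric.closedBall z r, (isCompact_range γ.continuous).union
      (isCompact_closedBall z r), ?_, union_subset (range_subset_iff.2 hγ) hb,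
      Or.inl ⟨0, γ.source⟩, mem_of_superset (Metric.closedBall_mem_nhds z hr) subset_union_right⟩
    exact (isPreconnected_range γ.continuous).union z ⟨1, γ.target⟩
      (Metric.mem_closedBall_self hr.le) (convex_closedBall z r).isPreconnected
  have hg : ∀ K : Set ℂ, IsCompact K → K ⊆ U → z₀ ∈ K → ∃ g : ℂ → ℂ, Continuous g ∧
      (∀ z ∈ K, Complex.exp (g z) = f z) ∧ g z₀ = Complex.log (f z₀) := by
    intro K hK hKU hzK
    obtain ⟨g, g1, g2⟩ := exists_log_of_isCompact hUo hUb hout hf h0 hK hKU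
    refine ⟨fun z => g z - g z₀ + Complex.log (f z₀), by fun_prop, fun z hz => ?_, by ring⟩
    rw [Complex.exp_add, Complex.exp_sub, g2 z hz, g2 _ hzK, Complex.exp_log (h0 _ hz₀),
      div_mul_cancel₀ _ (h0 _ hz₀)]
  choose! K K1 K2 K3 K4 K5 using hKex
  choose! g g1 g2 g3 using hg
  have huniq : ∀ L L' : Set ℂ, IsCompact L → IsCompact L' → IsPreconnected L → L ⊆ L' → L' ⊆ U →
      z₀ ∈ L → ∀ z ∈ L, g L z = g L' z := by
    intro L L' h1 h1' h2 h3 h3' h4 z hz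
    have := log_sub_const h2 (g1 L h1 (h3.trans h3') h4).continuousOn
      (g1 L' h1' h3' (h3 h4)).continuousOn (fun x hx => by
        rw [g2 L h1 (h3.trans h3') h4 x hx, g2 L' h1' h3' (h3 h4) x (h3 hx)]) hz h4
    rw [g3 L h1 (h3.trans h3') h4, g3 L' h1' h3' (h3 h4), sub_self, sub_eq_zero] at this
    exact this
  have hagree : ∀ z ∈ U, ∀ w ∈ U, w ∈ K z → g (K w) w = g (K z) w := by
    intro z hz w hw hwz
    have hc := (K1 z hz).union (K1 w hw)
    have hs : K z ∪ K w ⊆ U := union_subset (K3 z hz) (K3 w hw)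
    rw [huniq (K z) (K z ∪ K w) (K1 z hz) hc (K2 z hz) subset_union_left hs (K4 z hz) w hwz,
      huniq (K w) (K z ∪ K w) (K1 w hw) hc (K2 w hw) subset_union_right hs (K4 w hw) w
        (mem_of_mem_nhds (K5 w hw))]
  refine ⟨fun z => g (K z) z, fun z hz => ?_, fun z hz =>
    g2 (K z) (K1 z hz) (K3 z hz) (K4 z hz) z (mem_of_mem_nhds (K5 z hz))⟩
  refine ContinuousAt.continuousWithinAt ?_
  refine ((g1 (K z) (K1 z hz) (K3 z hz) (K4 z hz)).continuousAt).congr ?_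
  filter_upwards [K5 z hz, hUo.mem_nhds hz] with w hw hwU
  exact (hagree z hz w hwU hw).symm

end BrouwerPlane

namespace BrouwerPlane

/-- The union of the unbounded connected pieces of the complement of a set. -/
def outer (X : Set ℂ) : Set ℂ :=
  {w | ∃ C : Set ℂ, IsPreconnected C ∧ ¬ Bornology.IsBounded C ∧ C ⊆ Xᶜ ∧ w ∈ C}

/-- A set together with the bounded pieces of its complement. -/
def fill (X : Set ℂ) : Set ℂ := (outer X)ᶜ

theorem subset_outer {X C : Set ℂ} (h1 : IsPreconnected C) (h2 : ¬ Bornology.IsBounded C)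
    (h3 : C ⊆ Xᶜ) : C ⊆ outer X := fun _ hw => ⟨C, h1, h2, h3, hw⟩

theorem outer_subset_compl (X : Set ℂ) : outer X ⊆ Xᶜ := by
  rintro w ⟨C, -, -, h, hw⟩
  exact h hw

theorem subset_fill (X : Set ℂ) : X ⊆ fill X := fun _ hw h => outer_subset_compl X h hw

theorem isPreconnected_le_norm (R : ℝ) : IsPreconnected {w : ℂ | R ≤ ‖w‖} := by
  by_cases hR : R ≤ 0
  · have : {w : ℂ | R ≤ ‖w‖} = univ := by
      ext w; simp [hR.trans (norm_nonneg w)]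
    rw [this]; exact isPreconnected_univ
  have : {w : ℂ | R ≤ ‖w‖} = (fun z : ℂ => Complex.exp z) '' {z : ℂ | Real.log R ≤ z.re} := by
    ext w
    simp only [mem_ofPred_eq, mem_image]
    constructor
    · intro h
      have hw : w ≠ 0 := by
        rintro rfl; simp at h; exact hR h
      refine ⟨Complex.log w, ?_, Complex.exp_log hw⟩
      rw [Complex.log_re]
      exact Real.log_le_log (not_le.1 hR) h
    · rintro ⟨z, hz, rfl⟩
      rw [Complex.norm_exp]
      exact (Real.log_le_iff_le_exp (not_le.1 hR)).1 hz
  rw [this]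
  exact ((convex_halfSpace_re_ge _).isPreconnected).image _ Complex.continuous_exp.continuousOn

theorem not_isBounded_le_norm (R : ℝ) : ¬ Bornology.IsBounded {w : ℂ | R ≤ ‖w‖} := by
  intro h
  obtain ⟨M, hM⟩ := h.exists_norm_le
  have := hM ((max R (|M|+1) : ℝ) : ℂ) (by
    simp only [mem_ofPred_eq, Complex.norm_real, Real.norm_eq_abs]
    exact (le_max_left _ _).trans (le_abs_self _))
  simp only [Complex.norm_real, Real.norm_eq_abs] at this
  have h2 := (le_max_right R (|M|+1)).trans (le_abs_self _)
  have := le_abs_self M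
  linarith

theorem le_norm_subset_outer {X : Set ℂ} {R : ℝ} (hX : ∀ z ∈ X, ‖z‖ < R) :
    {w : ℂ | R ≤ ‖w‖} ⊆ outer X :=
  subset_outer (isPreconnected_le_norm R) (not_isBounded_le_norm R)
    fun w hw hwX => absurd (hX w hwX) (not_lt.2 hw)

theorem exists_norm_lt {X : Set ℂ} (hX : Bornology.IsBounded X) : ∃ R : ℝ, ∀ z ∈ X, ‖z‖ < R := by
  obtain ⟨M, hM⟩ := hX.exists_norm_le
  exact ⟨M + 1, fun z hz => by linarith [hM z hz]⟩

section
variable {X Y : Set ℂ}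

theorem isPreconnected_outer (hX : Bornology.IsBounded X) : IsPreconnected (outer X) := by
  obtain ⟨R, hR⟩ := exists_norm_lt hX
  have hsub := le_norm_subset_outer hR
  have h0 : ((max R 0 : ℝ) : ℂ) ∈ {w : ℂ | R ≤ ‖w‖} := by
    simp [abs_of_nonneg]
  refine isPreconnected_of_forall ((max R 0 : ℝ) : ℂ) ?_
  rintro w ⟨C, h1, h2, h3, hw⟩
  have hne : (C ∩ {w : ℂ | R ≤ ‖w‖}).Nonempty := by
    by_contra hcon
    apply h2
    refine (Metric.isBounded_ball (x := (0:ℂ)) (r := R)).subset fun z hz => ?_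
    rw [mem_ball_zero_iff]
    by_contra hc
    exact hcon ⟨z, hz, not_lt.1 hc⟩
  obtain ⟨v, hv, hv'⟩ := hne
  exact ⟨C ∪ {w : ℂ | R ≤ ‖w‖}, union_subset (subset_outer h1 h2 h3) hsub, Or.inr h0, Or.inl hw,
    IsPreconnected.union v hv hv' h1 (isPreconnected_le_norm R)⟩

theorem not_isBounded_outer (hX : Bornology.IsBounded X) : ¬ Bornology.IsBounded (outer X) := by
  obtain ⟨R, hR⟩ := exists_norm_lt hX
  exact fun h => not_isBounded_le_norm R (h.subset (le_norm_subset_outer hR))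

theorem isClosed_outer (hXo : IsOpen X) (hX : Bornology.IsBounded X) : IsClosed (outer X) := by
  refine isClosed_of_closure_subset ?_
  refine subset_outer (isPreconnected_outer hX).closure
    (fun h => not_isBounded_outer hX (h.subset subset_closure)) ?_
  exact closure_minimal (outer_subset_compl X) hXo.isClosed_compl

theorem isOpen_fill (hXo : IsOpen X) (hX : Bornology.IsBounded X) : IsOpen (fill X) :=
  (isClosed_outer hXo hX).isOpen_compl

theorem isBounded_fill (hX : Bornology.IsBounded X) : Bornology.IsBounded (fill X) := by
  obtain ⟨R, hR⟩ := exists_norm_lt hX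
  refine (Metric.isBounded_ball (x := (0:ℂ)) (r := R)).subset fun z hz => ?_
  rw [mem_ball_zero_iff]
  by_contra hc
  exact hz (le_norm_subset_outer hR (not_lt.1 hc))

theorem subset_outer_of_inter {C : Set ℂ} (hX : Bornology.IsBounded X) (hC : IsPreconnected C)
    (h : (C ∩ outer X).Nonempty) (hCX : C ⊆ Xᶜ) : C ⊆ outer X := by
  obtain ⟨v, h1, h2⟩ := h
  refine subset_union_left.trans (subset_outer (C := C ∪ outer X)
    (IsPreconnected.union v h1 h2 hC (isPreconnected_outer hX))
    (fun h => not_isBounded_outer hX (h.subset subset_union_right))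
    (union_subset hCX (outer_subset_compl X)))

theorem not_isClopen_of_isBounded {Q : Set ℂ} (hQ : Bornology.IsBounded Q) (hne : Q.Nonempty) :
    ¬ IsClopen Q := by
  intro h
  rcases isClopen_iff.1 h with h | h
  · exact hne.ne_empty h
  · rw [h] at hQ
    exact not_isBounded_le_norm 0 (hQ.subset (subset_univ _))

theorem isConnected_fill (hXo : IsOpen X) (hX : Bornology.IsBounded X) (hXc : IsConnected X) :
    IsConnected (fill X) := by
  refine ⟨hXc.nonempty.mono (subset_fill X), ?_⟩
  have key : ∀ A B : Set ℂ, IsOpen A → IsOpen B → fill X ⊆ A ∪ B → Disjoint A B → X ⊆ A →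
      fill X ⊆ A := by
    intro A B hA hB hAB hd hXA z hz
    rcases hAB hz with h | h
    · exact h
    exfalso
    -- the part of the complement of `A` inside `fill X` together with the outer part
    set S : Set ℂ := (A ∩ fill X)ᶜ with hS
    have hSc : IsClosed S := (hA.inter (isOpen_fill hXo hX)).isClosed_compl
    have hSp : IsPreconnected S := by
      rw [isPreconnected_iff_subset_of_fully_disjoint_closed hSc]
      intro u v hu hv huv hduv
      have main : ∀ u v : Set ℂ, IsClosed u → IsClosed v → S ⊆ u ∪ v → Disjoint u v →
          outer X ⊆ u → S ⊆ u := by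
        intro u v hu hv huv hduv hou w hw
        by_contra hwu
        have hwv : w ∈ v := (huv hw).resolve_left hwu
        have hsub : S ∩ v ⊆ fill X := fun q hq hq' => disjoint_left.1 hduv (hou hq') hq.2
        refine not_isClopen_of_isBounded (Q := S ∩ v) ((isBounded_fill hX).subset hsub)
          ⟨w, hw, hwv⟩ ⟨hSc.inter hv, ?_⟩
        have : S ∩ v = B ∩ fill X ∩ uᶜ := by
          ext q
          constructor
          · intro hq
            have hqf := hsub hq
            exact ⟨⟨(hAB hqf).resolve_left fun hqA => hq.1 ⟨hqA, hqf⟩, hqf⟩,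
              fun hqu => disjoint_left.1 hduv hqu hq.2⟩
          · rintro ⟨⟨h1, h2⟩, h3⟩
            have hqS : q ∈ S := fun h => disjoint_left.1 hd h.1 h1
            exact ⟨hqS, (huv hqS).resolve_left h3⟩
        rw [this]
        exact (hB.inter (isOpen_fill hXo hX)).inter hu.isOpen_compl
      have hoS : outer X ⊆ S := fun q hq h => h.2 hq
      rcases (isPreconnected_iff_subset_of_fully_disjoint_closed (isClosed_outer hXo hX)).1
        (isPreconnected_outer hX) u v hu hv (hoS.trans huv) hduv with h | h
      · exact Or.inl (main u v hu hv huv hduv h)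
      · exact Or.inr (main v u hv hu (by rwa [union_comm]) hduv.symm h)
    have hzS : z ∈ S := fun h' => disjoint_left.1 hd h'.1 h
    refine hz (subset_outer hSp (fun hb => not_isBounded_outer hX (hb.subset
      fun q hq h => h.2 hq)) (fun q hq hqX => hq ⟨hXA hqX, subset_fill X hqX⟩) hzS)
  intro A B hA hB hAB hne1 hne2
  by_contra hcon
  -- pass to disjoint open sets inside `fill X`
  set A' := A ∩ fill X
  set B' := B ∩ fill X
  have hA' : IsOpen A' := hA.inter (isOpen_fill hXo hX)
  have hB' : IsOpen B' := hB.inter (isOpen_fill hXo hX)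
  have hd : Disjoint A' B' := disjoint_left.2 fun z h1 h2 => hcon ⟨z, h1.2, h1.1, h2.1⟩
  have hAB' : fill X ⊆ A' ∪ B' := fun z hz => (hAB hz).imp (fun h => ⟨h, hz⟩) (fun h => ⟨h, hz⟩)
  have hX' : X ⊆ A' ∪ B' := (subset_fill X).trans hAB'
  rcases hXc.isPreconnected.subset_or_subset hA' hB' hd hX' with h | h
  · have := key A' B' hA' hB' hAB' hd h
    obtain ⟨w, hw1, hw2⟩ := hne2
    exact hcon ⟨w, hw1, (this hw1).1, hw2⟩
  · have := key B' A' hB' hA' (by rwa [union_comm]) hd.symm h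
    obtain ⟨w, hw1, hw2⟩ := hne1
    exact hcon ⟨w, hw1, hw2, (this hw1).1⟩

theorem hasLog_fill (hXo : IsOpen X) (hX : Bornology.IsBounded X) (hXc : IsConnected X) :
    HasLog (fill X) := by
  refine hasLog_of_outer (isOpen_fill hXo hX) (isBounded_fill hX) (isConnected_fill hXo hX hXc) ?_
  intro z hz
  exact ⟨outer X, isPreconnected_outer hX, not_isBounded_outer hX, by simp [fill], not_not.1 hz⟩

theorem frontier_fill_subset (hXo : IsOpen X) (hX : Bornology.IsBounded X) :
    frontier (fill X) ⊆ closure X := by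
  intro w hw
  rw [(isOpen_fill hXo hX).frontier_eq] at hw
  by_contra hc
  have hnhds : (closure X)ᶜ ∈ 𝓝 w := isClosed_closure.isOpen_compl.mem_nhds hc
  obtain ⟨ε, hε, hb⟩ := Metric.mem_nhds_iff.1 hnhds
  have hsub : Metric.ball w ε ⊆ outer X :=
    subset_outer_of_inter hX (convex_ball w ε).isPreconnected
      ⟨w, Metric.mem_ball_self hε, not_not.1 hw.2⟩ fun z hz hzX => hb hz (subset_closure hzX)
  obtain ⟨z, hz1, hz2⟩ := mem_closure_iff_nhds.1 hw.1 _ (Metric.ball_mem_nhds w hε)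
  exact hz2 (hsub hz1)

theorem isBounded_image_homeo (h : ℂ ≃ₜ ℂ) (hX : Bornology.IsBounded X) :
    Bornology.IsBounded (h '' X) :=
  ((hX.isCompact_closure.image h.continuous).isBounded).subset (image_mono subset_closure)

theorem image_outer_subset (h : ℂ ≃ₜ ℂ) (X : Set ℂ) : h '' outer X ⊆ outer (h '' X) := by
  rintro _ ⟨w, ⟨C, h1, h2, h3, hw⟩, rfl⟩
  refine ⟨h '' C, h1.image _ h.continuous.continuousOn, fun hb => h2 ?_, ?_, mem_image_of_mem _ hw⟩
  · have := isBounded_image_homeo h.symm hb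
    simpa only [image_image, h.symm_apply_apply, image_id'] using this
  · rw [← image_compl_eq h.bijective]
    exact image_mono h3

theorem image_outer (h : ℂ ≃ₜ ℂ) (X : Set ℂ) : h '' outer X = outer (h '' X) := by
  refine (image_outer_subset h X).antisymm ?_
  have := image_mono (f := h) (image_outer_subset h.symm (h '' X))
  simpa only [image_image, h.symm_apply_apply, h.apply_symm_apply, image_id'] using this

theorem image_fill (h : ℂ ≃ₜ ℂ) (X : Set ℂ) : h '' fill X = fill (h '' X) := by
  rw [fill, fill, image_compl_eq h.bijective, image_outer]

theorem subset_or_disjoint_of_frontier {A B : Set ℂ} (hA : IsPreconnected A) (hB : IsOpen B)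
    (h : Disjoint A (frontier B)) : A ⊆ B ∨ Disjoint A B := by
  have hcov : A ⊆ B ∪ (closure B)ᶜ := by
    intro z hz
    by_contra hc
    simp only [mem_union, mem_compl_iff, not_or, not_not] at hc
    refine disjoint_left.1 h hz ?_
    rw [hB.frontier_eq]
    exact ⟨hc.2, hc.1⟩
  rcases hA.subset_or_subset (u := B) (v := (closure B)ᶜ) hB isClosed_closure.isOpen_compl
    (disjoint_left.2 fun z h1 h2 => h2 (subset_closure h1)) hcov with h' | h'
  · exact Or.inl h'
  · exact Or.inr (disjoint_left.2 fun z h1 h2 => h' h1 (subset_closure h2))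

theorem closure_fill_subset_fill (hXo : IsOpen X) (hX : Bornology.IsBounded X)
    (hYo : IsOpen Y) (hY : Bornology.IsBounded Y) (hYc : IsConnected Y) (hd : Disjoint X Y)
    (h : Y ⊆ fill X) : closure (fill Y) ⊆ fill X := by
  obtain ⟨p, hp⟩ := hYc.nonempty
  have hYX : Y ⊆ Xᶜ := fun z hz hzX => disjoint_left.1 hd hzX hz
  set K := connectedComponentIn Xᶜ p
  have hKp : IsPreconnected K := isPreconnected_connectedComponentIn
  have hKX : K ⊆ Xᶜ := connectedComponentIn_subset _ _
  have hYK : Y ⊆ K := hYc.isPreconnected.subset_connectedComponentIn hp hYX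
  have hKf : K ⊆ fill X := fun z hz hzo =>
    h hp (subset_outer_of_inter hX hKp ⟨z, hz, hzo⟩ hKX (hYK hp))
  have hKcl : IsClosed K := isClosed_of_closure_subset <|
    hKp.closure.subset_connectedComponentIn (subset_closure (hYK hp))
      (closure_minimal hKX hXo.isClosed_compl)
  have h1 : fill Y ⊆ fill X := compl_subset_compl.2 <|
    subset_outer (isPreconnected_outer hX) (not_isBounded_outer hX) fun z hz hzY => h hzY hz
  rw [closure_eq_self_union_frontier]
  refine union_subset h1 ((frontier_fill_subset hYo hY).trans ?_)
  exact (closure_minimal hYK hKcl).trans hKf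

theorem fill_trichotomy (hXo : IsOpen X) (hX : Bornology.IsBounded X) (hXc : IsConnected X)
    (hYo : IsOpen Y) (hY : Bornology.IsBounded Y) (hYc : IsConnected Y) (hd : Disjoint X Y) :
    Disjoint (fill X) (fill Y) ∨ closure (fill Y) ⊆ fill X ∨ closure (fill X) ⊆ fill Y := by
  have aux : ∀ X Y : Set ℂ, IsOpen X → Bornology.IsBounded X → IsOpen Y → IsConnected Y →
      Disjoint X Y → Y ⊆ fill X ∨ Disjoint Y (fill X) := by
    intro X Y hXo hX hYo hYc hd
    refine subset_or_disjoint_of_frontier hYc.isPreconnected (isOpen_fill hXo hX) ?_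
    exact ((hd.closure_left hYo).symm).mono_right (frontier_fill_subset hXo hX)
  rcases aux X Y hXo hX hYo hYc hd with h | h
  · exact Or.inr (Or.inl (closure_fill_subset_fill hXo hX hYo hY hYc hd h))
  rcases aux Y X hYo hY hXo hXc hd.symm with h' | h'
  · exact Or.inr (Or.inr (closure_fill_subset_fill hYo hY hXo hX hXc hd.symm h'))
  left
  have hfr : Disjoint (fill X) (frontier (fill Y)) := by
    have : closure Y ⊆ outer X := closure_minimal
      (fun z hz => not_not.1 (disjoint_left.1 h hz)) (isClosed_outer hXo hX)
    exact disjoint_left.2 fun z h1 h2 => h1 (this (frontier_fill_subset hYo hY h2))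
  rcases subset_or_disjoint_of_frontier (isConnected_fill hXo hX hXc).isPreconnected
    (isOpen_fill hYo hY) hfr with h3 | h3
  · obtain ⟨p, hp⟩ := hXc.nonempty
    exact absurd (h3 (subset_fill X hp)) (disjoint_left.1 h' hp)
  · exact h3
end
end BrouwerPlane

namespace BrouwerPlane

theorem differentiableOn_of_exp {U : Set ℂ} (hUo : IsOpen U) {L g : ℂ → ℂ}
    (hL : ContinuousOn L U) (hg : DifferentiableOn ℂ g U) (h : ∀ z ∈ U, Complex.exp (L z) = g z) :
    DifferentiableOn ℂ L U := by
  intro z hz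
  apply DifferentiableAt.differentiableWithinAt
  have hgz : DifferentiableAt ℂ g z := hg.differentiableAt (hUo.mem_nhds hz)
  have hg0 : g z ≠ 0 := by rw [← h z hz]; exact Complex.exp_ne_zero _
  have hLz : ContinuousAt L z := hL.continuousAt (hUo.mem_nhds hz)
  have hd : DifferentiableAt ℂ (fun w => L z + Complex.log (g w / g z)) z := by
    refine DifferentiableAt.const_add _ (DifferentiableAt.clog (hgz.div_const _) ?_)
    rw [div_self hg0]
    exact Complex.one_mem_slitPlane
  refine hd.congr_of_eventuallyEq ?_
  filter_upwards [Metric.tendsto_nhds.1 hLz 1 one_pos, hUo.mem_nhds hz] with w hw hwU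
  rw [← h w hwU, ← h z hz, ← Complex.exp_sub, Complex.log_exp]
  · ring
  · have := (abs_le.1 (Complex.abs_im_le_norm (L w - L z))).1
    rw [dist_eq_norm] at hw
    linarith [Real.pi_gt_three]
  · have := (abs_le.1 (Complex.abs_im_le_norm (L w - L z))).2
    rw [dist_eq_norm] at hw
    linarith [Real.pi_gt_three]

theorem exists_sq_root {U : Set ℂ} (hUo : IsOpen U) (hlog : HasLog U) {g : ℂ → ℂ}
    (hg : DifferentiableOn ℂ g U) (h0 : ∀ z ∈ U, g z ≠ 0) :
    ∃ q : ℂ → ℂ, DifferentiableOn ℂ q U ∧ ∀ z ∈ U, q z ^ 2 = g z := by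
  obtain ⟨L, hL, hLe⟩ := hlog g hg.continuousOn h0
  have hd := differentiableOn_of_exp hUo hL hg hLe
  refine ⟨fun z => Complex.exp (L z / 2), (hd.div_const 2).cexp, fun z hz => ?_⟩
  rw [← Complex.exp_nat_mul, ← hLe z hz]
  congr 1; push_cast; ring

/-- Disc automorphisms. -/
noncomputable def moeb (c w : ℂ) : ℂ := (w - c) / (1 - (starRingEnd ℂ) c * w)

theorem one_sub_conj_mul_ne {c w : ℂ} (hc : ‖c‖ < 1) (hw : ‖w‖ ≤ 1) :
    1 - (starRingEnd ℂ) c * w ≠ 0 := by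
  intro h
  have h1 : (starRingEnd ℂ) c * w = 1 := (sub_eq_zero.1 h).symm
  have h2 : ‖c‖ * ‖w‖ = 1 := by
    rw [← RCLike.norm_conj c, ← norm_mul, h1, norm_one]
  nlinarith [norm_nonneg c, norm_nonneg w]

theorem norm_moeb_lt {c w : ℂ} (hc : ‖c‖ < 1) (hw : ‖w‖ < 1) : ‖moeb c w‖ < 1 := by
  have h0 := one_sub_conj_mul_ne hc hw.le
  rw [moeb, norm_div, div_lt_one (norm_pos_iff.2 h0)]
  refine lt_of_pow_lt_pow_left₀ 2 (norm_nonneg _) ?_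
  have hc2 : c.re ^ 2 + c.im ^ 2 < 1 := by
    have : ‖c‖ ^ 2 < 1 := by nlinarith [norm_nonneg c]
    rwa [← Complex.normSq_eq_norm_sq, Complex.normSq_apply, ← sq, ← sq] at this
  have hw2 : w.re ^ 2 + w.im ^ 2 < 1 := by
    have : ‖w‖ ^ 2 < 1 := by nlinarith [norm_nonneg w]
    rwa [← Complex.normSq_eq_norm_sq, Complex.normSq_apply, ← sq, ← sq] at this
  rw [← Complex.normSq_eq_norm_sq, ← Complex.normSq_eq_norm_sq, Complex.normSq_apply,
    Complex.normSq_apply]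
  simp only [Complex.sub_re, Complex.sub_im, Complex.mul_re, Complex.mul_im, Complex.conj_re,
    Complex.conj_im, Complex.one_re, Complex.one_im]
  nlinarith [mul_pos (sub_pos.2 hc2) (sub_pos.2 hw2)]

theorem moeb_injOn {c : ℂ} (hc : ‖c‖ < 1) {w v : ℂ} (hw : ‖w‖ < 1) (hv : ‖v‖ < 1)
    (h : moeb c w = moeb c v) : w = v := by
  have h1 := one_sub_conj_mul_ne hc hw.le
  have h2 := one_sub_conj_mul_ne hc hv.le
  rw [moeb, moeb, div_eq_div_iff h1 h2] at h
  have h3 : (w - v) * (1 - (starRingEnd ℂ) c * c) = 0 := by linear_combination h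
  rcases mul_eq_zero.1 h3 with h4 | h4
  · exact sub_eq_zero.1 h4
  · exact absurd h4 (one_sub_conj_mul_ne hc hc.le)

theorem hasDerivAt_moeb {c w : ℂ} (hc : ‖c‖ < 1) (hw : ‖w‖ < 1) :
    HasDerivAt (moeb c) ((1 - (starRingEnd ℂ) c * c) / (1 - (starRingEnd ℂ) c * w) ^ 2) w := by
  have h1 := one_sub_conj_mul_ne hc hw.le
  have := ((hasDerivAt_id w).sub_const c).div
    (((hasDerivAt_id w).const_mul ((starRingEnd ℂ) c)).const_sub 1) h1
  refine this.congr_deriv ?_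
  simp only [id]
  congr 1
  ring

theorem moeb_eq_zero {c w : ℂ} (hc : ‖c‖ < 1) (hw : ‖w‖ < 1) (h : moeb c w = 0) : w = c := by
  rw [moeb, div_eq_zero_iff] at h
  exact sub_eq_zero.1 (h.resolve_right (one_sub_conj_mul_ne hc hw.le))

/-- Injective holomorphic maps to the unit disc vanishing at `z₀`. -/
def DiscMap (U : Set ℂ) (z₀ : ℂ) (f : ℂ → ℂ) : Prop :=
  DifferentiableOn ℂ f U ∧ InjOn f U ∧ (∀ z ∈ U, ‖f z‖ < 1) ∧ f z₀ = 0

theorem exists_discMap {U : Set ℂ} (hUb : Bornology.IsBounded U) (z₀ : ℂ) :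
    ∃ f, DiscMap U z₀ f ∧ deriv f z₀ ≠ 0 := by
  obtain ⟨R, hR⟩ := exists_norm_lt hUb
  set c : ℝ := |R| + ‖z₀‖ + 1 with hc
  have hc0 : 0 < c := by positivity
  have hcc : (c : ℂ) ≠ 0 := Complex.ofReal_ne_zero.2 hc0.ne'
  refine ⟨fun z => (z - z₀) / c, ⟨by fun_prop, ?_, ?_, by simp⟩, ?_⟩
  · intro z _ w _ h
    have := (div_left_inj' hcc).1 h
    exact sub_left_injective this
  · intro z hz
    rw [norm_div, Complex.norm_real, Real.norm_of_nonneg hc0.le, div_lt_one hc0]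
    calc ‖z - z₀‖ ≤ ‖z‖ + ‖z₀‖ := norm_sub_le _ _
      _ < c := by linarith [hR z hz, le_abs_self R]
  · have : HasDerivAt (fun z => (z - z₀) / (c : ℂ)) (1 / c) z₀ :=
      ((hasDerivAt_id z₀).sub_const z₀).div_const _
    rw [this.deriv]
    simp [hcc]

/-- A disc map which is not onto does not maximize the derivative. -/
theorem DiscMap.exists_deriv_lt {U : Set ℂ} (hUo : IsOpen U) (hlog : HasLog U) {z₀ : ℂ}
    (hz₀ : z₀ ∈ U) {F : ℂ → ℂ} (hF : DiscMap U z₀ F) (hF' : deriv F z₀ ≠ 0) {c : ℂ}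
    (hc : ‖c‖ < 1) (hcF : ∀ z ∈ U, F z ≠ c) :
    ∃ p, DiscMap U z₀ p ∧ ‖deriv F z₀‖ < ‖deriv p z₀‖ := by
  obtain ⟨hd, hi, hb, h0⟩ := hF
  have hgd : DifferentiableOn ℂ (fun z => moeb c (F z)) U := fun z hz =>
    ((hasDerivAt_moeb hc (hb z hz)).differentiableAt.comp z
      (hd.differentiableAt (hUo.mem_nhds hz))).differentiableWithinAt
  obtain ⟨q, hqd, hq⟩ := exists_sq_root hUo hlog hgd
    fun z hz h => hcF z hz (moeb_eq_zero hc (hb z hz) h)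
  have hqb : ∀ z ∈ U, ‖q z‖ < 1 := by
    intro z hz
    have h1 := norm_moeb_lt hc (hb z hz)
    rw [← hq z hz, norm_pow] at h1
    exact (pow_lt_one_iff_of_nonneg (norm_nonneg _) two_ne_zero).1 h1
  set a := q z₀ with ha
  have hab : ‖a‖ < 1 := hqb z₀ hz₀
  have ha2 : a ^ 2 = -c := by rw [ha, hq z₀ hz₀, h0]; simp [moeb]
  have hc0 : c ≠ 0 := fun h => hcF z₀ hz₀ (by rw [h0, h])
  have ha0 : a ≠ 0 := by
    intro h; rw [h] at ha2; apply hc0; simpa using ha2.symm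
  have hpd : ∀ z ∈ U, HasDerivAt (fun z => moeb a (q z))
      ((1 - (starRingEnd ℂ) a * a) / (1 - (starRingEnd ℂ) a * q z) ^ 2 * deriv q z) z := fun z hz =>
    (hasDerivAt_moeb hab (hqb z hz)).comp z (hqd.differentiableAt (hUo.mem_nhds hz)).hasDerivAt
  refine ⟨fun z => moeb a (q z), ⟨fun z hz => (hpd z hz).differentiableAt.differentiableWithinAt,
    ?_, fun z hz => norm_moeb_lt hab (hqb z hz), by simp [moeb, ha]⟩, ?_⟩
  · intro z hz w hw hzw
    have h1 : q z = q w := moeb_injOn hab (hqb z hz) (hqb w hw) hzw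
    have h2 : moeb c (F z) = moeb c (F w) := by rw [← hq z hz, ← hq w hw, h1]
    exact hi hz hw (moeb_injOn hc (hb z hz) (hb w hw) h2)
  · rw [(hpd z₀ hz₀).deriv, ← ha]
    have hq1 : HasDerivAt q (deriv q z₀) z₀ := (hqd.differentiableAt (hUo.mem_nhds hz₀)).hasDerivAt
    have hq2 : HasDerivAt (fun z => q z ^ 2) (2 * a * deriv q z₀) z₀ := by
      have := hq1.pow 2
      refine this.congr_deriv ?_
      rw [← ha]; push_cast; ring
    have hF1 : HasDerivAt F (deriv F z₀) z₀ := (hd.differentiableAt (hUo.mem_nhds hz₀)).hasDerivAt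
    have hg1 : HasDerivAt (fun z => moeb c (F z)) ((1 - (starRingEnd ℂ) c * c) * deriv F z₀) z₀ := by
      have := (hasDerivAt_moeb hc (hb z₀ hz₀)).comp z₀ hF1
      refine this.congr_deriv ?_
      rw [h0]; simp
    have heq : 2 * a * deriv q z₀ = (1 - (starRingEnd ℂ) c * c) * deriv F z₀ := by
      refine (hq2.congr_of_eventuallyEq ?_).unique hg1
      filter_upwards [hUo.mem_nhds hz₀] with z hz
      exact (hq z hz).symm
    set s : ℝ := ‖a‖ with hs
    have hs0 : 0 < s := norm_pos_iff.2 ha0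
    have haa : (starRingEnd ℂ) a * a = ((s ^ 2 : ℝ) : ℂ) := by
      rw [mul_comm, Complex.mul_conj, Complex.normSq_eq_norm_sq]
    have hcc : (starRingEnd ℂ) c * c = ((s ^ 4 : ℝ) : ℂ) := by
      rw [mul_comm, Complex.mul_conj, Complex.normSq_eq_norm_sq, ← norm_neg, ← ha2, norm_pow]
      push_cast; ring
    have hne : (1 : ℂ) - ((s ^ 2 : ℝ) : ℂ) ≠ 0 := by
      rw [← haa]; exact one_sub_conj_mul_ne hab hab.le
    have hval : (1 - (starRingEnd ℂ) a * a) / (1 - (starRingEnd ℂ) a * a) ^ 2 * deriv q z₀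
        = (((1 + s ^ 2 : ℝ) : ℂ) / (2 * a)) * deriv F z₀ := by
      rw [haa]
      rw [hcc] at heq
      have : deriv q z₀ = (1 - ((s ^ 4 : ℝ) : ℂ)) * deriv F z₀ / (2 * a) := by
        rw [← heq]; field_simp
      rw [this]
      have h4 : (1 - ((s ^ 4 : ℝ) : ℂ)) = (1 - ((s ^ 2 : ℝ) : ℂ)) * ((1 + s ^ 2 : ℝ) : ℂ) := by
        push_cast; ring
      rw [h4]
      field_simp
    rw [hval, norm_mul, norm_div, norm_mul, Complex.norm_real, ← hs]
    have h5 : 1 < ‖(1 + s ^ 2 : ℝ)‖ / (‖(2:ℂ)‖ * s) := by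
      rw [Real.norm_of_nonneg (by positivity), Complex.norm_ofNat, lt_div_iff₀ (by positivity)]
      nlinarith [sq_pos_of_ne_zero (sub_ne_zero.2 hab.ne)]
    exact lt_mul_of_one_lt_left (norm_pos_iff.2 hF') h5

theorem DiscMap.norm_sub_le {U : Set ℂ} {z₀ : ℂ} {f : ℂ → ℂ} (hf : DiscMap U z₀ f) {z : ℂ} {r : ℝ}
    (hr : 0 < r) (hz : Metric.ball z r ⊆ U) {w : ℂ} (hw : w ∈ Metric.ball z r) :
    ‖f w - f z‖ ≤ 2 / r * ‖w - z‖ := by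
  have := Complex.dist_le_div_mul_dist_of_mapsTo_ball (f := f) (c := z) (R₁ := r) (R₂ := 2)
    (hf.1.mono hz) (fun v hv => ?_) hw
  · simpa [dist_eq_norm] using this
  · rw [Metric.mem_closedBall, dist_eq_norm]
    have h1 := hf.2.2.1 v (hz hv)
    have h2 := hf.2.2.1 z (hz (Metric.mem_ball_self hr))
    linarith [_root_.norm_sub_le (f v) (f z)]

/-- Limits of disc maps along an ultrafilter. -/
theorem exists_tendstoLocallyUniformlyOn {U : Set ℂ} (hUo : IsOpen U) {z₀ : ℂ} (f : ℕ → ℂ → ℂ)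
    (hf : ∀ n, DiscMap U z₀ (f n)) (𝓤 : Ultrafilter ℕ) :
    ∃ F : ℂ → ℂ, (∀ z ∈ U, ‖F z‖ ≤ 1) ∧ TendstoLocallyUniformlyOn f F 𝓤 U := by
  have hex : ∀ z ∈ U, ∃ w ∈ Metric.closedBall (0 : ℂ) 1, Tendsto (fun n => f n z) 𝓤 (𝓝 w) := by
    intro z hz
    refine (isCompact_closedBall (0 : ℂ) 1).ultrafilter_le_nhds (𝓤.map (fun n => f n z)) ?_
    rw [le_principal_iff]
    show ∀ᶠ n in (𝓤 : Filter ℕ), f n z ∈ Metric.closedBall (0 : ℂ) 1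
    exact Eventually.of_forall fun n => mem_closedBall_zero_iff.2 ((hf n).2.2.1 z hz).le
  choose! F hF1 hF2 using hex
  refine ⟨F, fun z hz => mem_closedBall_zero_iff.1 (hF1 z hz), ?_⟩
  rw [Metric.tendstoLocallyUniformlyOn_iff]
  intro ε hε z hz
  obtain ⟨r, hr, hrU⟩ := Metric.isOpen_iff.1 hUo z hz
  have hlip : ∀ w ∈ Metric.ball z r, ‖F w - F z‖ ≤ 2 / r * ‖w - z‖ := fun w hw =>
    le_of_tendsto ((hF2 w (hrU hw)).sub (hF2 z hz)).norm
      (Eventually.of_forall fun n => (hf n).norm_sub_le hr hrU hw)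
  set δ := min r (ε * r / 8) with hδ
  have hδ0 : 0 < δ := by positivity
  refine ⟨Metric.ball z δ, mem_nhdsWithin_of_mem_nhds (Metric.ball_mem_nhds z hδ0), ?_⟩
  filter_upwards [Metric.tendsto_nhds.1 (hF2 z hz) (ε / 4) (by positivity)] with n hn w hw
  have hwr : w ∈ Metric.ball z r := Metric.ball_subset_ball (min_le_left _ _) hw
  have h1 := hlip w hwr
  have h2 := (hf n).norm_sub_le hr hrU hwr
  have h3 : 2 / r * ‖w - z‖ ≤ ε / 4 := by
    have : ‖w - z‖ ≤ ε * r / 8 := by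
      rw [Metric.mem_ball, dist_eq_norm] at hw
      exact hw.le.trans (min_le_right _ _)
    calc 2 / r * ‖w - z‖ ≤ 2 / r * (ε * r / 8) := by gcongr
      _ = ε / 4 := by field_simp; ring
  rw [dist_eq_norm] at hn ⊢
  calc ‖F w - f n w‖ = ‖(F w - F z) - (f n z - F z) - (f n w - f n z)‖ := by congr 1; ring
    _ ≤ ‖F w - F z‖ + ‖f n z - F z‖ + ‖f n w - f n z‖ :=
      (norm_sub_le _ _).trans (add_le_add_left (norm_sub_le _ _) _)
    _ < ε := by linarith

/-- Locally uniform limits of injective holomorphic functions are injective or constant. -/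
theorem injOn_of_tendstoLocallyUniformlyOn {U : Set ℂ} (hUo : IsOpen U) (hUc : IsPreconnected U)
    {l : Filter ℕ} [l.NeBot] {f : ℕ → ℂ → ℂ} {F : ℂ → ℂ} (hd : ∀ n, DifferentiableOn ℂ (f n) U)
    (hi : ∀ n, InjOn (f n) U) (hl : TendstoLocallyUniformlyOn f F l U)
    (hnc : ∀ c, ∃ z ∈ U, F z ≠ c) : InjOn F U := by
  have hFd : DifferentiableOn ℂ F U := hl.differentiableOn (Eventually.of_forall hd) hUo
  intro a ha b hb hab
  by_contra hne
  have han : AnalyticOnNhd ℂ (fun z => F z - F b) U := (hFd.sub_const _).analyticOnNhd hUo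
  have hev : ∀ᶠ z in 𝓝[≠] a, F z - F b ≠ 0 := by
    rcases (han a ha).eventually_eq_zero_or_eventually_ne_zero with h | h
    · exfalso
      have := han.eqOn_zero_of_preconnected_of_eventuallyEq_zero hUc ha h
      obtain ⟨z, hz, hzc⟩ := hnc (F b)
      exact hzc (sub_eq_zero.1 (this hz))
    · exact h
  rw [eventually_nhdsWithin_iff] at hev
  obtain ⟨r, hr, hrb⟩ := Metric.eventually_nhds_iff_ball.1
    ((hev.and (hUo.mem_nhds ha)).and (isOpen_ne.mem_nhds hne))
  set s := r / 2 with hs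
  have hs0 : 0 < s := by positivity
  have hsub : Metric.closedBall a s ⊆ Metric.ball a r := Metric.closedBall_subset_ball (by linarith)
  have hsU : Metric.closedBall a s ⊆ U := fun z hz => (hrb z (hsub hz)).1.2
  have hsp : ∀ z ∈ Metric.sphere a s, F z - F b ≠ 0 := fun z hz =>
    (hrb z (hsub (Metric.sphere_subset_closedBall hz))).1.1
      (Metric.ne_of_mem_sphere hz hs0.ne')
  obtain ⟨z₁, hz₁, hmin⟩ := (isCompact_sphere a s).exists_isMinOn
    ((NormedSpace.sphere_nonempty).2 hs0.le)
    ((hFd.continuousOn.mono (Metric.sphere_subset_closedBall.trans hsU)).sub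
      (continuousOn_const (c := F b))).norm
  set m := ‖F z₁ - F b‖ with hm
  have hm0 : 0 < m := norm_pos_iff.2 (hsp z₁ hz₁)
  have hU' := (tendstoLocallyUniformlyOn_iff_forall_isCompact hUo).1 hl (Metric.closedBall a s ∪ {b})
    (union_subset hsU (singleton_subset_iff.2 hb))
    ((isCompact_closedBall a s).union isCompact_singleton)
  rw [Metric.tendstoUniformlyOn_iff] at hU'
  obtain ⟨n, hn⟩ := (hU' (m / 8) (by positivity)).exists
  have hclose : ∀ z ∈ Metric.closedBall a s, ‖(F z - F b) - (f n z - f n b)‖ ≤ m / 4 := by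
    intro z hz
    have h1 := hn z (Or.inl hz)
    have h2 := hn b (Or.inr rfl)
    rw [dist_eq_norm] at h1 h2
    calc ‖(F z - F b) - (f n z - f n b)‖ = ‖(F z - f n z) - (F b - f n b)‖ := by congr 1; ring
      _ ≤ ‖F z - f n z‖ + ‖F b - f n b‖ := norm_sub_le _ _
      _ ≤ m / 4 := by linarith
  have hnz : ∀ z ∈ Metric.closedBall a s, f n z - f n b ≠ 0 := by
    intro z hz h
    have : z = b := hi n (hsU hz) hb (sub_eq_zero.1 h)
    exact (hrb z (hsub hz)).2 this
  have hdn : DifferentiableOn ℂ (fun z => (f n z - f n b)⁻¹) (Metric.closedBall a s) :=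
    (((hd n).mono hsU).sub_const _).inv hnz
  have hmax : ‖(f n a - f n b)⁻¹‖ ≤ 2 / m := by
    refine Complex.norm_le_of_forall_mem_frontier_norm_le (U := Metric.ball a s)
      (f := fun z => (f n z - f n b)⁻¹) Metric.isBounded_ball
      (DifferentiableOn.diffContOnCl (hdn.mono ?_)) ?_ (subset_closure (Metric.mem_ball_self hs0))
    · exact (closure_ball a hs0.ne').subset
    · intro z hz
      rw [frontier_ball a hs0.ne'] at hz
      have h1 := hclose z (Metric.sphere_subset_closedBall hz)
      have h2 : m ≤ ‖F z - F b‖ := hmin hz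
      have h3 : m / 2 ≤ ‖f n z - f n b‖ := by
        have := norm_sub_norm_le (F z - F b) (f n z - f n b)
        linarith
      rw [norm_inv, inv_le_comm₀ (by linarith) (by positivity), inv_div]
      exact h3
  have h1 := hclose a (Metric.mem_closedBall_self hs0.le)
  rw [hab, sub_self, zero_sub, norm_neg] at h1
  have hpos : 0 < ‖f n a - f n b‖ := norm_pos_iff.2 (hnz a (Metric.mem_closedBall_self hs0.le))
  rw [norm_inv, inv_le_comm₀ hpos (by positivity), inv_div] at hmax
  linarith

theorem exists_riemann_map {U : Set ℂ} (hUo : IsOpen U) (hUb : Bornology.IsBounded U)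
    (hUc : IsConnected U) (hlog : HasLog U) :
    ∃ F : ℂ → ℂ, DifferentiableOn ℂ F U ∧ InjOn F U ∧ F '' U = Metric.ball 0 1 := by
  obtain ⟨z₀, hz₀⟩ := hUc.nonempty
  obtain ⟨ρ, hρ, hρU⟩ := Metric.isOpen_iff.1 hUo z₀ hz₀
  set S : Set ℝ := {x | ∃ f, DiscMap U z₀ f ∧ x = ‖deriv f z₀‖} with hS
  obtain ⟨f₀, hf₀, hf₀'⟩ := exists_discMap hUb z₀
  have hSne : S.Nonempty := ⟨_, f₀, hf₀, rfl⟩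
  have hSb : BddAbove S := by
    refine ⟨2 / ρ, ?_⟩
    rintro _ ⟨f, hf, rfl⟩
    refine Complex.norm_deriv_le_div_of_mapsTo_ball (hf.1.mono hρU) (fun w hw => ?_) hρ
    rw [hf.2.2.2, mem_closedBall_zero_iff]
    linarith [hf.2.2.1 w (hρU hw)]
  set M := sSup S with hM
  have hM0 : 0 < M := (norm_pos_iff.2 hf₀').trans_le (le_csSup hSb ⟨f₀, hf₀, rfl⟩)
  obtain ⟨u, -, hu, huS⟩ := exists_seq_tendsto_sSup hSne hSb
  choose f hf hfu using huS
  set 𝓤 : Ultrafilter ℕ := Ultrafilter.of atTop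
  obtain ⟨F, hF1, hF⟩ := exists_tendstoLocallyUniformlyOn hUo f hf 𝓤
  have hFd : DifferentiableOn ℂ F U := hF.differentiableOn (Eventually.of_forall fun n => (hf n).1) hUo
  have hder : ‖deriv F z₀‖ = M := by
    have h1 := ((hF.deriv (Eventually.of_forall fun n => (hf n).1) hUo).tendsto_at hz₀).norm
    have h2 : Tendsto u 𝓤 (𝓝 M) := hu.mono_left (Ultrafilter.of_le atTop)
    refine tendsto_nhds_unique h1 (h2.congr fun n => ?_)
    rw [hfu]; rfl
  have hder0 : deriv F z₀ ≠ 0 := by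
    intro h; rw [h, norm_zero] at hder; exact hM0.ne hder
  have hnc : ∀ c, ∃ z ∈ U, F z ≠ c := by
    intro c
    by_contra! hcon
    apply hder0
    have : F =ᶠ[𝓝 z₀] fun _ => c := by
      filter_upwards [hUo.mem_nhds hz₀] with z hz using hcon z hz
    rw [this.deriv_eq, deriv_const]
  have hinj : InjOn F U := injOn_of_tendstoLocallyUniformlyOn hUo hUc.isPreconnected
    (fun n => (hf n).1) (fun n => (hf n).2.1) hF hnc
  have hopen : IsOpen (F '' U) := by
    rcases (hFd.analyticOnNhd hUo).is_constant_or_isOpen hUc.isPreconnected with ⟨w, hw⟩ | h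
    · obtain ⟨z, hz, hzw⟩ := hnc w
      exact absurd (hw z hz) hzw
    · exact h U subset_rfl hUo
  have hball : F '' U ⊆ Metric.ball 0 1 := by
    rw [← interior_closedBall (0 : ℂ) one_ne_zero]
    refine interior_maximal ?_ hopen
    rintro _ ⟨z, hz, rfl⟩
    exact mem_closedBall_zero_iff.2 (hF1 z hz)
  have hFD : DiscMap U z₀ F := by
    refine ⟨hFd, hinj, fun z hz => mem_ball_zero_iff.1 (hball (mem_image_of_mem F hz)), ?_⟩
    refine tendsto_nhds_unique (hF.tendsto_at hz₀) (tendsto_const_nhds.congr fun n => ?_)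
    exact ((hf n).2.2.2).symm
  refine ⟨F, hFd, hinj, hball.antisymm fun c hc => ?_⟩
  by_contra hcF
  obtain ⟨p, hp, hlt⟩ := hFD.exists_deriv_lt hUo hlog hz₀ hder0 (mem_ball_zero_iff.1 hc)
    fun z hz h => hcF ⟨z, hz, h⟩
  rw [hder] at hlt
  exact absurd (le_csSup hSb ⟨p, hp, rfl⟩) (not_le.2 hlt)

/-- The Riemann map together with its inverse. -/
structure IsRiemannPair (U : Set ℂ) (F G : ℂ → ℂ) : Prop where
  differentiableOn : DifferentiableOn ℂ F U
  norm_lt : ∀ z ∈ U, ‖F z‖ < 1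
  continuousOn_inv : ContinuousOn G (Metric.ball 0 1)
  inv_mem : ∀ w, ‖w‖ < 1 → G w ∈ U
  left_inv : ∀ z ∈ U, G (F z) = z
  right_inv : ∀ w, ‖w‖ < 1 → F (G w) = w

theorem exists_isRiemannPair {U : Set ℂ} (hUo : IsOpen U) (hUb : Bornology.IsBounded U)
    (hUc : IsConnected U) (hlog : HasLog U) : ∃ F G, IsRiemannPair U F G := by
  obtain ⟨F, hd, hi, him⟩ := exists_riemann_map hUo hUb hUc hlog
  have hG : ∀ w : ℂ, ‖w‖ < 1 → ∃ z ∈ U, F z = w := fun w hw => by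
    have : w ∈ F '' U := by rw [him]; exact mem_ball_zero_iff.2 hw
    exact this
  choose! G hG1 hG2 using hG
  have hl : ∀ z ∈ U, ‖F z‖ < 1 := fun z hz =>
    mem_ball_zero_iff.1 (him ▸ mem_image_of_mem F hz)
  refine ⟨F, G, hd, hl, ?_, hG1, fun z hz => hi (hG1 _ (hl z hz)) hz (hG2 _ (hl z hz)), hG2⟩
  have hopen : ∀ s ⊆ U, IsOpen s → IsOpen (F '' s) := by
    rcases (hd.analyticOnNhd hUo).is_constant_or_isOpen hUc.isPreconnected with ⟨w, hw⟩ | h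
    · exfalso
      have h1 := hw _ (hG1 0 (by simp))
      have h2 := hw _ (hG1 (1/2) (by norm_num))
      rw [hG2 _ (by simp)] at h1
      rw [hG2 _ (by norm_num), ← h1] at h2
      norm_num at h2
    · exact h
  rw [continuousOn_open_iff Metric.isOpen_ball]
  intro t ht
  have : Metric.ball 0 1 ∩ G ⁻¹' t = F '' (U ∩ t) := by
    ext w
    constructor
    · rintro ⟨h1, h2⟩
      rw [mem_ball_zero_iff] at h1
      exact ⟨G w, ⟨hG1 w h1, h2⟩, hG2 w h1⟩
    · rintro ⟨z, ⟨h1, h2⟩, rfl⟩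
      refine ⟨mem_ball_zero_iff.2 (hl z h1), ?_⟩
      rw [mem_preimage, hi (hG1 _ (hl z h1)) h1 (hG2 _ (hl z h1))]
      exact h2
  rw [this]
  exact hopen _ inter_subset_left (hUo.inter ht)

/-- A homeomorphism contracting a plane disc into itself has a fixed point. -/
theorem IsRiemannPair.exists_fixedPoint {U : Set ℂ} {F G : ℂ → ℂ} (h : IsRiemannPair U F G)
    (hUo : IsOpen U) (hUb : Bornology.IsBounded U) (k : ℂ ≃ₜ ℂ) (hk : closure (k '' U) ⊆ U) :
    ∃ z, k z = z := by
  have hK : IsCompact (F '' closure (k '' U)) :=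
    ((isBounded_image_homeo k hUb).isCompact_closure).image_of_continuousOn
      (h.differentiableOn.continuousOn.mono hk)
  obtain ⟨ρ, hρ0, hρ1, hρ⟩ : ∃ ρ : ℝ, 0 < ρ ∧ ρ < 1 ∧ ∀ z ∈ U, ‖F (k z)‖ ≤ ρ := by
    have hne : (F '' closure (k '' U)).Nonempty :=
      ⟨_, mem_image_of_mem F (subset_closure (mem_image_of_mem k (h.inv_mem 0 (by simp))))⟩
    obtain ⟨w, hw, hmax⟩ := hK.exists_isMaxOn hne continuous_norm.continuousOn
    obtain ⟨z, hz, rfl⟩ := hw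
    have h1 := h.norm_lt z (hk hz)
    refine ⟨max ‖F z‖ (1/2), by positivity, max_lt h1 (by norm_num), fun v hv => ?_⟩
    exact (hmax (mem_image_of_mem F (subset_closure (mem_image_of_mem k hv)))).trans (le_max_left _ _)
  set π : ℂ → ℂ := fun w => ((ρ / max ρ ‖w‖ : ℝ) : ℂ) * w with hπ
  have hmaxpos : ∀ w : ℂ, 0 < max ρ ‖w‖ := fun w => lt_max_of_lt_left hρ0
  have hπc : Continuous π := by
    refine (Complex.continuous_ofReal.comp ?_).mul continuous_id
    exact continuous_const.div (continuous_const.max continuous_norm) fun w => (hmaxpos w).ne'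
  have hπb : ∀ w, ‖π w‖ < 1 := by
    intro w
    refine lt_of_le_of_lt ?_ hρ1
    rw [hπ]
    simp only [norm_mul, Complex.norm_real, Real.norm_of_nonneg (div_pos hρ0 (hmaxpos w)).le]
    rw [div_mul_eq_mul_div, div_le_iff₀ (hmaxpos w)]
    exact mul_le_mul_of_nonneg_left (le_max_right _ _) hρ0.le
  have hkU : ∀ z ∈ U, k z ∈ U := fun z hz => hk (subset_closure (mem_image_of_mem k hz))
  obtain ⟨w, hw⟩ := exists_fixedPoint_of_bounded (f := fun w => F (k (G (π w)))) (M := 1) (by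
      refine continuous_iff_continuousAt.2 fun w => ?_
      have hm : π w ∈ Metric.ball (0:ℂ) 1 := mem_ball_zero_iff.2 (hπb w)
      have h1 : ContinuousAt (fun w => k (G (π w))) w := k.continuous.continuousAt.comp
        ((h.continuousOn_inv.continuousAt (Metric.isOpen_ball.mem_nhds hm)).comp hπc.continuousAt)
      refine ContinuousAt.comp (g := F) ?_ h1
      have hmem := h.inv_mem _ (hπb w)
      exact (h.differentiableOn.continuousOn).continuousAt (hUo.mem_nhds (hkU _ hmem)))
    fun w => (h.norm_lt _ (hkU _ (h.inv_mem _ (hπb w)))).le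
  have hwρ : ‖w‖ ≤ ρ := by rw [← hw]; exact hρ _ (h.inv_mem _ (hπb w))
  have hπw : π w = w := by simp [hπ, max_eq_left hwρ, hρ0.ne']
  simp only [hπw] at hw
  have hw1 : ‖w‖ < 1 := hwρ.trans_lt hρ1
  refine ⟨G w, ?_⟩
  rw [← h.left_inv _ (hkU _ (h.inv_mem w hw1)), hw]

theorem iterate_eq_pow (h : ℂ ≃ₜ ℂ) (n : ℕ) : ∃ g : ℂ ≃ₜ ℂ, ⇑g = h^[n] := by
  induction n with
  | zero => exact ⟨Homeomorph.refl ℂ, rfl⟩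
  | succ n ih =>
    obtain ⟨g, hg⟩ := ih
    exact ⟨h.trans g, by rw [Function.iterate_succ, ← hg]; rfl⟩

theorem IsBrouwer.disjoint_fill_iterate {h : ℂ ≃ₜ ℂ} (hh : IsBrouwer h) {X : Set ℂ}
    (hXo : IsOpen X) (hXb : Bornology.IsBounded X) (hXc : IsConnected X) (hf : Free h X) {n : ℕ}
    (hn : 1 ≤ n) : Disjoint (fill X) (h^[n] '' fill X) := by
  obtain ⟨g, hg⟩ := iterate_eq_pow h n
  rw [← hg, image_fill]
  have hfree : Disjoint X (g '' X) := by
    rw [disjoint_right]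
    rintro _ ⟨z, hz, rfl⟩
    rw [hg]
    exact hh.free_iterate hXo hXc.isPreconnected hf hn z hz
  have hUo := isOpen_fill hXo hXb
  have hUb := isBounded_fill hXb
  obtain ⟨F, G, hFG⟩ := exists_isRiemannPair hUo hUb (isConnected_fill hXo hXb hXc)
    (hasLog_fill hXo hXb hXc)
  have hfix : ∀ z, g z ≠ z := fun z => by rw [hg]; exact hh.iterate_ne hn z
  rcases fill_trichotomy hXo hXb hXc (g.isOpenMap _ hXo) (isBounded_image_homeo g hXb)
    (hXc.image g g.continuous.continuousOn) hfree with h1 | h1 | h1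
  · exact h1
  · rw [← image_fill] at h1
    obtain ⟨z, hz⟩ := hFG.exists_fixedPoint hUo hUb g h1
    exact absurd hz (hfix z)
  · rw [← image_fill] at h1
    obtain ⟨z, hz⟩ := hFG.exists_fixedPoint hUo hUb g.symm (by
      rw [← g.symm.image_closure]
      rintro _ ⟨z, hz, rfl⟩
      obtain ⟨v, hv, hvz⟩ := h1 hz
      rw [← hvz, g.symm_apply_apply]
      exact hv)
    refine absurd ?_ (hfix z)
    conv_lhs => rw [← hz]
    exact g.apply_symm_apply z

end BrouwerPlane

namespace BrouwerPlane

theorem zero_mem_fill_of_rotation {L : Set ℂ} (hLo : IsOpen L) (hLb : Bornology.IsBounded L)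
    (hLc : IsConnected L) {m : ℕ} (hm : 2 ≤ m)
    (hrot : ∀ z ∈ L, Complex.exp (2 * Real.pi * Complex.I / m) * z ∈ L) : (0 : ℂ) ∈ fill L := by
  by_contra h0
  have hm0 : (m : ℂ) ≠ 0 := by exact_mod_cast (by omega : m ≠ 0)
  set c : ℂ := 2 * Real.pi * Complex.I / m with hc
  obtain ⟨l, hl, hle⟩ := hasLog_fill hLo hLb hLc id continuousOn_id
    (fun z hz h => h0 (by simpa [← h] using hz))
  have hl' : ContinuousOn l L := hl.mono (subset_fill L)
  have hle' : ∀ z ∈ L, Complex.exp (l z) = z := fun z hz => hle z (subset_fill L hz)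
  obtain ⟨z₀, hz₀⟩ := hLc.nonempty
  have hconst : ∀ z ∈ L, l (Complex.exp c * z) - (l z + c)
      = l (Complex.exp c * z₀) - (l z₀ + c) := fun z hz => by
    refine log_sub_const (f := fun z => l (Complex.exp c * z)) (g := fun z => l z + c)
      hLc.isPreconnected
      (hl'.comp (by fun_prop) hrot) (by fun_prop) (fun z hz => ?_) hz hz₀
    rw [hle' _ (hrot z hz), Complex.exp_add, hle' z hz, mul_comm]
  set a := l (Complex.exp c * z₀) - (l z₀ + c) with ha
  have hea : Complex.exp a = 1 := by
    have h1 : z₀ ≠ 0 := fun h => h0 (h ▸ subset_fill L hz₀)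
    rw [ha, Complex.exp_sub, Complex.exp_add, hle' _ (hrot z₀ hz₀), hle' _ hz₀, mul_comm, div_self]
    exact mul_ne_zero h1 (Complex.exp_ne_zero _)
  obtain ⟨n, hn⟩ := Complex.exp_eq_one_iff.1 hea
  have hit : ∀ k : ℕ, Complex.exp (k * c) * z₀ ∈ L ∧
      l (Complex.exp (k * c) * z₀) = l z₀ + k * (c + a) := by
    intro k
    induction k with
    | zero => simpa using hz₀
    | succ k ih =>
      have he : Complex.exp ((k + 1 : ℕ) * c) * z₀
          = Complex.exp c * (Complex.exp (k * c) * z₀) := by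
        push_cast
        rw [add_mul, one_mul, Complex.exp_add]; ring
      refine ⟨he ▸ hrot _ ih.1, ?_⟩
      rw [he]
      have := hconst _ ih.1
      push_cast
      linear_combination this + ih.2
  have hm1 := (hit m).2
  have hmc : (m : ℂ) * c = 2 * Real.pi * Complex.I := by rw [hc]; field_simp
  rw [hmc, Complex.exp_two_pi_mul_I, one_mul, left_eq_add, mul_add, hmc, hn] at hm1
  have h2 : (2 * Real.pi * Complex.I : ℂ) ≠ 0 := Complex.two_pi_I_ne_zero
  have h3 : (2 * Real.pi * Complex.I : ℂ) * (1 + m * n) = 0 := by rw [← hm1]; ring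
  have h4 : (1 + m * n : ℂ) = 0 := (mul_eq_zero.1 h3).resolve_left h2
  have h5 : (1 + m * n : ℤ) = 0 := by exact_mod_cast h4
  have h6 : (m : ℤ) ∣ 1 := ⟨-n, by linarith⟩
  have := Int.le_of_dvd one_pos h6
  omega

theorem koebe_bound_one {g : ℂ → ℂ} (hg : DifferentiableOn ℂ g (Metric.ball 0 1)) {M ε r : ℝ}
    (hM : ∀ z ∈ Metric.ball 0 1, ‖g z‖ ≤ M) {K : Set ℂ} (hKo : IsOpen K) (hKc : IsPreconnected K)
    (hr : r < 1) (hKr : ∀ z ∈ K, ‖z‖ < r) (hε : ∀ z ∈ K, ‖g z‖ ≤ ε) {m : ℕ} (hm : 2 ≤ m)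
    {s₁ s₂ : ℝ} (h1 : (s₁ : ℂ) ∈ K)
    (h2 : (s₂ : ℂ) * Complex.exp (Real.pi * Complex.I / m) ∈ K) :
    ‖g 0‖ ^ (2 * m) ≤ ε * M * (M ^ 2) ^ (m - 1) := by
  set ω : ℂ := Complex.exp (2 * Real.pi * Complex.I / m) with hω
  set η : ℂ := Complex.exp (Real.pi * Complex.I / m) with hη
  have hm0 : (m : ℂ) ≠ 0 := by exact_mod_cast (by omega : m ≠ 0)
  have hωm : ω ^ m = 1 := by
    rw [hω, ← Complex.exp_nat_mul, mul_div_cancel₀ _ hm0, Complex.exp_two_pi_mul_I]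
  have hω0 : ω ≠ 0 := Complex.exp_ne_zero _
  have hωn : ‖ω‖ = 1 := by
    have : ‖ω‖ ^ m = 1 := by rw [← norm_pow, hωm, norm_one]
    exact (pow_eq_one_iff_of_nonneg (norm_nonneg _) (by omega)).1 this
  have hωη : ω * (starRingEnd ℂ) η = η := by
    rw [hη, ← Complex.exp_conj, hω, ← Complex.exp_add]
    congr 1
    simp only [map_div₀, map_mul, Complex.conj_ofReal, Complex.conj_I, Complex.conj_natCast]
    ring
  let cj : ℂ → ℂ := starRingEnd ℂ
  have hcj : Continuous cj := Complex.continuous_conj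
  let K₁ : Set ℂ := K ∪ cj '' K
  have hcjK : cj '' K = cj ⁻¹' K := by
    ext z
    constructor
    · rintro ⟨w, hw, rfl⟩
      simpa [cj] using hw
    · intro hz
      exact ⟨cj z, hz, by simp [cj]⟩
  have hK₁o : IsOpen K₁ := hKo.union (hcjK ▸ hKo.preimage hcj)
  have hK₁c : IsPreconnected K₁ :=
    IsPreconnected.union (s₁ : ℂ) h1 ⟨s₁, h1, Complex.conj_ofReal _⟩ hKc
      (hKc.image _ hcj.continuousOn)
  have hK₁r : ∀ z ∈ K₁, ‖z‖ < r := by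
    rintro z (hz | ⟨w, hw, rfl⟩)
    · exact hKr z hz
    · simpa [cj] using hKr w hw
  have hεr : ∀ z ∈ K₁, ‖g z‖ ≤ ε ∨ ‖g (cj z)‖ ≤ ε := by
    rintro z (hz | ⟨w, hw, rfl⟩)
    · exact Or.inl (hε z hz)
    · right
      simpa [cj] using hε w hw
  let L : Set ℂ := ⋃ i : ℕ, (fun z => ω ^ i * z) '' K₁
  have hLo : IsOpen L := isOpen_iUnion fun i =>
    (Homeomorph.mulLeft₀ (ω ^ i) (pow_ne_zero _ hω0)).isOpenMap _ hK₁o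
  have hLr : ∀ z ∈ L, ‖z‖ < r := by
    intro z hz
    obtain ⟨i, w, hw, rfl⟩ := mem_iUnion.1 hz
    simpa [hωn] using hK₁r w hw
  have hLb : Bornology.IsBounded L :=
    (Metric.isBounded_ball (x := (0 : ℂ)) (r := r)).subset fun z hz => by simpa using hLr z hz
  have hLc : IsConnected L := by
    refine ⟨⟨s₁, mem_iUnion.2 ⟨0, s₁, Or.inl h1, by simp⟩⟩, ?_⟩
    refine IsPreconnected.iUnion_of_chain (fun i => hK₁c.image _ (by fun_prop)) fun i => ?_
    refine ⟨ω ^ i * (s₂ * η), ⟨_, Or.inl h2, rfl⟩, cj (s₂ * η), Or.inr ⟨_, h2, rfl⟩, ?_⟩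
    simp only [cj, map_mul, Complex.conj_ofReal, pow_succ,
      Order.succ_eq_add_one]
    linear_combination (ω ^ i * s₂) * hωη
  have hrot : ∀ z ∈ L, ω * z ∈ L := by
    intro z hz
    obtain ⟨i, w, hw, rfl⟩ := mem_iUnion.1 hz
    exact mem_iUnion.2 ⟨i + 1, w, hw, by simp only [pow_succ]; ring⟩
  have h0 : (0 : ℂ) ∈ fill L := zero_mem_fill_of_rotation hLo hLb hLc hm hrot
  have hfr : ∀ z ∈ fill L, ‖z‖ < r := by
    intro z hz
    by_contra hc
    exact hz (le_norm_subset_outer hLr (not_lt.1 hc))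
  have hball : closure (fill L) ⊆ Metric.ball 0 1 := by
    refine (closure_minimal (t := Metric.closedBall 0 r) (fun z hz => ?_)
      Metric.isClosed_closedBall).trans (Metric.closedBall_subset_ball hr)
    simpa using (hfr z hz).le
  have hM0 : 0 ≤ M := (norm_nonneg _).trans (hM 0 (by simp))
  have hε0 : 0 ≤ ε := (norm_nonneg _).trans (hε _ h1)
  have hgc : DifferentiableOn ℂ (fun z => cj (g (cj z))) (Metric.ball 0 1) := by
    intro z hz
    have hz' : cj z ∈ Metric.ball (0 : ℂ) 1 := by simpa [cj] using hz
    have := (hg.differentiableAt (Metric.isOpen_ball.mem_nhds hz')).conj_conj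
    simp only [cj, Complex.conj_conj] at this
    exact this.differentiableWithinAt
  let q : ℕ → ℂ → ℂ := fun j z => g (ω ^ j * z) * cj (g (cj (ω ^ j * z)))
  have hωb : ∀ (j : ℕ) (z : ℂ), z ∈ Metric.ball (0 : ℂ) 1 → ω ^ j * z ∈ Metric.ball (0 : ℂ) 1 := by
    intro j z hz
    simpa [hωn] using hz
  have hcb : ∀ z : ℂ, z ∈ Metric.ball (0 : ℂ) 1 → cj z ∈ Metric.ball (0 : ℂ) 1 := by
    intro z hz
    simpa [cj] using hz
  have hqd : ∀ j, DifferentiableOn ℂ (q j) (Metric.ball 0 1) := fun j =>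
    (hg.comp (f := fun z => ω ^ j * z) (by fun_prop) (hωb j)).mul
      (hgc.comp (f := fun z => ω ^ j * z) (by fun_prop) (hωb j))
  have hqn : ∀ j z, ‖q j z‖ = ‖g (ω ^ j * z)‖ * ‖g (cj (ω ^ j * z))‖ := fun j z => by
    simp [q, cj]
  have hqM : ∀ j, ∀ z ∈ Metric.ball (0 : ℂ) 1, ‖q j z‖ ≤ M ^ 2 := by
    intro j z hz
    rw [hqn, pow_two]
    exact mul_le_mul (hM _ (hωb j z hz)) (hM _ (hcb _ (hωb j z hz))) (norm_nonneg _) hM0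
  let P : ℂ → ℂ := fun z => ∏ j ∈ Finset.range m, q j z
  have hPd : DifferentiableOn ℂ P (Metric.ball 0 1) :=
    DifferentiableOn.fun_finsetProd fun j _ => hqd j
  have hPL : ∀ z ∈ L, ‖P z‖ ≤ ε * M * (M ^ 2) ^ (m - 1) := by
    intro z hz
    have hzb : z ∈ Metric.ball (0 : ℂ) 1 := by simpa using (hLr z hz).trans hr
    obtain ⟨i, w, hw, rfl⟩ := mem_iUnion.1 hz
    have hj : (i * (m - 1)) % m ∈ Finset.range m := Finset.mem_range.2 (Nat.mod_lt _ (by omega))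
    have hωj : ω ^ ((i * (m - 1)) % m) * ω ^ i = 1 := by
      rw [← pow_eq_pow_mod _ hωm, ← pow_add]
      have : i * (m - 1) + i = m * i := by
        obtain ⟨k, rfl⟩ : ∃ k, m = k + 1 := ⟨m - 1, by omega⟩
        simp only [Nat.add_sub_cancel]; ring
      rw [this, pow_mul, hωm, one_pow]
    simp only [P]
    rw [norm_prod, ← Finset.mul_prod_erase _ _ hj]
    refine mul_le_mul ?_ ?_ (Finset.prod_nonneg fun _ _ => norm_nonneg _)
      (mul_nonneg hε0 hM0)
    · rw [hqn]
      have hwb : w ∈ Metric.ball (0 : ℂ) 1 := by simpa using (hK₁r w hw).trans hr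
      have : ω ^ ((i * (m - 1)) % m) * (ω ^ i * w) = w := by rw [← mul_assoc, hωj, one_mul]
      rw [this]
      rcases hεr w hw with h | h
      · exact mul_le_mul h (hM _ (hcb _ hwb)) (norm_nonneg _) hε0
      · rw [mul_comm ε M]
        exact mul_le_mul (hM _ hwb) h (norm_nonneg _) hM0
    · refine (Finset.prod_le_prod (fun _ _ => norm_nonneg _) fun j _ => hqM j _ hzb).trans ?_
      rw [Finset.prod_const, Finset.card_erase_of_mem hj, Finset.card_range]
  have hP0 : ‖P 0‖ = ‖g 0‖ ^ (2 * m) := by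
    simp only [P, norm_prod, hqn, mul_zero]
    have : cj 0 = 0 := by simp [cj]
    rw [this, Finset.prod_const, Finset.card_range, ← pow_two, ← pow_mul]
  rw [← hP0]
  refine Complex.norm_le_of_forall_mem_frontier_norm_le (isBounded_fill hLb)
    (hPd.mono hball).diffContOnCl (fun z hz => ?_) (subset_closure h0)
  refine le_on_closure (f := fun z => ‖P z‖) (g := fun _ => ε * M * (M ^ 2) ^ (m - 1)) hPL ?_
    continuousOn_const (frontier_fill_subset hLo hLb hz)
  exact (hPd.continuousOn.mono ((closure_mono (subset_fill L)).trans hball)).norm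

theorem koebe_bound {g : ℂ → ℂ} (hg : DifferentiableOn ℂ g (Metric.ball 0 1)) {M ε r : ℝ}
    (hM : ∀ z ∈ Metric.ball 0 1, ‖g z‖ ≤ M) {K : Set ℂ} (hKo : IsOpen K) (hKc : IsPreconnected K)
    (hr : r < 1) (hKr : ∀ z ∈ K, ‖z‖ < r) (hε : ∀ z ∈ K, ‖g z‖ ≤ ε) {m : ℕ} (hm : 2 ≤ m)
    {d : ℂ} (hd : ‖d‖ = 1) {s₁ s₂ : ℝ} (h1 : s₁ * d ∈ K)
    (h2 : s₂ * (d * Complex.exp (Real.pi * Complex.I / m)) ∈ K) :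
    ‖g 0‖ ^ (2 * m) ≤ ε * M * (M ^ 2) ^ (m - 1) := by
  have hd0 : d ≠ 0 := norm_ne_zero_iff.1 (by rw [hd]; exact one_ne_zero)
  have hb : ∀ z : ℂ, z ∈ Metric.ball (0 : ℂ) 1 → d * z ∈ Metric.ball (0 : ℂ) 1 := by
    intro z hz
    simpa [hd] using hz
  have := koebe_bound_one (g := fun z => g (d * z)) (K := (fun z => d * z) ⁻¹' K) (M := M) (ε := ε)
    (r := r) (m := m) (s₁ := s₁) (s₂ := s₂)
    (hg.comp (f := fun z => d * z) (by fun_prop) hb) (fun z hz => hM _ (hb z hz))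
    (hKo.preimage (by fun_prop))
    ((Homeomorph.mulLeft₀ d hd0).isPreconnected_preimage.2 hKc)
    hr (fun z hz => by simpa [hd] using hKr _ hz) (fun z hz => hε _ hz) hm
    (by simpa [mul_comm] using h1)
    (by
      rw [mem_preimage]
      convert h2 using 1
      ring)
  simpa using this

theorem IsRiemannPair.differentiableOn_inv {U : Set ℂ} {F G : ℂ → ℂ} (hUo : IsOpen U)
    (h : IsRiemannPair U F G) : DifferentiableOn ℂ G (Metric.ball 0 1) := by
  have hFd : ∀ z ∈ U, DifferentiableAt ℂ F z := fun z hz =>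
    h.differentiableOn.differentiableAt (hUo.mem_nhds hz)
  have hGc : ∀ w : ℂ, ‖w‖ < 1 → ContinuousAt G w := fun w hw =>
    h.continuousOn_inv.continuousAt (Metric.isOpen_ball.mem_nhds (by simpa using hw))
  have hreg : ∀ w : ℂ, ‖w‖ < 1 → deriv F (G w) ≠ 0 → DifferentiableAt ℂ G w := by
    intro w hw hne
    refine (HasDerivAt.of_local_left_inverse (hGc w hw) (hFd _ (h.inv_mem w hw)).hasDerivAt hne
      ?_).differentiableAt
    filter_upwards [Metric.isOpen_ball.mem_nhds (show w ∈ Metric.ball (0 : ℂ) 1 by simpa using hw)]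
      with y hy
    exact h.right_inv y (by simpa using hy)
  intro w hw
  have hw' : ‖w‖ < 1 := by simpa using hw
  have han : AnalyticAt ℂ (deriv F) (G w) :=
    (h.differentiableOn.analyticAt (hUo.mem_nhds (h.inv_mem w hw'))).deriv
  have hinjG : ∀ y : ℂ, ‖y‖ < 1 → y ≠ w → G y ≠ G w := fun y hy hne he => hne (by
    rw [← h.right_inv y hy, he, h.right_inv w hw'])
  rcases han.eventually_eq_zero_or_eventually_ne_zero with hz | hz
  · exfalso
    obtain ⟨ρ, hρ, hb⟩ := Metric.eventually_nhds_iff_ball.1 (hz.and (hUo.mem_nhds (h.inv_mem w hw')))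
    have hconst : ∀ y ∈ Metric.ball (G w) ρ, F y = F (G w) := by
      intro y hy
      refine (convex_ball (G w) ρ).is_const_of_fderivWithin_eq_zero (𝕜 := ℂ) (f := F)
        (fun y hy => (hFd y (hb y hy).2).differentiableWithinAt) (fun y hy => ?_) hy
        (Metric.mem_ball_self hρ)
      rw [fderivWithin_of_isOpen Metric.isOpen_ball hy]
      ext
      simpa using (hb y hy).1
    have hρ2 : G w + (ρ / 2 : ℝ) ∈ Metric.ball (G w) ρ := by
      simp [abs_of_pos hρ, hρ]
    have := hconst _ hρ2
    have h3 := congrArg G this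
    rw [h.left_inv _ (hb _ hρ2).2, h.left_inv _ (h.inv_mem w hw')] at h3
    simp [hρ.ne'] at h3
  · obtain ⟨V, hV, hVo, hwV⟩ := eventually_nhds_iff.1 (eventually_nhdsWithin_iff.1 hz)
    have hs : G ⁻¹' V ∩ Metric.ball 0 1 ∈ 𝓝 w :=
      inter_mem ((hGc w hw').preimage_mem_nhds (hVo.mem_nhds hwV)) (Metric.isOpen_ball.mem_nhds hw)
    refine ((Complex.differentiableOn_compl_singleton_and_continuousAt_iff hs).1
      ⟨fun y hy => ?_, hGc w hw'⟩).differentiableAt hs |>.differentiableWithinAt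
    have hy1 : ‖y‖ < 1 := by simpa using hy.1.2
    exact (hreg y hy1 (hV _ hy.1.1 (hinjG y hy1 hy.2))).differentiableWithinAt

end BrouwerPlane

namespace BrouwerPlane

/-- Near `k 0`, the homeomorphism `k` maps the upper half disc into `U` and the rest off `U`. -/
def IsFlatChart (U : Set ℂ) (k : ℂ ≃ₜ ℂ) (ε : ℝ) : Prop :=
  0 < ε ∧ ∀ w ∈ Metric.ball (0 : ℂ) ε, (k w ∈ U ↔ 0 < w.im)

def FlatPt (U : Set ℂ) (p : ℂ) : Prop := ∃ k ε, IsFlatChart U k ε ∧ k 0 = p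

theorem IsFlatChart.flatPt_real {U : Set ℂ} {k : ℂ ≃ₜ ℂ} {ε : ℝ} (h : IsFlatChart U k ε) {s : ℝ}
    (hs : |s| < ε) : FlatPt U (k s) := by
  refine ⟨(Homeomorph.addRight (s : ℂ)).trans k, ε - |s|, ⟨by linarith, fun w hw => ?_⟩, by simp⟩
  have : w + s ∈ Metric.ball (0 : ℂ) ε := by
    rw [mem_ball_zero_iff] at hw ⊢
    have h1 := norm_add_le w (s : ℂ)
    rw [Complex.norm_real, Real.norm_eq_abs] at h1
    linarith
  simpa using h.2 _ this

theorem FlatPt.notMem {U : Set ℂ} {p : ℂ} (h : FlatPt U p) : p ∉ U := by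
  obtain ⟨k, ε, h, rfl⟩ := h
  rw [h.2 0 (Metric.mem_ball_self h.1)]
  simp

theorem FlatPt.mem_closure {U : Set ℂ} {p : ℂ} (h : FlatPt U p) : p ∈ closure U := by
  obtain ⟨k, ε, h, rfl⟩ := h
  have ht : Tendsto (fun t : ℝ => k (t * Complex.I)) (𝓝[>] 0) (𝓝 (k 0)) := by
    have : ContinuousAt (fun t : ℝ => k (t * Complex.I)) 0 := by fun_prop
    simpa using this.tendsto.mono_left nhdsWithin_le_nhds
  refine mem_closure_of_tendsto ht ?_
  filter_upwards [Ioo_mem_nhdsGT h.1] with t ht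
  refine (h.2 _ ?_).2 (by simpa using ht.1)
  simpa [abs_of_pos ht.1] using ht.2

section
variable {U : Set ℂ} {F G : ℂ → ℂ}

theorem IsRiemannPair.image_eq (h : IsRiemannPair U F G) {A : Set ℂ} (hA : A ⊆ U) :
    F '' A = Metric.ball 0 1 ∩ G ⁻¹' A := by
  ext w
  constructor
  · rintro ⟨z, hz, rfl⟩
    exact ⟨by simpa using h.norm_lt z (hA hz), by rw [mem_preimage, h.left_inv z (hA hz)]; exact hz⟩
  · rintro ⟨h1, h2⟩
    exact ⟨G w, h2, h.right_inv w (by simpa using h1)⟩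

theorem IsRiemannPair.isOpen_image (h : IsRiemannPair U F G) {A : Set ℂ} (hA : A ⊆ U)
    (hAo : IsOpen A) : IsOpen (F '' A) := by
  rw [h.image_eq hA]
  exact h.continuousOn_inv.isOpen_inter_preimage Metric.isOpen_ball hAo

theorem IsRiemannPair.norm_clusterPt (h : IsRiemannPair U F G) {p u : ℂ} (hp : p ∉ U)
    (hu : MapClusterPt u (𝓝[U] p) F) : ‖u‖ = 1 := by
  have hle : ‖u‖ ≤ 1 := by
    by_contra hc
    have hev : ∀ᶠ y in 𝓝 u, 1 < ‖y‖ :=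
      continuous_norm.continuousAt.eventually (lt_mem_nhds (not_le.1 hc))
    obtain ⟨z, h1, h2⟩ := ((hu.frequently hev).and_eventually self_mem_nhdsWithin).exists
    linarith [h.norm_lt z h2]
  refine hle.eq_of_not_lt fun hlt => hp ?_
  have hGc : ContinuousAt G u :=
    h.continuousOn_inv.continuousAt (Metric.isOpen_ball.mem_nhds (by simpa using hlt))
  have h1 : MapClusterPt (G u) (𝓝[U] p) (G ∘ F) := hu.continuousAt_comp hGc
  have h2 : map (G ∘ F) (𝓝[U] p) ≤ 𝓝 p := by
    have : map (G ∘ F) (𝓝[U] p) = map id (𝓝[U] p) := by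
      refine Filter.map_congr ?_
      filter_upwards [self_mem_nhdsWithin] with z hz using h.left_inv z hz
    rw [this, map_id]
    exact nhdsWithin_le_nhds
  have h3 : G u = p := eq_of_nhds_neBot (h1.clusterPt.mono h2).neBot
  exact h3 ▸ h.inv_mem u hlt

theorem exists_real_mul_mem {K : Set ℂ} (hK : IsPreconnected K) {z z' d : ℂ} (hz : z ∈ K)
    (hz' : z' ∈ K) (hd : ‖d‖ = 1) (h1 : 0 < ((starRingEnd ℂ) d * z).im)
    (h2 : ((starRingEnd ℂ) d * z').im < 0) : ∃ s : ℝ, (s : ℂ) * d ∈ K := by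
  have hc : ContinuousOn (fun z => ((starRingEnd ℂ) d * z).im) K := by fun_prop
  obtain ⟨y, hy, hy0⟩ := hK.intermediate_value hz' hz hc ⟨h2.le, h1.le⟩
  refine ⟨((starRingEnd ℂ) d * y).re, ?_⟩
  have h3 : (((starRingEnd ℂ) d * y).re : ℂ) = (starRingEnd ℂ) d * y :=
    Complex.ext (by simp) (by simpa using hy0.symm)
  have h4 : (starRingEnd ℂ) d * d = 1 := by
    rw [mul_comm, Complex.mul_conj, Complex.normSq_eq_norm_sq, hd]; simp
  rw [h3]
  convert hy using 1
  linear_combination y * h4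

theorem IsRiemannPair.clusterPt_unique (hUo : IsOpen U) (hUb : Bornology.IsBounded U)
    (h : IsRiemannPair U F G) {p u v : ℂ} (hp : FlatPt U p) (hu : MapClusterPt u (𝓝[U] p) F)
    (hv : MapClusterPt v (𝓝[U] p) F) : u = v := by
  by_contra huv
  have hu1 := h.norm_clusterPt hp.notMem hu
  have hv1 := h.norm_clusterPt hp.notMem hv
  have huv0 : u - v ≠ 0 := sub_ne_zero.2 huv
  have huvn : 0 < ‖u - v‖ := norm_pos_iff.2 huv0
  have hconj : ∀ a : ℂ, ‖a‖ = 1 → a.re * a.re + a.im * a.im = 1 := fun a ha => by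
    have := Complex.normSq_eq_norm_sq a
    rw [ha, Complex.normSq_apply] at this
    simpa using this
  have hsq : 0 < (u.re - v.re) * (u.re - v.re) + (u.im - v.im) * (u.im - v.im) := by
    have := Complex.normSq_pos.2 huv0
    rw [Complex.normSq_apply] at this
    simpa using this
  set d : ℂ := -Complex.I * (u - v) / (‖u - v‖ : ℝ) with hd
  have hd1 : ‖d‖ = 1 := by
    rw [hd, norm_div, norm_mul, norm_neg, Complex.norm_I, one_mul, Complex.norm_real, norm_norm,
      div_self huvn.ne']
  have hdim : ∀ a : ℂ, ((starRingEnd ℂ) d * a).im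
      = ((u.re - v.re) * a.re + (u.im - v.im) * a.im) / ‖u - v‖ := fun a => by
    rw [hd, map_div₀, Complex.conj_ofReal, div_mul_eq_mul_div, Complex.div_ofReal_im]
    simp
    ring
  have hdu : 0 < ((starRingEnd ℂ) d * u).im := by
    rw [hdim]
    refine div_pos ?_ huvn
    nlinarith [hconj u hu1, hconj v hv1]
  have hdv : ((starRingEnd ℂ) d * v).im < 0 := by
    rw [hdim]
    refine div_neg_of_neg_of_pos ?_ huvn
    nlinarith [hconj u hu1, hconj v hv1]
  have hηt : Tendsto (fun m : ℕ => d * Complex.exp (Real.pi * Complex.I / m)) atTop (𝓝 d) := by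
    have h1 : Tendsto (fun m : ℕ => (Real.pi * Complex.I / m : ℂ)) atTop (𝓝 0) :=
      tendsto_const_div_atTop_nhds_zero_nat _
    have h2 := (Complex.continuous_exp.tendsto 0).comp h1
    simpa using h2.const_mul d
  have hop : ∀ a : ℂ, Tendsto (fun m : ℕ => ((starRingEnd ℂ)
      (d * Complex.exp (Real.pi * Complex.I / m)) * a).im) atTop
      (𝓝 ((starRingEnd ℂ) d * a).im) := fun a => by
    have hc : Continuous fun e : ℂ => ((starRingEnd ℂ) e * a).im := by fun_prop
    exact (hc.tendsto d).comp hηt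
  obtain ⟨m, ⟨hmu, hmv⟩, hm⟩ := (((hop u).eventually (lt_mem_nhds hdu)).and
    ((hop v).eventually (gt_mem_nhds hdv))).and (eventually_ge_atTop 2) |>.exists
  set η := Complex.exp (Real.pi * Complex.I / m) with hη
  have hη1 : ‖d * η‖ = 1 := by
    rw [norm_mul, hd1, hη, Complex.norm_exp]
    simp [Complex.div_re]
  obtain ⟨k, ε₀, ⟨hε₀, hk⟩, rfl⟩ := hp
  obtain ⟨M₀, hM₀⟩ := hUb.exists_norm_le
  set M := M₀ + ‖k 0‖ with hM
  have hGM : ∀ w ∈ Metric.ball (0 : ℂ) 1, ‖G w - k 0‖ ≤ M := fun w hw =>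
    (norm_sub_le _ _).trans (by
      have := hM₀ _ (h.inv_mem w (by simpa using hw))
      linarith)
  have hM0 : 0 ≤ M := (norm_nonneg _).trans (hGM 0 (by simp))
  have key : ∀ ε : ℝ, 0 < ε → ‖G 0 - k 0‖ ^ (2 * m) ≤ ε * M * (M ^ 2) ^ (m - 1) := by
    intro ε hε
    obtain ⟨ε₁, hε₁, hb₁⟩ := Metric.continuousAt_iff.1 (k.continuous.continuousAt (x := 0)) ε hε
    obtain ⟨ε₂, hε₂, hlt⟩ := exists_between (lt_min hε₁ hε₀)
    have hlt0 : ε₂ < ε₀ := hlt.trans_le (min_le_right _ _)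
    have hnear : ∀ᶠ z in 𝓝[U] (k 0), ∃ w ∈ Metric.ball (0 : ℂ) ε₂, k w = z ∧ 0 < w.im := by
      have : k '' Metric.ball 0 ε₂ ∈ 𝓝 (k 0) :=
        (k.isOpenMap _ Metric.isOpen_ball).mem_nhds ⟨0, Metric.mem_ball_self hε₂, rfl⟩
      filter_upwards [mem_nhdsWithin_of_mem_nhds this, self_mem_nhdsWithin] with z ⟨w, hw, hwz⟩ hzU
      exact ⟨w, hw, hwz, (hk w (Metric.ball_subset_ball hlt0.le hw)).1 (hwz ▸ hzU)⟩
    have hcu : ∀ e : ℂ, Continuous fun z : ℂ => ((starRingEnd ℂ) e * z).im := fun e => by fun_prop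
    obtain ⟨z, ⟨hz1, hz2⟩, w, hw, rfl, hwi⟩ := ((hu.frequently
      (((hcu d).tendsto u).eventually (lt_mem_nhds hdu) |>.and
        (((hcu (d * η)).tendsto u).eventually (lt_mem_nhds hmu)))).and_eventually hnear).exists
    obtain ⟨z', ⟨hz1', hz2'⟩, w', hw', rfl, hwi'⟩ := ((hv.frequently
      (((hcu d).tendsto v).eventually (gt_mem_nhds hdv) |>.and
        (((hcu (d * η)).tendsto v).eventually (gt_mem_nhds hmv)))).and_eventually hnear).exists
    obtain ⟨τ, hτ, hτw⟩ := exists_between (lt_min hwi hwi')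
    let W : Set ℂ := Metric.ball 0 ε₂ ∩ {w | τ < w.im}
    let Wc : Set ℂ := Metric.closedBall 0 ε₂ ∩ {w | τ ≤ w.im}
    have hWc : W ⊆ Wc := fun y hy => ⟨Metric.ball_subset_closedBall hy.1, (show τ < y.im from hy.2).le⟩
    have hWcU : ∀ y ∈ Wc, k y ∈ U := fun y hy =>
      (hk y (Metric.closedBall_subset_ball hlt0 hy.1)).2 (hτ.trans_le hy.2)
    have hkU : k '' W ⊆ U := by
      rintro _ ⟨y, hy, rfl⟩
      exact hWcU y (hWc hy)
    have hwW : w ∈ W := ⟨hw, hτw.trans_le (min_le_left _ _)⟩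
    have hwW' : w' ∈ W := ⟨hw', hτw.trans_le (min_le_right _ _)⟩
    have hWconn : IsPreconnected W :=
      ((convex_ball (0 : ℂ) ε₂).inter (convex_halfSpace_im_gt τ)).isPreconnected
    have hWo : IsOpen W := Metric.isOpen_ball.inter (isOpen_lt continuous_const Complex.continuous_im)
    have hWcomp : IsCompact Wc := (isCompact_closedBall _ _).inter_right
      (isClosed_le continuous_const Complex.continuous_im)
    have hFk : ContinuousOn (fun y => ‖F (k y)‖) Wc :=
      (h.differentiableOn.continuousOn.comp k.continuous.continuousOn hWcU).norm
    obtain ⟨y₀, hy₀, hmax⟩ := hWcomp.exists_isMaxOn ⟨w, hWc hwW⟩ hFk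
    obtain ⟨r, hr, hr1⟩ := exists_between (h.norm_lt _ (hWcU y₀ hy₀))
    have hKc : IsPreconnected (F '' (k '' W)) :=
      (hWconn.image _ k.continuous.continuousOn).image _ (h.differentiableOn.continuousOn.mono hkU)
    have hzK : F (k w) ∈ F '' (k '' W) := ⟨_, ⟨w, hwW, rfl⟩, rfl⟩
    have hzK' : F (k w') ∈ F '' (k '' W) := ⟨_, ⟨w', hwW', rfl⟩, rfl⟩
    obtain ⟨s₁, hs₁⟩ := exists_real_mul_mem hKc hzK hzK' hd1 hz1 hz1'
    obtain ⟨s₂, hs₂⟩ := exists_real_mul_mem hKc hzK hzK' hη1 hz2 hz2'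
    refine koebe_bound (g := fun w => G w - k 0) ((h.differentiableOn_inv hUo).sub_const _) hGM
      (h.isOpen_image hkU (k.isOpenMap _ hWo)) hKc hr1 ?_ ?_ hm hd1 hs₁ hs₂
    · rintro _ ⟨_, ⟨y, hy, rfl⟩, rfl⟩
      exact (hmax (hWc hy)).trans_lt hr
    · rintro _ ⟨_, ⟨y, hy, rfl⟩, rfl⟩
      rw [h.left_inv _ (hkU ⟨y, hy, rfl⟩), ← dist_eq_norm]
      have hy1 : dist y 0 < ε₁ := (Metric.mem_ball.1 hy.1).trans (hlt.trans_le (min_le_left _ _))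
      exact (hb₁ hy1).le
  have hle : ‖G 0 - k 0‖ ^ (2 * m) ≤ 0 := by
    have ht : Tendsto (fun ε : ℝ => ε * M * (M ^ 2) ^ (m - 1)) (𝓝[>] 0) (𝓝 0) := by
      have : Continuous fun ε : ℝ => ε * M * (M ^ 2) ^ (m - 1) := by fun_prop
      simpa using (this.tendsto 0).mono_left nhdsWithin_le_nhds
    exact ge_of_tendsto ht (by filter_upwards [self_mem_nhdsWithin] with ε hε using key ε hε)
  have h0 : ‖G 0 - k 0‖ = 0 :=
    eq_zero_of_pow_eq_zero (le_antisymm hle (by positivity))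
  have h1 : G 0 = k 0 := sub_eq_zero.1 (norm_eq_zero.1 h0)
  have h2 : k 0 ∈ U := h1 ▸ h.inv_mem 0 (by simp)
  rw [hk 0 (Metric.mem_ball_self hε₀)] at h2
  simp at h2

theorem IsRiemannPair.tendsto_of_flatPt (hUo : IsOpen U) (hUb : Bornology.IsBounded U)
    (h : IsRiemannPair U F G) {p : ℂ} (hp : FlatPt U p) :
    ∃ u, ‖u‖ = 1 ∧ Tendsto F (𝓝[U] p) (𝓝 u) := by
  have : (𝓝[U] p).NeBot := mem_closure_iff_nhdsWithin_neBot.1 hp.mem_closure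
  have hmap : ∀ᶠ z in 𝓝[U] p, F z ∈ Metric.closedBall (0 : ℂ) 1 := by
    filter_upwards [self_mem_nhdsWithin] with z hz
    simpa using (h.norm_lt z hz).le
  obtain ⟨u, -, hu⟩ := (isCompact_closedBall (0 : ℂ) 1).exists_mapClusterPt_of_frequently
    hmap.frequently
  exact ⟨u, h.norm_clusterPt hp.notMem hu, (isCompact_closedBall (0 : ℂ) 1).tendsto_nhds_of_unique_mapClusterPt
    hmap fun v _ hv => (h.clusterPt_unique hUo hUb hp hv hu)⟩

end
end BrouwerPlane

namespace BrouwerPlane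

theorem IsFlatChart.translate {U : Set ℂ} {k : ℂ ≃ₜ ℂ} {ε : ℝ} (h : IsFlatChart U k ε) {s ε' : ℝ}
    (h0 : 0 < ε') (hs : |s| + ε' ≤ ε) :
    IsFlatChart U ((Homeomorph.addRight (s : ℂ)).trans k) ε' := by
  refine ⟨h0, fun w hw => ?_⟩
  have : w + s ∈ Metric.ball (0 : ℂ) ε := by
    rw [mem_ball_zero_iff] at hw ⊢
    have h1 := norm_add_le w (s : ℂ)
    rw [Complex.norm_real, Real.norm_eq_abs] at h1
    linarith
  simpa using h.2 _ this

theorem exists_rotation_near {ζ ξ : ℂ} {ρ κ : ℝ} (hζ : ‖ζ‖ = ρ) (hξ : ‖ξ‖ = ρ) (hρ : 0 < ρ) {m : ℕ}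
    (hm : 0 < m) (hκ : 2 * Real.pi / m < κ / ρ) :
    ∃ j < m, ‖Complex.exp (2 * Real.pi * Complex.I / m) ^ j * ζ - ξ‖ < κ := by
  have hm0 : (m : ℂ) ≠ 0 := by exact_mod_cast hm.ne'
  have hmr : (0 : ℝ) < m := by exact_mod_cast hm
  have hζ0 : ζ ≠ 0 := norm_ne_zero_iff.1 (by rw [hζ]; exact hρ.ne')
  set θ := (ξ / ζ).arg with hθ
  have hq : ξ / ζ = Complex.exp (θ * Complex.I) := by
    have := Complex.norm_mul_exp_arg_mul_I (ξ / ζ)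
    rw [norm_div, hζ, hξ, div_self hρ.ne', Complex.ofReal_one, one_mul] at this
    exact this.symm
  set x := (θ + 2 * Real.pi) * m / (2 * Real.pi) with hx
  have hpi := Real.pi_pos
  have hx0 : 0 ≤ x := by
    have := Complex.neg_pi_lt_arg (ξ / ζ)
    exact div_nonneg (mul_nonneg (by linarith) hmr.le) (by linarith)
  set n := ⌊x⌋₊ with hn
  have hn1 : (n : ℝ) ≤ x := Nat.floor_le hx0
  have hn2 : x < n + 1 := Nat.lt_floor_add_one x
  set ω := Complex.exp (2 * Real.pi * Complex.I / m) with hω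
  have hωm : ω ^ m = 1 := by
    rw [hω, ← Complex.exp_nat_mul, mul_div_cancel₀ _ hm0, Complex.exp_two_pi_mul_I]
  refine ⟨n % m, Nat.mod_lt _ hm, ?_⟩
  rw [← pow_eq_pow_mod _ hωm]
  set y : ℝ := 2 * Real.pi * n / m - (θ + 2 * Real.pi) with hy
  have hyx : y = 2 * Real.pi / m * (n - x) := by
    rw [hy, hx]; field_simp
  have hyb : |y| ≤ 2 * Real.pi / m := by
    rw [hyx, abs_mul, abs_of_pos (by positivity)]
    refine mul_le_of_le_one_right (by positivity) ?_
    rw [abs_le]; constructor <;> linarith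
  have hωn : ω ^ n * ζ - ξ = ξ * (Complex.exp (Complex.I * y) - 1) := by
    have h1 : ω ^ n = (ξ / ζ) * Complex.exp (Complex.I * y) := by
      rw [hq, hω, ← Complex.exp_nat_mul, ← Complex.exp_add, Complex.exp_eq_exp_iff_exists_int]
      refine ⟨1, ?_⟩
      rw [hy]
      push_cast
      ring
    rw [h1]
    field_simp
  rw [hωn, norm_mul, hξ]
  have h2 : ‖Complex.exp (Complex.I * y) - 1‖ ≤ |y| := Real.norm_exp_I_mul_ofReal_sub_one_le
  calc ρ * ‖Complex.exp (Complex.I * y) - 1‖ ≤ ρ * (2 * Real.pi / m) :=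
        mul_le_mul_of_nonneg_left (h2.trans hyb) hρ.le
    _ < ρ * (κ / ρ) := mul_lt_mul_of_pos_left hκ hρ
    _ = κ := by field_simp

section
variable {U : Set ℂ} {F G : ℂ → ℂ}

theorem IsRiemannPair.extend_eq (h : IsRiemannPair U F G) {z : ℂ} (hz : z ∈ U) :
    extendFrom U F z = F z :=
  extendFrom_extends h.differentiableOn.continuousOn z hz

theorem IsRiemannPair.tendsto_extend (hUo : IsOpen U) (hUb : Bornology.IsBounded U)
    (h : IsRiemannPair U F G) {p : ℂ} (hp : FlatPt U p) :
    Tendsto F (𝓝[U] p) (𝓝 (extendFrom U F p)) := by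
  obtain ⟨u, -, hu⟩ := h.tendsto_of_flatPt hUo hUb hp
  exact tendsto_extendFrom ⟨u, hu⟩

theorem IsRiemannPair.norm_extend (hUo : IsOpen U) (hUb : Bornology.IsBounded U)
    (h : IsRiemannPair U F G) {p : ℂ} (hp : FlatPt U p) : ‖extendFrom U F p‖ = 1 := by
  obtain ⟨u, hu1, hu⟩ := h.tendsto_of_flatPt hUo hUb hp
  rw [extendFrom_eq hp.mem_closure hu, hu1]

theorem IsRiemannPair.continuousOn_extend (hUo : IsOpen U) (hUb : Bornology.IsBounded U)
    (h : IsRiemannPair U F G) : ContinuousOn (extendFrom U F) (U ∪ {p | FlatPt U p}) := by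
  refine continuousOn_extendFrom (fun p hp => ?_) fun p hp => ?_
  · rcases hp with hp | hp
    · exact subset_closure hp
    · exact FlatPt.mem_closure hp
  · rcases hp with hp | hp
    · exact ⟨F p, h.differentiableOn.continuousOn p hp⟩
    · exact ⟨_, h.tendsto_extend hUo hUb hp⟩

theorem IsRiemannPair.exists_extend_ne (hUo : IsOpen U) (hUb : Bornology.IsBounded U)
    (h : IsRiemannPair U F G) {k : ℂ ≃ₜ ℂ} {ε : ℝ} (hk : IsFlatChart U k ε) (u : ℂ) :
    ∃ s : ℝ, |s| < ε ∧ extendFrom U F (k s) ≠ u := by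
  classical
  by_contra! hcon
  have hε := hk.1
  have hu1 : ‖u‖ = 1 := by
    have h0 := hcon 0 (by simpa using hε)
    rw [← h0]
    exact h.norm_extend hUo hUb (hk.flatPt_real (by simpa using hε))
  let g : ℂ → ℂ := fun z => if z ∈ U then F z - u else 0
  have hgU : ∀ z ∈ U, g =ᶠ[𝓝 z] fun z => F z - u := fun z hz => by
    filter_upwards [hUo.mem_nhds hz] with y hy
    simp [g, hy]
  have hgd : ∀ z ∈ U, DifferentiableAt ℂ g z := fun z hz =>
    (((h.differentiableOn.differentiableAt (hUo.mem_nhds hz)).sub_const u)).congr_of_eventuallyEq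
      (hgU z hz)
  have hgc : ∀ w ∈ Metric.ball (0 : ℂ) ε, ContinuousAt g (k w) := by
    intro w hw
    by_cases hz : k w ∈ U
    · exact (hgd _ hz).continuousAt
    · have hF : Tendsto F (𝓝[U] (k w)) (𝓝 u) := by
        have him : w.im ≤ 0 := not_lt.1 fun h' => hz ((hk.2 w hw).2 h')
        rcases him.lt_or_eq with hlt | heq
        · have : 𝓝[U] (k w) = ⊥ := by
            rw [← notMem_closure_iff_nhdsWithin_eq_bot]
            intro hcl
            have hnb : k '' (Metric.ball 0 ε ∩ {w | w.im < 0}) ∈ 𝓝 (k w) :=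
              (k.isOpenMap _ (Metric.isOpen_ball.inter
                (isOpen_lt Complex.continuous_im continuous_const))).mem_nhds ⟨w, ⟨hw, hlt⟩, rfl⟩
            obtain ⟨_, ⟨y, ⟨hy1, hy2⟩, rfl⟩, hyU⟩ := mem_closure_iff_nhds.1 hcl _ hnb
            exact lt_asymm hy2 ((hk.2 y hy1).1 hyU)
          rw [this]
          exact tendsto_bot
        · have hws : w = (w.re : ℂ) := Complex.ext (by simp) (by simpa using heq)
          have habs : |w.re| < ε := (Complex.abs_re_le_norm w).trans_lt (mem_ball_zero_iff.1 hw)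
          have := h.tendsto_extend hUo hUb (hk.flatPt_real habs)
          rw [hcon _ habs, ← hws] at this
          exact this
      have hgz : g (k w) = 0 := by simp [g, hz]
      rw [ContinuousAt, hgz]
      refine Tendsto.if (p := fun z => z ∈ U) ?_ tendsto_const_nhds
      have := hF.sub_const u
      rw [sub_self] at this
      exact this
  have hV : k '' Metric.ball 0 ε ∈ 𝓝 (k 0) :=
    (k.isOpenMap _ Metric.isOpen_ball).mem_nhds ⟨0, Metric.mem_ball_self hε, rfl⟩
  obtain ⟨R, hR, hRV⟩ := Metric.mem_nhds_iff.1 hV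
  have hgR : ∀ z ∈ Metric.ball (k 0) R, ContinuousAt g z := by
    intro z hz
    obtain ⟨w, hw, rfl⟩ := hRV hz
    exact hgc w hw
  have hp0 : FlatPt U (k 0) := ⟨k, ε, hk, rfl⟩
  obtain ⟨c, hcU, hcp⟩ := Metric.mem_closure_iff.1 hp0.mem_closure (R / 4) (by linarith)
  obtain ⟨d, κ, hκ, hdp, hdU⟩ : ∃ d : ℂ, ∃ κ > 0, dist (k 0) d < R / 4 ∧
      Metric.ball d κ ⊆ Uᶜ := by
    have ht : Tendsto (fun t : ℝ => k (-(t * Complex.I))) (𝓝[>] 0) (𝓝 (k 0)) := by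
      have : ContinuousAt (fun t : ℝ => k (-(t * Complex.I))) 0 := by fun_prop
      simpa using this.tendsto.mono_left nhdsWithin_le_nhds
    obtain ⟨t, h1, h2⟩ := ((ht.eventually (Metric.ball_mem_nhds _ (by linarith : 0 < R / 4))).and
      (Ioo_mem_nhdsGT hε)).exists
    have hw : -(t * Complex.I) ∈ Metric.ball (0 : ℂ) ε ∩ {w | w.im < 0} := by
      refine ⟨?_, ?_⟩
      · simpa [abs_of_pos h2.1] using h2.2
      · simpa using h2.1
    have hnb : k '' (Metric.ball 0 ε ∩ {w | w.im < 0}) ∈ 𝓝 (k (-(t * Complex.I))) :=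
      (k.isOpenMap _ (Metric.isOpen_ball.inter
        (isOpen_lt Complex.continuous_im continuous_const))).mem_nhds ⟨_, hw, rfl⟩
    obtain ⟨κ, hκ, hb⟩ := Metric.mem_nhds_iff.1 hnb
    refine ⟨k (-(t * Complex.I)), κ, hκ, ?_, fun z hz hzU => ?_⟩
    · rw [dist_comm]; exact h1
    · obtain ⟨y, ⟨hy1, hy2⟩, rfl⟩ := hb hz
      exact lt_asymm hy2 ((hk.2 y hy1).1 hzU)
  have hcd : c ≠ d := fun he => hdU (Metric.mem_ball_self hκ) (he ▸ hcU)
  set ρ := ‖d - c‖ with hρ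
  have hρ0 : 0 < ρ := norm_pos_iff.2 (sub_ne_zero.2 hcd.symm)
  have hρR : ρ < R / 2 := by
    rw [hρ, ← dist_eq_norm]
    have := dist_triangle d (k 0) c
    rw [dist_comm d (k 0)] at this
    linarith
  have hin : ∀ ζ ∈ Metric.closedBall (0 : ℂ) ρ, c + ζ ∈ Metric.ball (k 0) R := by
    intro ζ hζ
    rw [mem_closedBall_zero_iff] at hζ
    rw [Metric.mem_ball]
    have h1 := dist_triangle (c + ζ) c (k 0)
    rw [dist_comm c, dist_eq_norm (c + ζ) c, add_sub_cancel_left] at h1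
    linarith
  obtain ⟨m, hmκ, hm⟩ : ∃ m : ℕ, 2 * Real.pi / m < κ / ρ ∧ 0 < m := by
    have h1 : Tendsto (fun m : ℕ => 2 * Real.pi / (m : ℝ)) atTop (𝓝 0) :=
      tendsto_const_div_atTop_nhds_zero_nat _
    exact ((h1.eventually (gt_mem_nhds (div_pos hκ hρ0))).and (eventually_gt_atTop 0)).exists
  set ω := Complex.exp (2 * Real.pi * Complex.I / m) with hω
  have hωn : ‖ω‖ = 1 := by
    have h1 : (2 * Real.pi * Complex.I / m : ℂ) = ((2 * Real.pi / m : ℝ) : ℂ) * Complex.I := by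
      push_cast; ring
    rw [hω, h1, Complex.norm_exp_ofReal_mul_I]
  have hωb : ∀ (j : ℕ), ∀ ζ ∈ Metric.closedBall (0 : ℂ) ρ, ω ^ j * ζ ∈ Metric.closedBall (0 : ℂ) ρ := by
    intro j ζ hζ
    simpa [hωn] using hζ
  let P : ℂ → ℂ := fun ζ => ∏ j ∈ Finset.range m, g (c + ω ^ j * ζ)
  have hPc : ContinuousOn P (Metric.closedBall 0 ρ) := by
    refine continuousOn_finsetProd _ fun j _ ζ hζ => ?_
    have h1 : ContinuousAt g (c + ω ^ j * ζ) := hgR _ (hin _ (hωb j ζ hζ))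
    exact (ContinuousAt.comp (f := fun ζ => c + ω ^ j * ζ) h1 (by fun_prop)).continuousWithinAt
  have hPs : ∀ ζ : ℂ, ‖ζ‖ = ρ → P ζ = 0 := by
    intro ζ hζ
    obtain ⟨j, hj, hj2⟩ := exists_rotation_near hζ hρ.symm hρ0 hm hmκ
    refine Finset.prod_eq_zero (Finset.mem_range.2 hj) ?_
    have : c + ω ^ j * ζ ∈ Metric.ball d κ := by
      rw [Metric.mem_ball, dist_eq_norm]
      have he : c + ω ^ j * ζ - d = ω ^ j * ζ - (d - c) := by ring
      rw [he]
      exact hj2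
    simp only [g, if_neg (hdU this)]
  have hP0 : P 0 ≠ 0 := by
    simp only [P, mul_zero, add_zero, Finset.prod_const]
    refine pow_ne_zero _ ?_
    simp only [g, if_pos hcU]
    rw [sub_ne_zero]
    intro he
    have := h.norm_lt c hcU
    rw [he, hu1] at this
    exact lt_irrefl _ this
  let Q : Set ℂ := Metric.ball 0 ρ ∩ P ⁻¹' {0}ᶜ
  have hQo : IsOpen Q :=
    (hPc.mono Metric.ball_subset_closedBall).isOpen_inter_preimage Metric.isOpen_ball
      isClosed_singleton.isOpen_compl
  have hQcl : closure Q ⊆ Metric.closedBall 0 ρ :=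
    closure_minimal (inter_subset_left.trans Metric.ball_subset_closedBall) Metric.isClosed_closedBall
  have hQd : DifferentiableOn ℂ P Q := by
    refine DifferentiableOn.fun_finsetProd fun j hj ζ hζ => ?_
    have hne : g (c + ω ^ j * ζ) ≠ 0 := fun h0 => hζ.2 (Finset.prod_eq_zero hj h0)
    have hmem : c + ω ^ j * ζ ∈ U := by
      by_contra hc
      exact hne (by simp only [g, if_neg hc])
    exact (DifferentiableAt.comp (f := fun ζ => c + ω ^ j * ζ) ζ (hgd _ hmem)
      (by fun_prop)).differentiableWithinAt
  have hfin := Complex.norm_le_of_forall_mem_frontier_norm_le (f := P) (U := Q) (C := 0)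
    (Metric.isBounded_ball.subset inter_subset_left) ⟨hQd, hPc.mono hQcl⟩ (fun ζ hζ => by
      rw [hQo.frontier_eq] at hζ
      have h1 : ‖ζ‖ ≤ ρ := by simpa using hQcl hζ.1
      rcases h1.lt_or_eq with h2 | h2
      · by_contra hc
        exact hζ.2 ⟨by simpa using h2, fun h0 => hc (by
          rw [mem_singleton_iff] at h0
          rw [h0, norm_zero])⟩
      · rw [hPs ζ h2, norm_zero])
    (subset_closure (show (0 : ℂ) ∈ Q from ⟨Metric.mem_ball_self hρ0, hP0⟩))
  exact hP0 (norm_le_zero_iff.1 hfin)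

theorem IsRiemannPair.exists_lens (hUo : IsOpen U) (hUb : Bornology.IsBounded U)
    (h : IsRiemannPair U F G) {p : ℂ} (hp : FlatPt U p) {N : Set ℂ} (hN : N ∈ 𝓝 p) :
    ∃ δ > 0, ∀ w : ℂ, ‖w‖ < 1 → dist w (extendFrom U F p) < δ → G w ∈ N := by
  obtain ⟨k, ε, hk, rfl⟩ := hp
  have hp : FlatPt U (k 0) := ⟨k, ε, hk, rfl⟩
  set u := extendFrom U F (k 0) with hu
  have hu1 : ‖u‖ = 1 := h.norm_extend hUo hUb hp
  obtain ⟨ε', hε', hkN⟩ := Metric.mem_nhds_iff.1 (k.continuous.continuousAt.preimage_mem_nhds hN)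
  set η := min ε ε' / 2 with hη
  have hη0 : 0 < η := half_pos (lt_min hk.1 hε')
  have hηε : 2 * η ≤ ε := by rw [hη]; linarith [min_le_left ε ε']
  have hηε' : 2 * η ≤ ε' := by rw [hη]; linarith [min_le_right ε ε']
  obtain ⟨t₁, ht₁, ht₁', hne₁⟩ : ∃ t : ℝ, -η < t ∧ t < 0 ∧ extendFrom U F (k t) ≠ u := by
    obtain ⟨s, hs, hne⟩ := h.exists_extend_ne hUo hUb (hk.translate (s := -(η / 2))
      (half_pos hη0) (by rw [abs_neg, abs_of_pos (half_pos hη0)]; linarith)) u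
    rw [abs_lt] at hs
    refine ⟨s - η / 2, by linarith, by linarith, ?_⟩
    rw [Homeomorph.trans_apply] at hne
    convert hne using 3
    simp [sub_eq_add_neg]
  obtain ⟨t₂, ht₂, ht₂', hne₂⟩ : ∃ t : ℝ, 0 < t ∧ t < η ∧ extendFrom U F (k t) ≠ u := by
    obtain ⟨s, hs, hne⟩ := h.exists_extend_ne hUo hUb (hk.translate (s := η / 2)
      (half_pos hη0) (by rw [abs_of_pos (half_pos hη0)]; linarith)) u
    rw [abs_lt] at hs
    refine ⟨s + η / 2, by linarith, by linarith, ?_⟩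
    rw [Homeomorph.trans_apply] at hne
    convert hne using 3
    simp
  let Rc : Set ℂ := {w | (t₁ ≤ w.re ∧ w.re ≤ t₂) ∧ 0 ≤ w.im ∧ w.im ≤ η}
  let R : Set ℂ := {w | (t₁ < w.re ∧ w.re < t₂) ∧ 0 < w.im ∧ w.im < η}
  have hre := Complex.continuous_re
  have him := Complex.continuous_im
  have hRo : IsOpen R := ((isOpen_lt continuous_const hre).inter (isOpen_lt hre continuous_const)).inter
    ((isOpen_lt continuous_const him).inter (isOpen_lt him continuous_const))
  have hRcc : IsClosed Rc :=
    ((isClosed_le continuous_const hre).inter (isClosed_le hre continuous_const)).inter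
    ((isClosed_le continuous_const him).inter (isClosed_le him continuous_const))
  have hRcn : ∀ w ∈ Rc, ‖w‖ < 2 * η := by
    rintro w ⟨⟨h1, h2⟩, h3, h4⟩
    have hlt : |w.re| < η := by rw [abs_lt]; constructor <;> linarith
    have hle : |w.im| ≤ η := by rw [abs_le]; constructor <;> linarith
    have := Complex.norm_le_abs_re_add_abs_im w
    linarith
  have hRcb : ∀ w ∈ Rc, w ∈ Metric.ball (0 : ℂ) ε := fun w hw => by
    rw [mem_ball_zero_iff]; exact (hRcn w hw).trans_le hηε
  have hRR : R ⊆ Rc := fun w hw => ⟨⟨hw.1.1.le, hw.1.2.le⟩, hw.2.1.le, hw.2.2.le⟩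
  let B : Set ℂ := Rc ∩ {w | w.re = t₁ ∨ w.re = t₂ ∨ w.im = η}
  have hBc : IsCompact B := by
    refine Metric.isCompact_of_isClosed_isBounded (hRcc.inter ?_) ?_
    · exact (isClosed_eq hre continuous_const).union ((isClosed_eq hre continuous_const).union
        (isClosed_eq him continuous_const))
    · exact (Metric.isBounded_ball (x := (0 : ℂ)) (r := 2 * η)).subset fun w hw => by
        rw [mem_ball_zero_iff]; exact hRcn w hw.1
  have hflat : ∀ w ∈ Rc, w.im = 0 → w = (w.re : ℂ) ∧ FlatPt U (k w) := by
    intro w hw h0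
    have hws : w = (w.re : ℂ) := Complex.ext (by simp) (by simpa using h0)
    refine ⟨hws, ?_⟩
    rw [hws]
    exact hk.flatPt_real ((Complex.abs_re_le_norm w).trans_lt (mem_ball_zero_iff.1 (hRcb w hw)))
  have hmaps : ∀ w ∈ Rc, k w ∈ U ∪ {p | FlatPt U p} := by
    intro w hw
    rcases hw.2.1.lt_or_eq with h1 | h1
    · exact Or.inl ((hk.2 w (hRcb w hw)).2 h1)
    · exact Or.inr (hflat w hw h1.symm).2
  have hcB : ContinuousOn (fun w => extendFrom U F (k w)) B :=
    (h.continuousOn_extend hUo hUb).comp k.continuous.continuousOn fun w hw => hmaps w hw.1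
  have hIc := (hBc.image_of_continuousOn hcB).isClosed
  have hnot : u ∉ (fun w => extendFrom U F (k w)) '' B := by
    rintro ⟨w, ⟨hw, hside⟩, he⟩
    rcases hw.2.1.lt_or_eq with h1 | h1
    · have hwU : k w ∈ U := (hk.2 w (hRcb w hw)).2 h1
      have h2 := h.norm_lt _ hwU
      simp only [] at he
      rw [h.extend_eq hwU] at he
      rw [he, hu1] at h2
      exact lt_irrefl _ h2
    · have hws := (hflat w hw h1.symm).1
      rcases hside with h2 | h2 | h2
      · rw [h2] at hws
        exact hne₁ (hws ▸ he)
      · rw [h2] at hws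
        exact hne₂ (hws ▸ he)
      · rw [← h1] at h2
        exact hη0.ne h2
  obtain ⟨δ, hδ, hδI⟩ := Metric.mem_nhds_iff.1 (hIc.isOpen_compl.mem_nhds hnot)
  let S : Set ℂ := Metric.ball u δ ∩ Metric.ball 0 1
  have hSc : IsPreconnected S := ((convex_ball u δ).inter (convex_ball 0 1)).isPreconnected
  let T : Set ℂ := (fun w => k.symm (G w)) '' S
  have hTc : IsPreconnected T := hSc.image _
    (k.symm.continuous.comp_continuousOn (h.continuousOn_inv.mono inter_subset_right))
  have hTU : ∀ y ∈ T, k y ∈ U := by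
    rintro _ ⟨w, hw, rfl⟩
    simpa using h.inv_mem w (by simpa using hw.2)
  have hTB : ∀ y ∈ T, y ∉ B := by
    rintro y hyT hyB
    have hyU := hTU y hyT
    obtain ⟨w, hw, rfl⟩ := hyT
    refine hδI hw.1 ⟨_, hyB, ?_⟩
    simp only [Homeomorph.apply_symm_apply] at hyU ⊢
    rw [h.extend_eq hyU, h.right_inv w (by simpa using hw.2)]
  have hTR : (T ∩ R).Nonempty := by
    have ht : Tendsto (fun t : ℝ => k (t * Complex.I)) (𝓝[>] 0) (𝓝[U] (k 0)) := by
      refine tendsto_nhdsWithin_iff.2 ⟨?_, ?_⟩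
      · have : ContinuousAt (fun t : ℝ => k (t * Complex.I)) 0 := by fun_prop
        simpa using this.tendsto.mono_left nhdsWithin_le_nhds
      · filter_upwards [Ioo_mem_nhdsGT hk.1] with t ht
        refine (hk.2 _ ?_).2 (by simpa using ht.1)
        simpa [abs_of_pos ht.1] using ht.2
    have ht2 := (h.tendsto_extend hUo hUb hp).comp ht
    obtain ⟨t, h1, ⟨h2, h3⟩, h4⟩ := ((ht2.eventually (Metric.ball_mem_nhds u hδ)).and
      ((eventually_of_mem (Ioo_mem_nhdsGT hη0) fun _ h => h).and
        (ht.eventually self_mem_nhdsWithin))).exists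
    refine ⟨t * Complex.I, ⟨F (k (t * Complex.I)), ⟨h1, ?_⟩, ?_⟩, ?_⟩
    · simpa using h.norm_lt _ h4
    · simp only []
      rw [h.left_inv _ h4, k.symm_apply_apply]
    · refine ⟨⟨by simpa using ht₁', by simpa using ht₂⟩, by simpa using h2, by simpa using h3⟩
  have hTsub : T ⊆ R := by
    refine (subset_or_disjoint_of_frontier hTc hRo ?_).resolve_right
      (not_disjoint_iff_nonempty_inter.2 hTR)
    rw [disjoint_left]
    intro y hyT hyF
    rw [hRo.frontier_eq] at hyF
    have hyR : y ∈ Rc := closure_minimal hRR hRcc hyF.1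
    have hpos : 0 < y.im := (hk.2 y (hRcb y hyR)).1 (hTU y hyT)
    refine hTB y hyT ⟨hyR, ?_⟩
    by_contra hc
    have hc' : ¬ y.re = t₁ ∧ ¬ y.re = t₂ ∧ ¬ y.im = η := by
      refine ⟨fun h => hc (Or.inl h), fun h => hc (Or.inr (Or.inl h)),
        fun h => hc (Or.inr (Or.inr h))⟩
    exact hyF.2 ⟨⟨lt_of_le_of_ne hyR.1.1 (Ne.symm hc'.1), lt_of_le_of_ne hyR.1.2 hc'.2.1⟩, hpos,
      lt_of_le_of_ne hyR.2.2 hc'.2.2⟩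
  refine ⟨δ, hδ, fun w hw hwd => ?_⟩
  have hmem : k.symm (G w) ∈ R := hTsub ⟨w, ⟨hwd, by simpa using hw⟩, rfl⟩
  have := hkN (show k.symm (G w) ∈ Metric.ball (0 : ℂ) ε' by
    rw [mem_ball_zero_iff]; exact (hRcn _ (hRR hmem)).trans_le hηε')
  simpa using this

end

/-- A homeomorphism from `U` and its flat boundary points onto a subset of the closed disc. -/
structure IsDiscChart (U : Set ℂ) (Φ : ℂ → ℂ) : Prop where
  norm_lt : ∀ z ∈ U, ‖Φ z‖ < 1
  exists_eq : ∀ w, ‖w‖ < 1 → ∃ z ∈ U, Φ z = w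
  norm_eq : ∀ p, FlatPt U p → ‖Φ p‖ = 1
  continuousOn : ContinuousOn Φ (U ∪ {p | FlatPt U p})
  sep : ∀ p ∈ U ∪ {p | FlatPt U p}, ∀ N ∈ 𝓝 p, ∃ δ > 0, ∀ q ∈ U ∪ {p | FlatPt U p},
    dist (Φ q) (Φ p) < δ → q ∈ N

theorem exists_isDiscChart {U : Set ℂ} (hUo : IsOpen U) (hUb : Bornology.IsBounded U)
    (hUc : IsConnected U) (hlog : HasLog U) : ∃ Φ, IsDiscChart U Φ := by
  obtain ⟨F, G, h⟩ := exists_isRiemannPair hUo hUb hUc hlog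
  refine ⟨extendFrom U F, ⟨fun z hz => ?_, fun w hw => ?_, fun p hp => h.norm_extend hUo hUb hp,
    h.continuousOn_extend hUo hUb, ?_⟩⟩
  · rw [h.extend_eq hz]; exact h.norm_lt z hz
  · exact ⟨G w, h.inv_mem w hw, by rw [h.extend_eq (h.inv_mem w hw), h.right_inv w hw]⟩
  · rintro p (hp | hp) N hN
    · have hp1 := h.norm_lt p hp
      have hGc : ContinuousAt G (F p) :=
        h.continuousOn_inv.continuousAt (Metric.isOpen_ball.mem_nhds (by simpa using hp1))
      have hN' : G ⁻¹' N ∩ Metric.ball 0 1 ∈ 𝓝 (F p) :=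
        inter_mem (hGc.preimage_mem_nhds (by rwa [h.left_inv p hp]))
          (Metric.isOpen_ball.mem_nhds (by simpa using hp1))
      obtain ⟨δ, hδ, hb⟩ := Metric.mem_nhds_iff.1 hN'
      refine ⟨δ, hδ, fun q hq hd => ?_⟩
      rw [h.extend_eq hp] at hd
      have h2 := hb hd
      rcases hq with hq | hq
      · have := h2.1
        rwa [h.extend_eq hq, mem_preimage, h.left_inv q hq] at this
      · have h3 := h2.2
        rw [mem_ball_zero_iff, h.norm_extend hUo hUb hq] at h3
        exact absurd h3 (lt_irrefl _)
    · obtain ⟨N', hN', hN'c, hN'N⟩ := exists_mem_nhds_isClosed_subset hN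
      obtain ⟨δ, hδ, hl⟩ := h.exists_lens hUo hUb hp hN'
      refine ⟨δ, hδ, fun q hq hd => hN'N ?_⟩
      rcases hq with hq | hq
      · rw [h.extend_eq hq] at hd
        have := hl _ (h.norm_lt q hq) hd
        rwa [h.left_inv q hq] at this
      · have hev := (h.tendsto_extend hUo hUb hq).eventually
          (Metric.isOpen_ball.mem_nhds (show extendFrom U F q ∈ Metric.ball (extendFrom U F p) δ
            from hd))
        have : ∀ᶠ z in 𝓝[U] q, z ∈ N' := by
          filter_upwards [hev, self_mem_nhdsWithin] with z hz hzU
          have := hl _ (h.norm_lt z hzU) hz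
          rwa [h.left_inv z hzU] at this
        have hnb : (𝓝[U] q).NeBot := mem_closure_iff_nhdsWithin_neBot.1 (FlatPt.mem_closure hq)
        exact hN'c.mem_of_tendsto (tendsto_id.mono_right nhdsWithin_le_nhds) this

theorem IsDiscChart.injOn {U : Set ℂ} {Φ : ℂ → ℂ} (h : IsDiscChart U Φ) :
    InjOn Φ (U ∪ {p | FlatPt U p}) := by
  intro p hp q hq he
  by_contra hne
  obtain ⟨δ, hδ, hs⟩ := h.sep p hp {q}ᶜ (isOpen_compl_singleton.mem_nhds hne)
  exact hs q hq (by rw [he, dist_self]; exact hδ) rfl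

end BrouwerPlane

namespace BrouwerPlane

theorem isCompact_convexJoin {s t : Set ℂ} (hs : IsCompact s) (ht : IsCompact t) :
    IsCompact (convexJoin ℝ s t) := by
  have h := ((isCompact_Icc (a := (0 : ℝ)) (b := 1)).prod (hs.prod ht)).image
    (f := fun q : ℝ × ℂ × ℂ => (1 - q.1) • q.2.1 + q.1 • q.2.2) (by fun_prop)
  convert h using 1
  ext x
  simp only [mem_convexJoin, segment_eq_image, mem_image, Prod.exists, mem_prod]
  constructor
  · rintro ⟨a, ha, b, hb, θ, hθ, rfl⟩
    exact ⟨θ, a, b, ⟨hθ, ha, hb⟩, rfl⟩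
  · rintro ⟨θ, a, b, ⟨hθ, ha, hb⟩, rfl⟩
    exact ⟨a, ha, b, hb, θ, hθ, rfl⟩

theorem convex_ball_union_pair {r : ℝ} {a b : ℂ} (ha : ‖a‖ = r) (hb : ‖b‖ = r) :
    Convex ℝ (Metric.ball (0 : ℂ) r ∪ {a, b}) := by
  rw [convex_iff_openSegment_subset]
  intro x hx y hy
  have hle : ∀ w ∈ Metric.ball (0 : ℂ) r ∪ {a, b}, w ∈ Metric.closedBall (0 : ℂ) r := by
    rintro w (hw | rfl | rfl)
    · exact Metric.ball_subset_closedBall hw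
    · simp [ha]
    · simp [hb]
  by_cases hxy : x = y
  · subst hxy
    simpa using hx
  · exact (openSegment_subset_ball_of_ne (hle x hx) (hle y hy) hxy).trans subset_union_left

/-- A set `U` disjoint from its forward iterates, whose boundary near the origin is the real line,
with `h⁻¹ U` on the other side. -/
structure IsHalfDomain (h : ℂ ≃ₜ ℂ) (U : Set ℂ) (ρ : ℝ) : Prop where
  pos : 0 < ρ
  isOpen : IsOpen U
  isBounded : Bornology.IsBounded U
  isConnected : IsConnected U
  hasLog : HasLog U
  disjoint : ∀ n : ℕ, 1 ≤ n → ∀ z ∈ U, h^[n] z ∉ U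
  mem_iff : ∀ w ∈ Metric.ball (0 : ℂ) ρ, w ∈ U ↔ 0 < w.im
  apply_mem_iff : ∀ w ∈ Metric.ball (0 : ℂ) ρ, h w ∈ U ↔ w.im < 0

theorem exists_im_pos_near {w : ℂ} (hw : w.im = 0) {N : Set ℂ} (hN : N ∈ 𝓝 w) :
    ∃ v ∈ N, 0 < v.im := by
  have ht : Tendsto (fun t : ℝ => w + t * Complex.I) (𝓝[>] 0) (𝓝 w) := by
    have : ContinuousAt (fun t : ℝ => w + t * Complex.I) 0 := by fun_prop
    simpa using this.tendsto.mono_left nhdsWithin_le_nhds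
  obtain ⟨t, h1, h2⟩ := ((ht.eventually hN).and self_mem_nhdsWithin).exists
  exact ⟨_, h1, by simpa [hw] using h2⟩

theorem exists_im_neg_near {w : ℂ} (hw : w.im = 0) {N : Set ℂ} (hN : N ∈ 𝓝 w) :
    ∃ v ∈ N, v.im < 0 := by
  have ht : Tendsto (fun t : ℝ => w - t * Complex.I) (𝓝[>] 0) (𝓝 w) := by
    have : ContinuousAt (fun t : ℝ => w - t * Complex.I) 0 := by fun_prop
    simpa using this.tendsto.mono_left nhdsWithin_le_nhds
  obtain ⟨t, h1, h2⟩ := ((ht.eventually hN).and self_mem_nhdsWithin).exists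
  exact ⟨_, h1, by simpa [hw] using h2⟩

theorem IsBrouwer.exists_isHalfDomain {h : ℂ ≃ₜ ℂ} (hh : IsBrouwer h) {z : ℂ} {r t ρ : ℝ}
    (hρ : 0 < ρ) (hρr : ρ < r) (hz : ‖z‖ = r) (hhz : ‖h z‖ = r)
    (hcrit : ∀ w, r ≤ max ‖w‖ ‖h w‖) (ht : 0 < t) (hzt : h z - z = t * Complex.I) :
    ∃ U, IsHalfDomain h U ρ := by
  have hre : (h z).re = z.re := by
    have := congrArg Complex.re hzt
    simp at this
    linarith
  have him : (h z).im = z.im + t := by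
    have := congrArg Complex.im hzt
    simp at this
    linarith
  have hsq : (h z).im ^ 2 = z.im ^ 2 := by
    have h1 := Complex.sq_norm z
    have h2 := Complex.sq_norm (h z)
    rw [hz, Complex.normSq_apply] at h1
    rw [hhz, Complex.normSq_apply, hre] at h2
    nlinarith
  have hsum : (h z).im = - z.im := by
    rcases sq_eq_sq_iff_eq_or_eq_neg.1 hsq with h1 | h1
    · linarith
    · exact h1
  have hzim : z.im < 0 := by linarith
  have hhzim : 0 < (h z).im := by linarith
  set B := Metric.ball (0 : ℂ) r with hB
  have hBfree : Free h B := by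
    intro w hw hw'
    rw [hB, mem_ball_zero_iff] at hw hw'
    exact absurd (hcrit w) (not_le.2 (max_lt hw hw'))
  have hB2 : Free h^[2] B := hh.free_iterate Metric.isOpen_ball (convex_ball 0 r).isPreconnected
    hBfree (by norm_num)
  have hclB : ∀ w, ‖w‖ = r → w ∈ closure B := fun w hw => by
    rw [hB, closure_ball _ (by linarith)]
    simp [hw]
  have hc2 : Continuous h^[2] := h.continuous.iterate 2
  have hzn : ∀ w, ‖w‖ = r → h^[2] w ∉ B := fun w hw hw' => by
    obtain ⟨v, hv, hvB⟩ := mem_closure_iff_nhds.1 (hclB w hw) _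
      (hc2.continuousAt.preimage_mem_nhds (Metric.isOpen_ball.mem_nhds hw'))
    exact hB2 v hvB hv
  have hnz : ∀ w ∈ B, ‖h^[2] w‖ ≠ r := fun w hw hw' => by
    have hopen : IsOpen (h^[2] '' B) := by
      have : h^[2] '' B = h '' (h '' B) := by
        rw [image_image]; rfl
      rw [this]
      exact h.isOpenMap _ (h.isOpenMap _ Metric.isOpen_ball)
    obtain ⟨v, ⟨u, hu, rfl⟩, hvB⟩ := mem_closure_iff_nhds.1 (hclB _ hw') _
      (hopen.mem_nhds ⟨w, hw, rfl⟩)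
    exact hB2 u hu hvB
  set C := convexJoin ℝ (segment ℝ z (h z)) (Metric.closedBall 0 ρ) with hC
  have hsegc : IsCompact (segment ℝ z (h z)) := by
    rw [segment_eq_image]
    exact isCompact_Icc.image (by fun_prop)
  have hCc : IsCompact C := isCompact_convexJoin hsegc (isCompact_closedBall 0 ρ)
  have hCconv : Convex ℝ C := (convex_segment z (h z)).convexJoin (convex_closedBall 0 ρ)
  have hne0 : (Metric.closedBall (0 : ℂ) ρ).Nonempty := ⟨0, Metric.mem_closedBall_self hρ.le⟩
  have hzC : z ∈ C := subset_convexJoin_left hne0 (left_mem_segment ℝ z (h z))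
  have hhzC : h z ∈ C := subset_convexJoin_left hne0 (right_mem_segment ℝ z (h z))
  have hballC : Metric.closedBall 0 ρ ⊆ C := subset_convexJoin_right ⟨z, left_mem_segment ℝ z (h z)⟩
  have hCB : C ⊆ B ∪ {z, h z} := by
    have hconv := convex_ball_union_pair hz hhz
    refine convexJoin_subset ?_ ?_ hconv
    · exact hconv.segment_subset (Or.inr (by simp)) (Or.inr (by simp))
    · exact (Metric.closedBall_subset_ball hρr).trans subset_union_left
  have hintC : interior C ⊆ B := by
    have h1 : C ⊆ Metric.closedBall 0 r := hCB.trans (by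
      rintro w (hw | rfl | rfl)
      · exact Metric.ball_subset_closedBall hw
      · simp [hz]
      · simp [hhz])
    have h2 := interior_mono h1
    rwa [interior_closedBall _ (by linarith)] at h2
  have hzz : h^[2] z ∉ C := fun hc => by
    rcases hCB hc with h1 | h1 | h1
    · exact hzn z hz h1
    · exact hh.iterate_ne (by norm_num) z h1
    · exact hh.2 (h z) h1
  have hkey : ∀ w ∈ C, h w ∈ C → w = z := by
    intro w hw hhw
    rcases hCB hw with h1 | h1 | h1
    · rcases hCB hhw with h2 | h2 | h2
      · exact absurd h2 (hBfree w h1)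
      · refine absurd ?_ (hnz w h1)
        show ‖h (h w)‖ = r
        rw [h2, hhz]
      · exact h.injective h2
    · exact h1
    · refine absurd ?_ hzz
      rw [h1] at hhw
      exact hhw
  set P := interior C ∩ {w | 0 < w.im} with hP
  set N := interior C ∩ {w | w.im < 0} with hN
  have hPo : IsOpen P := isOpen_interior.inter (isOpen_lt continuous_const Complex.continuous_im)
  have hNo : IsOpen N := isOpen_interior.inter (isOpen_lt Complex.continuous_im continuous_const)
  have hPC : P ⊆ C := inter_subset_left.trans interior_subset
  have hNC : N ⊆ C := inter_subset_left.trans interior_subset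
  have hPconv : Convex ℝ P := hCconv.interior.inter (convex_halfSpace_im_gt 0)
  have hNconv : Convex ℝ N := hCconv.interior.inter (convex_halfSpace_im_lt 0)
  have hballint : Metric.ball 0 ρ ⊆ interior C :=
    interior_maximal (Metric.ball_subset_closedBall.trans hballC) Metric.isOpen_ball
  have hhzP : h z ∈ closure P := by
    obtain ⟨p, hp, hp0⟩ := exists_im_pos_near (w := 0) rfl (Metric.ball_mem_nhds 0 hρ)
    refine closure_mono ?_ (segment_subset_closure_openSegment (right_mem_segment ℝ p (h z)))
    refine subset_inter (hCconv.openSegment_interior_closure_subset_interior (hballint hp)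
      (subset_closure hhzC)) ?_
    exact (openSegment_subset_segment ℝ _ _).trans ((convex_halfSpace_im_gt 0).segment_subset hp0 hhzim)
  have hzN : z ∈ closure N := by
    obtain ⟨p, hp, hp0⟩ := exists_im_neg_near (w := 0) rfl (Metric.ball_mem_nhds 0 hρ)
    refine closure_mono ?_ (segment_subset_closure_openSegment (right_mem_segment ℝ p z))
    refine subset_inter (hCconv.openSegment_interior_closure_subset_interior (hballint hp)
      (subset_closure hzC)) ?_
    exact (openSegment_subset_segment ℝ _ _).trans ((convex_halfSpace_im_lt 0).segment_subset hp0 hzim)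
  set Cp := C ∩ {w | 0 ≤ w.im} with hCp
  have hCpc : IsCompact Cp := hCc.inter_right (isClosed_le continuous_const Complex.continuous_im)
  have hPCp : P ⊆ Cp := fun w hw => ⟨hPC hw, show 0 ≤ w.im from le_of_lt hw.2⟩
  have hnear : ∀ᶠ w in 𝓝 (h z), 0 < w.im ∧ w ∉ h '' Cp ∧ h w ∉ C ∧ w ∉ h '' (h '' C) := by
    have h0 : ∀ᶠ w in 𝓝 (h z), 0 < w.im :=
      (isOpen_lt continuous_const Complex.continuous_im).mem_nhds hhzim
    have h1 : ∀ᶠ w in 𝓝 (h z), w ∉ h '' Cp := by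
      refine (hCpc.image h.continuous).isClosed.isOpen_compl.mem_nhds ?_
      rintro ⟨w, hw, he⟩
      rw [h.injective he] at hw
      exact absurd hw.2 (not_le.2 hzim)
    have h2 : ∀ᶠ w in 𝓝 (h z), h w ∉ C :=
      h.continuous.continuousAt.preimage_mem_nhds (hCc.isClosed.isOpen_compl.mem_nhds hzz)
    have h3 : ∀ᶠ w in 𝓝 (h z), w ∉ h '' (h '' C) := by
      refine ((hCc.image h.continuous).image h.continuous).isClosed.isOpen_compl.mem_nhds ?_
      rintro ⟨_, ⟨w, hw, rfl⟩, he⟩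
      have h1 := h.injective he
      have h2 := hkey w hw (h1 ▸ hzC)
      rw [h2] at h1
      exact hh.2 z h1
    exact h0.and (h1.and (h2.and h3))
  obtain ⟨η, hη, hV, hVfree⟩ : ∃ η > 0, (∀ w ∈ Metric.ball (h z) η,
      0 < w.im ∧ w ∉ h '' Cp ∧ h w ∉ C ∧ w ∉ h '' (h '' C)) ∧ Free h (Metric.ball (h z) η) := by
    obtain ⟨η₁, hη₁, h1⟩ := Metric.eventually_nhds_iff_ball.1 hnear
    obtain ⟨Y, hYo, -, -, hYf, hY⟩ := exists_free_nhd (h := h) (isCompact_singleton (x := h z))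
      isConnected_singleton (by rintro w rfl h'; exact hh.2 _ h')
    obtain ⟨η₂, hη₂, h2⟩ := Metric.isOpen_iff.1 hYo _ (hY rfl)
    exact ⟨min η₁ η₂, lt_min hη₁ hη₂,
      fun w hw => h1 w (Metric.ball_subset_ball (min_le_left _ _) hw),
      hYf.mono ((Metric.ball_subset_ball (min_le_right _ _)).trans h2)⟩
  set V := Metric.ball (h z) η with hVdef
  have hVn : V ∈ 𝓝 (h z) := Metric.ball_mem_nhds _ hη
  set X := P ∪ V ∪ h '' N with hX
  have hXo : IsOpen X := (hPo.union Metric.isOpen_ball).union (h.isOpenMap _ hNo)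
  have hXb : Bornology.IsBounded X :=
    ((hCc.isBounded.subset hPC).union Metric.isBounded_ball).union
      (isBounded_image_homeo h (hCc.isBounded.subset hNC))
  have hXc : IsConnected X := by
    refine ⟨⟨h z, Or.inl (Or.inr (mem_of_mem_nhds hVn))⟩, ?_⟩
    have hVc : IsPreconnected V := (convex_ball _ _).isPreconnected
    obtain ⟨v, hv, hvP⟩ := mem_closure_iff_nhds.1 hhzP V hVn
    obtain ⟨u, hu, huN⟩ := mem_closure_iff_nhds.1 hzN (h ⁻¹' V)
      (h.continuous.continuousAt.preimage_mem_nhds hVn)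
    have hPV := hPconv.isPreconnected.union v hvP hv hVc
    exact hPV.union (h u) (Or.inr hu) ⟨u, huN, rfl⟩
      (hNconv.isPreconnected.image _ h.continuous.continuousOn)
  have hXf : Free h X := by
    rintro w ((hw | hw) | ⟨w, hw, rfl⟩) ((hw' | hw') | ⟨v, hv, he⟩)
    · have := hkey w (hPC hw) (hPC hw')
      rw [this] at hw
      exact lt_asymm hw.2 hzim
    · exact (hV _ hw').2.1 ⟨w, hPCp hw, rfl⟩
    · rw [h.injective he] at hv
      exact lt_asymm (show 0 < w.im from hw.2) (show w.im < 0 from hv.2)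
    · exact (hV w hw).2.2.1 (hPC hw')
    · exact hVfree w hw hw'
    · rw [h.injective he] at hv
      exact lt_asymm (hV w hw).1 (show w.im < 0 from hv.2)
    · exact hB2 w (hintC hw.1) (hintC hw'.1)
    · exact (hV _ hw').2.2.2 ⟨_, ⟨w, hNC hw, rfl⟩, rfl⟩
    · have h1 := h.injective he
      exact hBfree w (hintC hw.1) (h1 ▸ hintC hv.1)
  have hdis : ∀ n : ℕ, 1 ≤ n → ∀ z ∈ fill X, h^[n] z ∉ fill X := fun n hn z hz hz' =>
    disjoint_left.1 (hh.disjoint_fill_iterate hXo hXb hXc hXf hn) hz' ⟨z, hz, rfl⟩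
  have hUo := isOpen_fill hXo hXb
  have hpos : ∀ w ∈ Metric.ball (0 : ℂ) ρ, 0 < w.im → w ∈ fill X := fun w hw h0 =>
    subset_fill X (Or.inl (Or.inl ⟨hballint hw, h0⟩))
  have hneg : ∀ w ∈ Metric.ball (0 : ℂ) ρ, w.im < 0 → h w ∈ fill X := fun w hw h0 =>
    subset_fill X (Or.inr ⟨w, ⟨hballint hw, h0⟩, rfl⟩)
  refine ⟨fill X, hρ, hUo, isBounded_fill hXb, isConnected_fill hXo hXb hXc,
    hasLog_fill hXo hXb hXc, hdis, fun w hw => ⟨fun hwU => ?_, hpos w hw⟩,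
    fun w hw => ⟨fun hwU => ?_, hneg w hw⟩⟩
  · by_contra! hle
    rcases hle.lt_or_eq with h1 | h1
    · exact hdis 1 le_rfl w hwU (hneg w hw h1)
    · obtain ⟨v, ⟨hv1, hv2⟩, hv3⟩ := exists_im_neg_near h1
        (inter_mem (hUo.mem_nhds hwU) (Metric.isOpen_ball.mem_nhds hw))
      exact hdis 1 le_rfl v hv1 (hneg v hv2 hv3)
  · by_contra! hle
    rcases hle.lt_or_eq with h1 | h1
    · exact hdis 1 le_rfl w (hpos w hw h1) hwU
    · obtain ⟨v, ⟨hv1, hv2⟩, hv3⟩ := exists_im_pos_near h1.symm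
        (inter_mem (h.continuous.continuousAt.preimage_mem_nhds (hUo.mem_nhds hwU))
          (Metric.isOpen_ball.mem_nhds hw))
      exact hdis 1 le_rfl v (hpos v hv2 hv3) hv1

end BrouwerPlane

namespace BrouwerPlane

/-- The open real interval of radius `ρ` around the origin. -/
def realSeg (ρ : ℝ) : Set ℂ := {w | ‖w‖ < ρ ∧ w.im = 0}

theorem ofReal_mem_realSeg {t ρ : ℝ} (ht : |t| < ρ) : (t : ℂ) ∈ realSeg ρ :=
  ⟨by simpa using ht, Complex.ofReal_im t⟩

theorem realSeg_eq {w : ℂ} {ρ : ℝ} (hw : w ∈ realSeg ρ) : w = (w.re : ℂ) ∧ |w.re| < ρ :=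
  ⟨Complex.ext (by simp) (by simpa using hw.2), (Complex.abs_re_le_norm w).trans_lt hw.1⟩

theorem realSeg_mono {ρ R : ℝ} (h : ρ ≤ R) : realSeg ρ ⊆ realSeg R :=
  fun _ hw => ⟨hw.1.trans_le h, hw.2⟩

section

variable {h : ℂ ≃ₜ ℂ} {U : Set ℂ} {R : ℝ}

theorem IsHalfDomain.iterate_notMem (hU : IsHalfDomain h U R) {n : ℕ} (hn : 1 ≤ n) {z : ℂ}
    (hz : z ∈ U ∪ realSeg R) : h^[n] z ∉ U ∪ realSeg R := by
  have hcn : ContinuousAt h^[n] z := (h.continuous.iterate n).continuousAt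
  have hUU : ∀ w ∈ U, h^[n] w ∉ U := hU.disjoint n hn
  have hball : ∀ w ∈ realSeg R, Metric.ball (0 : ℂ) R ∈ 𝓝 w := fun w hw =>
    Metric.isOpen_ball.mem_nhds (by simpa using hw.1)
  have hSU : ∀ w ∈ realSeg R, h^[n] w ∉ U := fun w hw hw' => by
    obtain ⟨v, ⟨hv1, hv2⟩, hv3⟩ := exists_im_pos_near hw.2
      (inter_mem ((h.continuous.iterate n).continuousAt.preimage_mem_nhds (hU.isOpen.mem_nhds hw'))
        (hball w hw))
    exact hUU v ((hU.mem_iff v hv2).2 hv3) hv1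
  obtain ⟨g, hg⟩ := iterate_eq_pow h n
  have hUS : ∀ w ∈ U, h^[n] w ∉ realSeg R := fun w hw hw' => by
    rw [← hg] at hw'
    have h1 : g.symm ⁻¹' U ∩ Metric.ball 0 R ∈ 𝓝 (g w) :=
      inter_mem (g.symm.continuous.continuousAt.preimage_mem_nhds
        (hU.isOpen.mem_nhds (by simpa using hw))) (hball _ hw')
    obtain ⟨v, ⟨hv1, hv2⟩, hv3⟩ := exists_im_pos_near hw'.2 h1
    refine hUU _ hv1 ?_
    rw [← hg, g.apply_symm_apply]
    exact (hU.mem_iff v hv2).2 hv3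
  rcases hz with hz | hz
  · exact fun h' => h'.elim (hUU z hz) (hUS z hz)
  · rintro (h' | h')
    · exact hSU z hz h'
    · obtain ⟨v, ⟨hv1, hv2⟩, hv3⟩ := exists_im_pos_near hz.2
        (inter_mem (hcn.preimage_mem_nhds (hball _ h')) (hball z hz))
      have hvU := (hU.mem_iff v hv2).2 hv3
      rcases lt_trichotomy (h^[n] v).im 0 with h1 | h1 | h1
      · have := (hU.apply_mem_iff _ hv1).2 h1
        rw [← Function.iterate_succ_apply' h] at this
        exact hU.disjoint (n + 1) (by omega) v hvU this
      · exact hUS v hvU ⟨by simpa using hv1, h1⟩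
      · exact hUU v hvU ((hU.mem_iff _ hv1).2 h1)

theorem IsHalfDomain.flatPt (hU : IsHalfDomain h U R) {w : ℂ} (hw : w ∈ realSeg R) : FlatPt U w := by
  obtain ⟨he, hr⟩ := realSeg_eq hw
  have hk : IsFlatChart U (Homeomorph.refl ℂ) R := ⟨hU.pos, fun w hw => hU.mem_iff w hw⟩
  have := hk.flatPt_real hr
  rwa [Homeomorph.refl_apply, ← he] at this

theorem IsHalfDomain.flatPt_apply (hU : IsHalfDomain h U R) {w : ℂ} (hw : w ∈ realSeg R) :
    FlatPt U (h w) := by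
  obtain ⟨he, hr⟩ := realSeg_eq hw
  have hk : IsFlatChart U (Complex.conjCLE.toHomeomorph.trans h) R := ⟨hU.pos, fun w hw => by
    have := hU.apply_mem_iff ((starRingEnd ℂ) w) (by simpa using hw)
    simpa using this⟩
  have := hk.flatPt_real hr
  rw [he]
  simpa using this

end

theorem image_Ioo_of_injOn {f : ℝ → ℝ} {a b : ℝ} (hab : a < b) (hf : ContinuousOn f (Icc a b))
    (hi : InjOn f (Icc a b)) :
    ∃ l r, l < r ∧ f '' Ioo a b = Ioo l r ∧ (l = f a ∨ l = f b) ∧ (r = f a ∨ r = f b) := by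
  have ha : a ∈ Icc a b := left_mem_Icc.2 hab.le
  have hb : b ∈ Icc a b := right_mem_Icc.2 hab.le
  rcases hf.strictMonoOn_of_injOn_Icc' hab.le hi with hm | hm
  · refine ⟨f a, f b, hm ha hb hab, Subset.antisymm ?_ (intermediate_value_Ioo hab.le hf),
      Or.inl rfl, Or.inr rfl⟩
    rintro _ ⟨x, hx, rfl⟩
    exact ⟨hm ha (Ioo_subset_Icc_self hx) hx.1, hm (Ioo_subset_Icc_self hx) hb hx.2⟩
  · refine ⟨f b, f a, hm ha hb hab, Subset.antisymm ?_ (intermediate_value_Ioo' hab.le hf),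
      Or.inr rfl, Or.inl rfl⟩
    rintro _ ⟨x, hx, rfl⟩
    exact ⟨hm (Ioo_subset_Icc_self hx) hb hx.2, hm ha (Ioo_subset_Icc_self hx) hx.1⟩

section

open Complex

theorem im_cayley {m w : ℂ} (hm : ‖m‖ = 1) :
    (I * (m + w) / (m - w)).im = (1 - ‖w‖ ^ 2) / normSq (m - w) := by
  have h1 := Complex.sq_norm m
  rw [hm, normSq_apply] at h1
  rw [Complex.sq_norm, div_im, ← sub_div]
  congr 1
  simp [normSq_apply]
  linear_combination -h1

theorem im_moebius {l r : ℝ} (κ : ℂ) :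
    ((κ - l) / (r - κ)).im = (r - l) * κ.im / normSq (r - κ) := by
  rw [div_im, ← sub_div]
  congr 1
  simp
  ring

/-- The union of `U` with the two boundary intervals `realSeg ρ` and `h '' realSeg ρ`. -/
def stripSet (h : ℂ ≃ₜ ℂ) (U : Set ℂ) (ρ : ℝ) : Set ℂ := U ∪ (realSeg ρ ∪ h '' realSeg ρ)

/-- Coordinates identifying `stripSet h U ρ` with the strip `|Im| < π / 2` together with its lower
edge and part of its upper edge. -/
structure IsStripChart (h : ℂ ≃ₜ ℂ) (U : Set ℂ) (ρ : ℝ) (L : ℂ → ℂ) : Prop where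
  continuousOn : ContinuousOn L (stripSet h U ρ)
  sep : ∀ p ∈ stripSet h U ρ, ∀ N ∈ 𝓝 p, ∃ V ∈ 𝓝 (L p), ∀ q ∈ stripSet h U ρ, L q ∈ V → q ∈ N
  abs_im_lt : ∀ z ∈ U, |(L z).im| < Real.pi / 2
  im_lower : ∀ z ∈ realSeg ρ, (L z).im = -(Real.pi / 2)
  im_upper : ∀ z ∈ realSeg ρ, (L (h z)).im = Real.pi / 2
  exists_eq : ∀ w : ℂ, |w.im| < Real.pi / 2 → ∃ z ∈ U, L z = w
  exists_eq_lower : ∀ w : ℂ, w.im = -(Real.pi / 2) → ∃ z ∈ realSeg ρ, L z = w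

theorem im_div_pos_aux {l r : ℝ} (hlr : l < r) {ζ : ℂ} (hζ : 0 < ζ.im) :
    0 < ((r * ζ + l) / (1 + ζ)).im := by
  have hne : 1 + ζ ≠ 0 := fun h0 => by
    have := congrArg im h0
    simp at this
    exact hζ.ne' this
  rw [div_im, ← sub_div]
  refine div_pos ?_ (normSq_pos.2 hne)
  have : (r * ζ + l : ℂ).im * (1 + ζ).re - (r * ζ + l : ℂ).re * (1 + ζ).im = (r - l) * ζ.im := by
    simp
    ring
  rw [this]
  exact mul_pos (by linarith) hζ

theorem norm_inv_cayley_lt {m κ : ℂ} (hm : ‖m‖ = 1) (hκ : 0 < κ.im) :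
    ‖m * (κ - I) / (κ + I)‖ < 1 := by
  have hne : κ + I ≠ 0 := fun h0 => by
    have := congrArg im h0
    simp at this
    linarith
  rw [norm_div, norm_mul, hm, one_mul, div_lt_one (norm_pos_iff.2 hne)]
  refine lt_of_pow_lt_pow_left₀ 2 (norm_nonneg _) ?_
  rw [Complex.sq_norm, Complex.sq_norm, normSq_apply, normSq_apply]
  simp
  nlinarith

theorem cayley_inv_cayley {m κ : ℂ} (hm : m ≠ 0) (hκ : κ + I ≠ 0) :
    I * (m + m * (κ - I) / (κ + I)) / (m - m * (κ - I) / (κ + I)) = κ := by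
  have h1 : m + m * (κ - I) / (κ + I) = 2 * m * κ / (κ + I) := by
    field_simp
    ring
  have h2 : m - m * (κ - I) / (κ + I) = 2 * m * I / (κ + I) := by
    field_simp
    ring
  rw [h1, h2]
  have := I_ne_zero
  field_simp

theorem inv_cayley_cayley {m w : ℂ} (hm : m ≠ 0) (hw : m - w ≠ 0) :
    m * (I * (m + w) / (m - w) - I) / (I * (m + w) / (m - w) + I) = w := by
  have h1 : I * (m + w) / (m - w) - I = 2 * I * w / (m - w) := by
    field_simp
    ring
  have h2 : I * (m + w) / (m - w) + I = 2 * I * m / (m - w) := by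
    field_simp
    ring
  rw [h1, h2]
  have := I_ne_zero
  field_simp

theorem moebius_inv_moebius {l r : ℝ} (hlr : l < r) {ζ : ℂ} (hζ : 1 + ζ ≠ 0) :
    ((r * ζ + l) / (1 + ζ) - l) / (r - (r * ζ + l) / (1 + ζ)) = ζ := by
  have hrl : (r : ℂ) - l ≠ 0 := by
    rw [← ofReal_sub]; exact_mod_cast (sub_pos.2 hlr).ne'
  have h1 : (r * ζ + l) / (1 + ζ) - l = (r - l) * ζ / (1 + ζ) := by
    field_simp
    ring
  have h2 : r - (r * ζ + l) / (1 + ζ) = (r - l) / (1 + ζ) := by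
    field_simp
    ring
  rw [h1, h2]
  field_simp

theorem inv_moebius_moebius {l r : ℝ} (hlr : l < r) {κ : ℂ} (hκ : (r : ℂ) - κ ≠ 0) :
    1 + (κ - l) / (r - κ) ≠ 0 ∧
      (r * ((κ - l) / (r - κ)) + l) / (1 + (κ - l) / (r - κ)) = κ := by
  have hrl : (r : ℂ) - l ≠ 0 := by
    rw [← ofReal_sub]; exact_mod_cast (sub_pos.2 hlr).ne'
  have h1 : 1 + (κ - l) / (r - κ) = (r - l) / (r - κ) := by
    field_simp
    ring
  have h2 : r * ((κ - l) / (r - κ)) + l = (r - l) * κ / (r - κ) := by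
    field_simp
    ring
  refine ⟨by rw [h1]; exact div_ne_zero hrl hκ, ?_⟩
  rw [h1, h2]
  field_simp

theorem IsHalfDomain.exists_isStripChart {h : ℂ ≃ₜ ℂ} {U : Set ℂ} {R ρ : ℝ}
    (hU : IsHalfDomain h U R) (hρ : 0 < ρ) (hρR : ρ < R) : ∃ L, IsStripChart h U ρ L := by
  obtain ⟨Φ, hΦ⟩ := exists_isDiscChart hU.isOpen hU.isBounded hU.isConnected hU.hasLog
  set T := U ∪ {p | FlatPt U p} with hT
  set t₁ : ℝ := (ρ + R) / 2 with ht₁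
  have hst : realSeg ρ ⊆ realSeg R := realSeg_mono hρR.le
  have ht₁S : (t₁ : ℂ) ∈ realSeg R := ofReal_mem_realSeg (by
    rw [abs_of_pos (by rw [ht₁]; linarith)]; rw [ht₁]; linarith)
  have hflat : ∀ w ∈ realSeg R, w ∈ T := fun w hw => Or.inr (hU.flatPt hw)
  have hnotS : ∀ w ∈ realSeg R, h w ∉ realSeg R := fun w hw hw' =>
    hU.iterate_notMem le_rfl (Or.inr hw) (Or.inr hw')
  set m := Φ t₁ with hm
  have hm1 : ‖m‖ = 1 := hΦ.norm_eq _ (hU.flatPt ht₁S)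
  have hm0 : m ≠ 0 := norm_ne_zero_iff.1 (by rw [hm1]; exact one_ne_zero)
  let κ : ℂ → ℂ := fun z => I * (m + Φ z) / (m - Φ z)
  set T' := T \ {(t₁ : ℂ)} with hT'
  have hden : ∀ z ∈ T', m - Φ z ≠ 0 := fun z hz h0 =>
    hz.2 (hΦ.injOn hz.1 (hflat _ ht₁S) (sub_eq_zero.1 h0).symm)
  have hκc : ContinuousOn κ T' := by
    have := hΦ.continuousOn.mono (show T' ⊆ T from sdiff_subset)
    exact ContinuousOn.div (by fun_prop) (by fun_prop) hden
  have hκΦ : ∀ z ∈ T', m * (κ z - I) / (κ z + I) = Φ z := fun z hz =>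
    inv_cayley_cayley hm0 (hden z hz)
  have hκinj : InjOn κ T' := fun z hz w hw he =>
    hΦ.injOn hz.1 hw.1 (by rw [← hκΦ z hz, ← hκΦ w hw, he])
  have hκU : ∀ z ∈ U, z ∈ T' ∧ 0 < (κ z).im := fun z hz => by
    have hzT : z ∈ T' := ⟨Or.inl hz, fun he => (hU.flatPt ht₁S).notMem (by
      rw [mem_singleton_iff] at he; rwa [he] at hz)⟩
    refine ⟨hzT, ?_⟩
    rw [im_cayley hm1]
    refine div_pos ?_ (normSq_pos.2 (hden z hzT))
    have := hΦ.norm_lt z hz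
    nlinarith [norm_nonneg (Φ z)]
  have hκF : ∀ z, FlatPt U z → (κ z).im = 0 := fun z hz => by
    rw [im_cayley hm1, hΦ.norm_eq z hz]
    simp
  have hκI : ∀ z ∈ T, 0 ≤ (κ z).im := by
    rintro z (hz | hz)
    · exact (hκU z hz).2.le
    · exact (hκF z hz).ge
  have hκre : ∀ z, FlatPt U z → κ z = ((κ z).re : ℂ) := fun z hz =>
    Complex.ext (by simp) (by simpa using hκF z hz)
  have hIcc : ∀ t ∈ Icc (-ρ) ρ, (t : ℂ) ∈ T' := fun t ht => by
    refine ⟨hflat _ (ofReal_mem_realSeg ((abs_le.2 ht).trans_lt hρR)), fun he => ?_⟩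
    have h1 : t = t₁ := by
      rw [mem_singleton_iff] at he
      exact_mod_cast he
    have := ht.2
    rw [h1, ht₁] at this
    linarith
  have hfr : ∀ t ∈ Icc (-ρ) ρ, FlatPt U (t : ℂ) := fun t ht =>
    hU.flatPt (ofReal_mem_realSeg ((abs_le.2 ht).trans_lt hρR))
  obtain ⟨l, r, hlr, himg, hl, hr⟩ := image_Ioo_of_injOn (f := fun t : ℝ => (κ t).re)
    (show -ρ < ρ by linarith)
    (continuous_re.comp_continuousOn (hκc.comp continuous_ofReal.continuousOn hIcc))
    (fun s hs t ht he => by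
      have : κ s = κ t := by
        rw [hκre _ (hfr s hs), hκre _ (hfr t ht)]
        exact congrArg _ he
      exact_mod_cast hκinj (hIcc s hs) (hIcc t ht) this)
  have hend : ∀ x : ℝ, (x = (κ ((-ρ : ℝ) : ℂ)).re ∨ x = (κ ((ρ : ℝ) : ℂ)).re) →
      ∃ t : ℝ, |t| = ρ ∧ κ t = x := by
    have h1 : -ρ ∈ Icc (-ρ) ρ := ⟨le_rfl, by linarith⟩
    have h2 : ρ ∈ Icc (-ρ) ρ := ⟨by linarith, le_rfl⟩
    rintro x (rfl | rfl)
    · exact ⟨-ρ, by rw [abs_neg, abs_of_pos hρ], hκre _ (hfr _ h1)⟩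
    · exact ⟨ρ, abs_of_pos hρ, hκre _ (hfr _ h2)⟩
  set E := stripSet h U ρ with hE
  have hET : E ⊆ T' := by
    rintro z (hz | hz | ⟨w, hw, rfl⟩)
    · exact (hκU z hz).1
    · obtain ⟨he, hr⟩ := realSeg_eq hz
      rw [he]
      exact hIcc _ (abs_le.1 hr.le)
    · refine ⟨Or.inr (hU.flatPt_apply (hst hw)), fun he => hnotS w (hst hw) ?_⟩
      rw [mem_singleton_iff] at he
      rw [he]
      exact ht₁S
  have hEne : ∀ z ∈ E, ∀ t : ℝ, |t| = ρ → z ≠ t := by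
    rintro z (hz | hz | ⟨w, hw, rfl⟩) t ht he
    · refine (hfr t (abs_le.1 ht.le)).notMem (he ▸ hz)
    · obtain ⟨h1, h2⟩ := realSeg_eq hz
      rw [he, ofReal_re, ht] at h2
      exact lt_irrefl _ h2
    · refine hnotS w (hst hw) ?_
      rw [he]
      exact ofReal_mem_realSeg (ht.trans_lt hρR)
  have hκne : ∀ z ∈ E, ∀ x : ℝ, (x = (κ ((-ρ : ℝ) : ℂ)).re ∨ x = (κ ((ρ : ℝ) : ℂ)).re) →
      κ z ≠ x := by
    intro z hz x hx he
    obtain ⟨t, ht, htx⟩ := hend x hx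
    exact hEne z hz t ht (hκinj (hET hz) (hIcc t (abs_le.1 ht.le)) (he.trans htx.symm))
  have hrden : ∀ z ∈ E, (r : ℂ) - κ z ≠ 0 := fun z hz h0 => hκne z hz r hr (sub_eq_zero.1 h0).symm
  have hlnum : ∀ z ∈ E, κ z - l ≠ 0 := fun z hz h0 => hκne z hz l hl (sub_eq_zero.1 h0)
  let ζ : ℂ → ℂ := fun z => (κ z - l) / (r - κ z)
  have hζ0 : ∀ z ∈ E, ζ z ≠ 0 := fun z hz => div_ne_zero (hlnum z hz) (hrden z hz)
  have hζc : ContinuousOn ζ E := by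
    have := hκc.mono hET
    exact ContinuousOn.div (by fun_prop) (by fun_prop) hrden
  have hζU : ∀ z ∈ U, 0 < (ζ z).im := fun z hz => by
    rw [im_moebius]
    exact div_pos (mul_pos (by linarith) (hκU z hz).2) (normSq_pos.2 (hrden z (Or.inl hz)))
  have hζF : ∀ x : ℝ, ((x : ℂ) - l) / (r - x) = (((x - l) / (r - x) : ℝ) : ℂ) := fun x => by
    push_cast; rfl
  have hζS : ∀ z ∈ realSeg ρ, ∃ x : ℝ, 0 < x ∧ ζ z = x := fun z hz => by
    obtain ⟨he, hr⟩ := realSeg_eq hz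
    have hmem : (κ z).re ∈ Ioo l r := by
      rw [← himg, he]
      exact ⟨z.re, abs_lt.1 hr, rfl⟩
    refine ⟨((κ z).re - l) / (r - (κ z).re), div_pos (by linarith [hmem.1]) (by linarith [hmem.2]), ?_⟩
    rw [← hζF, ← hκre z (hU.flatPt (hst hz))]
  have hζh : ∀ z ∈ realSeg ρ, ∃ x : ℝ, 0 < x ∧ ζ (h z) = -x := fun z hz => by
    have hzE : h z ∈ E := Or.inr (Or.inr ⟨z, hz, rfl⟩)
    have hF := hU.flatPt_apply (hst hz)
    have hk := hκre _ hF
    have hout : (κ (h z)).re < l ∨ r < (κ (h z)).re := by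
      by_contra! hc
      have h1 : (κ (h z)).re ∈ Ioo l r := by
        refine ⟨lt_of_le_of_ne hc.1 fun he => hκne _ hzE l hl ?_,
          lt_of_le_of_ne hc.2 fun he => hκne _ hzE r hr ?_⟩
        · rw [hk, he]
        · rw [hk, he]
      rw [← himg] at h1
      obtain ⟨t, ht, hte⟩ := h1
      have htI := Ioo_subset_Icc_self ht
      have : h z = t := hκinj (hET hzE) (hIcc t htI) (by
        rw [hk, hκre _ (hfr t htI)]
        exact congrArg _ hte.symm)
      refine hnotS z (hst hz) ?_
      rw [this]
      exact ofReal_mem_realSeg ((abs_lt.2 ht).trans hρR)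
    refine ⟨-(((κ (h z)).re - l) / (r - (κ (h z)).re)), ?_, ?_⟩
    · rw [neg_pos]
      rcases hout with h1 | h1
      · exact div_neg_of_neg_of_pos (by linarith) (by linarith)
      · exact div_neg_of_pos_of_neg (by linarith) (by linarith)
    · rw [ofReal_neg, neg_neg, ← hζF, ← hk]
  let L : ℂ → ℂ := fun z => Complex.log (-(I * ζ z))
  have hexp : ∀ z ∈ E, I * Complex.exp (L z) = ζ z := fun z hz => by
    rw [Complex.exp_log (neg_ne_zero.2 (mul_ne_zero I_ne_zero (hζ0 z hz)))]
    linear_combination (-ζ z) * I_mul_I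
  have hLc : ContinuousOn L E := by
    refine ContinuousOn.clog (by fun_prop) ?_
    rintro z (hz | hz | ⟨z, hz, rfl⟩)
    · left
      simpa using hζU z hz
    · obtain ⟨x, hx, he⟩ := hζS z hz
      right
      simpa [he] using hx.ne'
    · obtain ⟨x, hx, he⟩ := hζh z hz
      right
      simpa [he] using hx.ne'
  let G : ℂ → ℂ := fun w =>
    m * ((r * (I * exp w) + l) / (1 + I * exp w) - I) / ((r * (I * exp w) + l) / (1 + I * exp w) + I)
  have hκL : ∀ z ∈ E, 1 + I * exp (L z) ≠ 0 ∧
      (r * (I * exp (L z)) + l) / (1 + I * exp (L z)) = κ z := fun z hz => by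
    rw [hexp z hz]
    exact inv_moebius_moebius hlr (hrden z hz)
  have hGL : ∀ z ∈ E, G (L z) = Φ z := fun z hz => by
    simp only [G, (hκL z hz).2]
    exact hκΦ z (hET hz)
  have hGc : ∀ z ∈ E, ContinuousAt G (L z) := fun z hz => by
    have h1 := (hκL z hz).1
    have hq : ContinuousAt (fun w => (r * (I * exp w) + l) / (1 + I * exp w)) (L z) :=
      ContinuousAt.div (by fun_prop) (by fun_prop) h1
    refine ContinuousAt.div (by fun_prop) (by fun_prop) ?_
    rw [(hκL z hz).2]
    intro h0
    have h2 := congrArg im h0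
    have h3 := hκI z (hET hz).1
    simp at h2
    linarith
  refine ⟨L, hLc, fun p hp N hN => ?_, fun z hz => ?_, fun z hz => ?_, fun z hz => ?_,
    fun w hw => ?_, fun w hw => ?_⟩
  · obtain ⟨δ, hδ, hs⟩ := hΦ.sep p (hET hp).1 N hN
    refine ⟨G ⁻¹' Metric.ball (Φ p) δ, (hGc p hp).preimage_mem_nhds ?_, fun q hq hqV => ?_⟩
    · rw [hGL p hp]
      exact Metric.ball_mem_nhds _ hδ
    · rw [mem_preimage, hGL q hq] at hqV
      exact hs q (hET hq).1 hqV
  · rw [log_im, abs_arg_lt_pi_div_two_iff]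
    left
    simpa using hζU z hz
  · obtain ⟨x, hx, he⟩ := hζS z hz
    rw [log_im, arg_eq_neg_pi_div_two_iff, he]
    simpa using hx
  · obtain ⟨x, hx, he⟩ := hζh z hz
    rw [log_im, arg_eq_pi_div_two_iff, he]
    simpa using hx
  · have hre : 0 < (I * exp w).im := by
      have := Real.cos_pos_of_mem_Ioo (abs_lt.1 hw)
      simp [exp_re]
      positivity
    have hκ := im_div_pos_aux hlr hre
    obtain ⟨z, hz, he⟩ := hΦ.exists_eq _ (norm_inv_cayley_lt hm1 hκ)
    refine ⟨z, hz, ?_⟩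
    have hne : 1 + I * exp w ≠ 0 := fun h0 => by
      have := congrArg im h0
      rw [add_im, one_im, zero_add, zero_im] at this
      exact hre.ne' this
    have hk : κ z = (r * (I * exp w) + l) / (1 + I * exp w) := by
      simp only [κ, he]
      refine cayley_inv_cayley hm0 fun h0 => ?_
      have := congrArg im h0
      rw [add_im, I_im, zero_im] at this
      linarith
    have hz' : ζ z = I * exp w := by
      simp only [ζ, hk]
      exact moebius_inv_moebius hlr hne
    have hpi := Real.pi_pos
    simp only [L, hz', ← mul_assoc, I_mul_I, neg_one_mul, neg_neg]
    rw [abs_lt] at hw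
    exact log_exp (by linarith) (by linarith)
  · have hx := Real.exp_pos w.re
    set x := Real.exp w.re with hxd
    have hmem : (r * x + l) / (1 + x) ∈ Ioo l r := by
      constructor
      · rw [lt_div_iff₀ (by linarith)]; nlinarith
      · rw [div_lt_iff₀ (by linarith)]; nlinarith
    rw [← himg] at hmem
    obtain ⟨t, ht, hte⟩ := hmem
    refine ⟨t, ofReal_mem_realSeg (abs_lt.2 ht), ?_⟩
    have hk : κ t = (r * x + l) / (1 + x) := by
      rw [hκre _ (hfr t (Ioo_subset_Icc_self ht))]
      simp only [] at hte
      rw [hte]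
      push_cast
      rfl
    have hz' : ζ t = x := by
      simp only [ζ, hk]
      refine moebius_inv_moebius hlr ?_
      rw [← ofReal_one, ← ofReal_add]
      exact_mod_cast (by linarith : (0 : ℝ) < 1 + x).ne'
    have hw2 : -(I * (x : ℂ)) = exp w := by
      have hwe : w = (w.re : ℂ) + (-(Real.pi / 2) : ℝ) * I := by
        rw [← hw, re_add_im]
      have h2 : exp ((-(Real.pi / 2) : ℝ) * I) = -I := by
        rw [exp_mul_I, ← ofReal_cos, ← ofReal_sin]
        simp
      rw [hwe, exp_add, h2, hxd, ofReal_exp]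
      ring
    have hpi := Real.pi_pos
    simp only [L, hz', hw2]
    exact log_exp (by linarith) (by linarith)

end

end BrouwerPlane

namespace BrouwerPlane
open Complex

/-- A parametrization `E` of a strip set by `[0, 1] × ℝ`, with inverse `C`, in which `h` maps the
left side to the right side by `(0, y) ↦ (1, ε * y)`. -/
structure IsStrip (h : ℂ ≃ₜ ℂ) (U : Set ℂ) (ρ ε : ℝ) (E : ℝ × ℝ → ℂ) (C : ℂ → ℝ × ℝ) : Prop where
  continuousOn : ContinuousOn E {p | p.1 ∈ Icc (0 : ℝ) 1}
  continuousOn_symm : ContinuousOn C (stripSet h U ρ)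
  mem : ∀ p : ℝ × ℝ, p.1 ∈ Ioo (0 : ℝ) 1 → E p ∈ U
  mem_realSeg : ∀ y : ℝ, E (0, y) ∈ realSeg ρ
  apply_eq : ∀ y : ℝ, E (1, ε * y) = h (E (0, y))
  left_inv : ∀ p : ℝ × ℝ, p.1 ∈ Icc (0 : ℝ) 1 → C (E p) = p
  right_inv : ∀ z ∈ stripSet h U ρ, E (C z) = z
  fst_mem : ∀ z ∈ U, (C z).1 ∈ Ioo (0 : ℝ) 1
  fst_eq : ∀ z ∈ realSeg ρ, (C z).1 = 0

theorem strictMono_mix {τ : ℝ → ℝ} (hτ : StrictMono τ) {s : ℝ} (hs : s ∈ Icc (0 : ℝ) 1) :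
    StrictMono fun y => (1 - s) * y + s * τ y := by
  intro a b hab
  have h1 := hτ hab
  rcases eq_or_lt_of_le hs.1 with h0 | h0
  · simp only [← h0]; linarith
  · have := mul_lt_mul_of_pos_left h1 h0
    have := mul_le_mul_of_nonneg_left hab.le (sub_nonneg.2 hs.2)
    simp only
    linarith

theorem exists_mix_eq {τ : ℝ → ℝ} (hτ : StrictMono τ) (hτc : Continuous τ) {s : ℝ} (h0 : 0 ≤ s)
    (h1 : s < 1) (v : ℝ) : ∃ y, (1 - s) * y + s * τ y = v := by
  have hc : Continuous fun y => (1 - s) * y + s * τ y := by fun_prop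
  refine hc.surjective ?_ ?_ v
  · refine tendsto_atTop_mono' _ (f₁ := fun y => (1 - s) * y + s * τ 0) ?_ ?_
    · filter_upwards [eventually_ge_atTop (0 : ℝ)] with y hy
      have := mul_le_mul_of_nonneg_left (hτ.monotone hy) h0
      linarith
    · exact tendsto_atTop_add_const_right _ _ (tendsto_id.const_mul_atTop (sub_pos.2 h1))
  · refine tendsto_atBot_mono' _ (f₁ := fun y => (1 - s) * y + s * τ 0) ?_ ?_
    · filter_upwards [eventually_le_atBot (0 : ℝ)] with y hy
      have := mul_le_mul_of_nonneg_left (hτ.monotone hy) h0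
      linarith
    · exact tendsto_atBot_add_const_right _ _ (tendsto_id.const_mul_atBot (sub_pos.2 h1))

theorem tendsto_of_mix {α : Type*} {l : Filter α} {τ : ℝ → ℝ} (hτ : StrictMono τ)
    {f : α → ℝ × ℝ} {p : ℝ × ℝ} (hf : ∀ᶠ a in l, (f a).1 ∈ Icc (0 : ℝ) 1)
    (hp : p.1 ∈ Icc (0 : ℝ) 1) (h1 : Tendsto (fun a => (f a).1) l (𝓝 p.1))
    (h2 : Tendsto (fun a => (1 - (f a).1) * (f a).2 + (f a).1 * τ (f a).2) l
      (𝓝 ((1 - p.1) * p.2 + p.1 * τ p.2))) : Tendsto f l (𝓝 p) := by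
  refine Tendsto.prodMk_nhds h1 ?_
  rw [tendsto_order]
  have key : ∀ c : ℝ, Tendsto (fun a => (1 - (f a).1) * c + (f a).1 * τ c) l
      (𝓝 ((1 - p.1) * c + p.1 * τ c)) := fun c =>
    ((tendsto_const_nhds.sub h1).mul_const c).add (h1.mul_const _)
  constructor
  · intro c hc
    filter_upwards [hf, (key c).eventually_lt h2 (strictMono_mix hτ hp hc)] with a ha hlt
    exact (strictMono_mix hτ ha).lt_iff_lt.1 hlt
  · intro c hc
    filter_upwards [hf, h2.eventually_lt (key c) (strictMono_mix hτ hp hc)] with a ha hlt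
    exact (strictMono_mix hτ ha).lt_iff_lt.1 hlt

theorem IsStripChart.injOn {h : ℂ ≃ₜ ℂ} {U : Set ℂ} {ρ : ℝ} {L : ℂ → ℂ}
    (hL : IsStripChart h U ρ L) : InjOn L (stripSet h U ρ) := by
  intro p hp q hq he
  by_contra hne
  obtain ⟨V, hV, hs⟩ := hL.sep p hp {q}ᶜ (isOpen_compl_singleton.mem_nhds hne)
  exact hs q hq (by rw [← he]; exact mem_of_mem_nhds hV) rfl

theorem IsStripChart.tendsto {α : Type*} {l : Filter α} {h : ℂ ≃ₜ ℂ} {U : Set ℂ} {ρ : ℝ} {L : ℂ → ℂ}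
    (hL : IsStripChart h U ρ L) {f : α → ℂ} {p : ℂ} (hp : p ∈ stripSet h U ρ)
    (hf : ∀ᶠ a in l, f a ∈ stripSet h U ρ) (ht : Tendsto (fun a => L (f a)) l (𝓝 (L p))) :
    Tendsto f l (𝓝 p) := by
  intro N hN
  obtain ⟨V, hV, hs⟩ := hL.sep p hp N hN
  have h1 : ∀ᶠ a in l, L (f a) ∈ V := ht hV
  refine mem_map.2 ?_
  filter_upwards [hf, h1] with a ha hav
  exact hs _ ha hav

theorem IsStripChart.exists_isStrip {h : ℂ ≃ₜ ℂ} {U : Set ℂ} {ρ : ℝ} {L : ℂ → ℂ}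
    (hL : IsStripChart h U ρ L) :
    ∃ (ε : ℝ) (E : ℝ × ℝ → ℂ) (C : ℂ → ℝ × ℝ), (ε = 1 ∨ ε = -1) ∧ IsStrip h U ρ ε E C := by
  have hπ := Real.pi_pos
  have hlow : ∀ y : ℝ, ∃ z ∈ realSeg ρ, L z = ⟨y, -(Real.pi / 2)⟩ := fun y =>
    hL.exists_eq_lower _ rfl
  choose a ha haL using hlow
  have haT : ∀ y, a y ∈ stripSet h U ρ := fun y => Or.inr (Or.inl (ha y))
  have hhT : ∀ y, h (a y) ∈ stripSet h U ρ := fun y => Or.inr (Or.inr ⟨_, ha y, rfl⟩)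
  have hac : Continuous a := continuous_iff_continuousAt.2 fun y => by
    refine hL.tendsto (haT y) (Eventually.of_forall haT) ?_
    simp_rw [haL]
    have : Continuous fun y : ℝ => (⟨y, -(Real.pi / 2)⟩ : ℂ) :=
      Complex.equivRealProdCLM.symm.continuous.comp (by fun_prop : Continuous fun y : ℝ =>
        ((y, -(Real.pi / 2)) : ℝ × ℝ))
    exact this.tendsto y
  set σ : ℝ → ℝ := fun y => (L (h (a y))).re with hσ
  have hσc : Continuous σ := Complex.continuous_re.comp
    (hL.continuousOn.comp_continuous (h.continuous.comp hac) hhT)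
  have hσL : ∀ y, L (h (a y)) = ⟨σ y, Real.pi / 2⟩ := fun y =>
    Complex.ext rfl (hL.im_upper _ (ha y))
  have hσi : Function.Injective σ := fun y y' he => by
    have h1 : L (h (a y)) = L (h (a y')) := by rw [hσL, hσL, he]
    have h2 := h.injective (hL.injOn (hhT y) (hhT y') h1)
    have h3 := haL y
    rw [h2, haL] at h3
    exact (congrArg Complex.re h3).symm
  obtain ⟨ε, hε, hτ⟩ : ∃ ε : ℝ, (ε = 1 ∨ ε = -1) ∧ StrictMono fun y => σ (ε * y) := by
    rcases hσc.strictMono_of_inj hσi with h1 | h1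
    · exact ⟨1, Or.inl rfl, by simpa using h1⟩
    · exact ⟨-1, Or.inr rfl, fun x y hxy => h1 (by linarith)⟩
  have hεε : ε * ε = 1 := by rcases hε with rfl | rfl <;> norm_num
  set τ : ℝ → ℝ := fun y => σ (ε * y) with hτd
  have hτc : Continuous τ := hσc.comp (by fun_prop)
  let F : ℝ × ℝ → ℂ := fun p => ⟨(1 - p.1) * p.2 + p.1 * τ p.2, Real.pi * (p.1 - 1 / 2)⟩
  have hFc : Continuous F :=
    Complex.equivRealProdCLM.symm.continuous.comp (by fun_prop : Continuous fun p : ℝ × ℝ =>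
        (((1 - p.1) * p.2 + p.1 * τ p.2, Real.pi * (p.1 - 1 / 2)) : ℝ × ℝ))
  have hFi : ∀ p q : ℝ × ℝ, p.1 ∈ Icc (0 : ℝ) 1 → F p = F q → p = q := fun p q hp he => by
    have h1 : Real.pi * (p.1 - 1 / 2) = Real.pi * (q.1 - 1 / 2) := congrArg Complex.im he
    have h2 : p.1 = q.1 := by
      have := mul_left_cancel₀ hπ.ne' h1
      linarith
    have h3 : (1 - p.1) * p.2 + p.1 * τ p.2 = (1 - q.1) * q.2 + q.1 * τ q.2 :=
      congrArg Complex.re he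
    rw [← h2] at h3
    exact Prod.ext h2 ((strictMono_mix hτ hp).injective h3)
  have hF0 : ∀ y, F (0, y) = L (a y) := fun y => by
    rw [haL]
    exact Complex.ext (by simp [F]) (by simp [F]; ring)
  have hF1 : ∀ y, F (1, ε * y) = L (h (a y)) := fun y => by
    rw [hσL]
    refine Complex.ext ?_ (by simp [F]; ring)
    simp only [F, hτd, ← mul_assoc, hεε]
    simp
  have hFmid : ∀ p : ℝ × ℝ, p.1 ∈ Ioo (0 : ℝ) 1 → |(F p).im| < Real.pi / 2 := fun p hp => by
    simp only [F]
    rw [abs_lt]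
    constructor <;> nlinarith [hp.1, hp.2]
  have hE : ∀ p : ℝ × ℝ, ∃ z, p.1 ∈ Icc (0 : ℝ) 1 → z ∈ stripSet h U ρ ∧ L z = F p := fun p => by
    by_cases hp : p.1 ∈ Icc (0 : ℝ) 1
    · rcases eq_or_lt_of_le hp.1 with h0 | h0
      · exact ⟨a p.2, fun _ => ⟨haT _, by rw [← hF0, h0]⟩⟩
      rcases eq_or_lt_of_le hp.2 with h1 | h1
      · refine ⟨h (a (ε * p.2)), fun _ => ⟨hhT _, ?_⟩⟩
        rw [← hF1, ← mul_assoc, hεε, one_mul, ← h1]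
      · obtain ⟨z, hz, he⟩ := hL.exists_eq _ (hFmid p ⟨h0, h1⟩)
        exact ⟨z, fun _ => ⟨Or.inl hz, he⟩⟩
    · exact ⟨0, fun h => absurd h hp⟩
  choose E hE using hE
  have hlowmem : ∀ z ∈ realSeg ρ, ∃ y, a y = z := fun z hz => by
    refine ⟨(L z).re, hL.injOn (haT _) (Or.inr (Or.inl hz)) ?_⟩
    rw [haL]
    exact Complex.ext rfl (hL.im_lower z hz).symm
  have hC : ∀ z : ℂ, ∃ p : ℝ × ℝ, z ∈ stripSet h U ρ → p.1 ∈ Icc (0 : ℝ) 1 ∧ F p = L z := by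
    intro z
    by_cases hz : z ∈ stripSet h U ρ
    · rcases hz with hz | hz | ⟨w, hw, rfl⟩
      · have him := abs_lt.1 (hL.abs_im_lt z hz)
        have h1 : (L z).im / Real.pi + 1 / 2 < 1 := by
          have : (L z).im / Real.pi < 1 / 2 := by rw [div_lt_iff₀ hπ]; linarith
          linarith
        have h0 : 0 < (L z).im / Real.pi + 1 / 2 := by
          have : -(1 / 2) < (L z).im / Real.pi := by rw [lt_div_iff₀ hπ]; linarith
          linarith
        obtain ⟨y, hy⟩ := exists_mix_eq hτ hτc h0.le h1 (L z).re
        refine ⟨(_, y), fun _ => ⟨⟨h0.le, h1.le⟩, Complex.ext hy ?_⟩⟩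
        simp only [F]
        field_simp
        ring
      · obtain ⟨y, rfl⟩ := hlowmem z hz
        exact ⟨(0, y), fun _ => ⟨⟨le_rfl, zero_le_one⟩, hF0 y⟩⟩
      · obtain ⟨y, rfl⟩ := hlowmem w hw
        exact ⟨(1, ε * y), fun _ => ⟨⟨zero_le_one, le_rfl⟩, hF1 y⟩⟩
    · exact ⟨0, fun h => absurd h hz⟩
  choose C hC using hC
  have h0I : (0 : ℝ) ∈ Icc (0 : ℝ) 1 := ⟨le_rfl, zero_le_one⟩
  have h1I : (1 : ℝ) ∈ Icc (0 : ℝ) 1 := ⟨zero_le_one, le_rfl⟩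
  have hEa : ∀ y, E (0, y) = a y := fun y =>
    hL.injOn (hE _ h0I).1 (haT y) ((hE (0, y) h0I).2.trans (hF0 y))
  have hEha : ∀ y, E (1, ε * y) = h (a y) := fun y =>
    hL.injOn (hE _ h1I).1 (hhT y) ((hE (1, ε * y) h1I).2.trans (hF1 y))
  have hFim : ∀ p : ℝ × ℝ, (F p).im = Real.pi * (p.1 - 1 / 2) := fun p => rfl
  have hCim : ∀ z ∈ stripSet h U ρ, (C z).1 = (L z).im / Real.pi + 1 / 2 := fun z hz => by
    rw [← (hC z hz).2, hFim]
    field_simp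
    ring
  refine ⟨ε, E, C, hε, ?_, ?_, ?_, ?_, ?_, ?_, ?_, ?_, ?_⟩
  · intro p hp
    refine hL.tendsto (hE p hp).1 ?_ ?_
    · filter_upwards [self_mem_nhdsWithin] with q hq using (hE q hq).1
    · rw [(hE p hp).2]
      refine (hFc.continuousWithinAt (s := {p | p.1 ∈ Icc (0 : ℝ) 1}) (x := p)).tendsto.congr' ?_
      filter_upwards [self_mem_nhdsWithin] with q hq using (hE q hq).2.symm
  · intro z hz
    have hLt : Tendsto (fun w => F (C w)) (𝓝[stripSet h U ρ] z) (𝓝 (F (C z))) := by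
      rw [(hC z hz).2]
      refine (hL.continuousOn z hz).tendsto.congr' ?_
      filter_upwards [self_mem_nhdsWithin] with q hq using (hC q hq).2.symm
    refine tendsto_of_mix hτ ?_ (hC z hz).1 ?_ ?_
    · filter_upwards [self_mem_nhdsWithin] with q hq using (hC q hq).1
    · have := (((Complex.continuous_im.tendsto _).comp hLt).div_const Real.pi).add_const (1 / 2 : ℝ)
      have hs : ∀ p : ℝ × ℝ, (F p).im / Real.pi + 1 / 2 = p.1 := fun p => by
        rw [hFim]; field_simp; ring
      simpa only [Function.comp_def, hs] using this
    · exact (Complex.continuous_re.tendsto _).comp hLt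
  · intro p hp
    obtain ⟨z, hz, he⟩ := hL.exists_eq _ (hFmid p hp)
    have h1 := hE p ⟨hp.1.le, hp.2.le⟩
    rwa [hL.injOn h1.1 (Or.inl hz) (h1.2.trans he.symm)]
  · intro y
    rw [hEa]; exact ha y
  · intro y
    rw [hEha, hEa]
  · intro p hp
    have h1 := hE p hp
    have h2 := hC _ h1.1
    exact hFi _ _ h2.1 (h2.2.trans h1.2)
  · intro z hz
    have h2 := hC z hz
    have h1 := hE _ h2.1
    exact hL.injOn h1.1 hz (h1.2.trans h2.2)
  · intro z hz
    have him := abs_lt.1 (hL.abs_im_lt z hz)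
    rw [hCim z (Or.inl hz)]
    have h1 : (L z).im / Real.pi < 1 / 2 := by rw [div_lt_iff₀ hπ]; linarith
    have h0 : -(1 / 2) < (L z).im / Real.pi := by rw [lt_div_iff₀ hπ]; linarith
    exact ⟨by linarith, by linarith⟩
  · intro z hz
    rw [hCim z (Or.inr (Or.inl hz)), hL.im_lower z hz]
    field_simp
    ring

end BrouwerPlane

namespace BrouwerPlane

/-- The affine homeomorphism `(s, y) ↦ (s + 1, ε * y)` of `ℝ × ℝ`. -/
noncomputable def shiftFlip (ε : ℝ) (hε : ε ≠ 0) : ℝ × ℝ ≃ₜ ℝ × ℝ :=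
  (Homeomorph.addRight (1 : ℝ)).prodCongr (Homeomorph.mulLeft₀ ε hε)

theorem shiftFlip_apply (ε : ℝ) (hε : ε ≠ 0) (p : ℝ × ℝ) :
    shiftFlip ε hε p = (p.1 + 1, ε * p.2) := rfl

theorem shiftFlip_zpow_fst (ε : ℝ) (hε : ε ≠ 0) (n : ℤ) (p : ℝ × ℝ) :
    ((shiftFlip ε hε ^ n) p).1 = p.1 + n := by
  have hinv : ∀ q : ℝ × ℝ, ((shiftFlip ε hε)⁻¹ q).1 = q.1 - 1 := fun q => by
    have h1 : shiftFlip ε hε ((shiftFlip ε hε)⁻¹ q) = q := (shiftFlip ε hε).apply_symm_apply q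
    have h2 := congrArg Prod.fst h1
    rw [shiftFlip_apply] at h2
    simp only at h2
    linarith
  induction n with
  | zero => simp
  | succ n ih =>
    rw [add_comm, zpow_add, zpow_one, Homeomorph.mul_apply, shiftFlip_apply]
    simp only
    rw [ih]
    push_cast
    ring
  | pred n ih =>
    rw [sub_eq_add_neg, add_comm, zpow_add, zpow_neg_one, Homeomorph.mul_apply, hinv, ih]
    push_cast
    ring

section Develop

variable {h : ℂ ≃ₜ ℂ} {U : Set ℂ} {ρ R ε : ℝ} {E : ℝ × ℝ → ℂ} {C : ℂ → ℝ × ℝ}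

/-- The equivariant extension of a strip parametrization to the whole plane. -/
noncomputable def develop (h : ℂ ≃ₜ ℂ) (T : ℝ × ℝ ≃ₜ ℝ × ℝ) (E : ℝ × ℝ → ℂ) (p : ℝ × ℝ) : ℂ :=
  (h ^ ⌊p.1⌋) (E ((T ^ (-⌊p.1⌋)) p))

theorem IsStrip.develop_eq (hE : IsStrip h U ρ ε E C) (hε : ε ≠ 0) {n : ℤ} {p : ℝ × ℝ}
    (hp : p.1 ∈ Icc (n : ℝ) (n + 1)) :
    develop h (shiftFlip ε hε) E p = (h ^ n) (E ((shiftFlip ε hε ^ (-n)) p)) := by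
  rcases eq_or_lt_of_le hp.2 with h1 | h1
  · have hfl : ⌊p.1⌋ = n + 1 := by
      rw [h1]
      exact_mod_cast Int.floor_intCast (R := ℝ) (n + 1)
    set T := shiftFlip ε hε with hT
    have h0 : ((T ^ (-(n + 1))) p).1 = 0 := by
      rw [hT, shiftFlip_zpow_fst, h1]
      push_cast
      ring
    set q := (T ^ (-(n + 1))) p with hq
    have hq2 : (T ^ (-n)) p = T q := by
      rw [hq, ← Homeomorph.mul_apply, ← zpow_one_add]
      congr 2
      ring
    have hq3 : q = (0, q.2) := Prod.ext h0 rfl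
    rw [develop, hfl, ← hq, hq2, hT, shiftFlip_apply, h0, zero_add, hE.apply_eq, ← hq3, zpow_add_one,
      Homeomorph.mul_apply]
  · rw [develop, Int.floor_eq_iff.2 ⟨hp.1, h1⟩]

theorem develop_shift (h : ℂ ≃ₜ ℂ) (E : ℝ × ℝ → ℂ) (hε : ε ≠ 0) (p : ℝ × ℝ) :
    develop h (shiftFlip ε hε) E (shiftFlip ε hε p) = h (develop h (shiftFlip ε hε) E p) := by
  set T := shiftFlip ε hε with hT
  have hfl : ⌊(T p).1⌋ = ⌊p.1⌋ + 1 := Int.floor_add_one p.1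
  rw [develop, hfl, develop, ← Homeomorph.mul_apply, ← Homeomorph.mul_apply, ← zpow_one_add,
    add_comm 1, ← zpow_add_one]
  congr 4
  ring

theorem develop_zpow (h : ℂ ≃ₜ ℂ) (E : ℝ × ℝ → ℂ) (hε : ε ≠ 0) (n : ℤ) (p : ℝ × ℝ) :
    develop h (shiftFlip ε hε) E ((shiftFlip ε hε ^ n) p) =
      (h ^ n) (develop h (shiftFlip ε hε) E p) := by
  set T := shiftFlip ε hε with hT
  induction n with
  | zero => simp
  | succ n ih =>
    rw [add_comm, zpow_add, zpow_one, Homeomorph.mul_apply, develop_shift, ih, zpow_add, zpow_one,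
      Homeomorph.mul_apply]
  | pred n ih =>
    apply h.injective
    rw [← develop_shift, ← Homeomorph.mul_apply, ← Homeomorph.mul_apply, ← zpow_one_add,
      ← zpow_one_add]
    simpa using ih

theorem IsStrip.continuous_develop (hE : IsStrip h U ρ ε E C) (hε : ε ≠ 0) :
    Continuous (develop h (shiftFlip ε hε) E) := by
  set T := shiftFlip ε hε with hT
  have hcl : ∀ n : ℤ, IsClosed {p : ℝ × ℝ | p.1 ∈ Icc (n : ℝ) (n + 1)} := fun n =>
    isClosed_Icc.preimage continuous_fst
  have hon : ∀ n : ℤ, ContinuousOn (develop h T E) {p : ℝ × ℝ | p.1 ∈ Icc (n : ℝ) (n + 1)} := by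
    intro n
    have h1 : ContinuousOn (fun p => (h ^ n) (E ((T ^ (-n)) p)))
        {p : ℝ × ℝ | p.1 ∈ Icc (n : ℝ) (n + 1)} := by
      refine (h ^ n).continuous.comp_continuousOn (hE.continuousOn.comp
        (T ^ (-n)).continuous.continuousOn fun p hp => ?_)
      show ((T ^ (-n)) p).1 ∈ Icc (0 : ℝ) 1
      rw [hT, shiftFlip_zpow_fst]
      have h2 : p.1 ∈ Icc (n : ℝ) (n + 1) := hp
      push_cast
      exact ⟨by linarith [h2.1], by linarith [h2.2]⟩
    exact h1.congr fun p hp => hE.develop_eq hε hp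
  rw [continuous_iff_continuousAt]
  intro p
  set n := ⌊p.1⌋ with hn
  have h1 := (hon (n - 1)).union_of_isClosed (hon n) (hcl _) (hcl _)
  refine h1.continuousAt ?_
  have h2 : {q : ℝ × ℝ | q.1 ∈ Ioo ((n : ℝ) - 1) (n + 1)} ∈ 𝓝 p :=
    (isOpen_Ioo.preimage continuous_fst).mem_nhds
      ⟨by linarith [Int.floor_le p.1], Int.lt_floor_add_one p.1⟩
  filter_upwards [h2] with q hq
  have hq' : q.1 ∈ Ioo ((n : ℝ) - 1) (n + 1) := hq
  rcases le_total q.1 n with h3 | h3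
  · left
    show q.1 ∈ Icc (((n - 1 : ℤ)) : ℝ) (((n - 1 : ℤ) : ℝ) + 1)
    push_cast
    exact ⟨hq'.1.le, by linarith⟩
  · right
    exact ⟨h3, hq'.2.le⟩

theorem IsStrip.mem_of_Ico (hE : IsStrip h U ρ ε E C) {p : ℝ × ℝ} (hp : p.1 ∈ Ico (0 : ℝ) 1) :
    E p ∈ U ∪ realSeg ρ := by
  rcases eq_or_lt_of_le hp.1 with h0 | h0
  · right
    have := hE.mem_realSeg p.2
    rwa [h0] at this
  · exact Or.inl (hE.mem p ⟨h0, hp.2⟩)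

theorem IsStrip.injective_develop (hE : IsStrip h U ρ ε E C) (hU : IsHalfDomain h U R)
    (hρR : ρ ≤ R) (hε : ε ≠ 0) : Function.Injective (develop h (shiftFlip ε hε) E) := by
  set T := shiftFlip ε hε with hT
  have hI : ∀ p : ℝ × ℝ, ((T ^ (-⌊p.1⌋)) p).1 ∈ Ico (0 : ℝ) 1 := fun p => by
    rw [hT, shiftFlip_zpow_fst]
    push_cast
    exact ⟨by linarith [Int.floor_le p.1], by linarith [Int.lt_floor_add_one p.1]⟩
  have key : ∀ p q : ℝ × ℝ, ⌊p.1⌋ ≤ ⌊q.1⌋ → develop h T E p = develop h T E q → p = q := by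
    intro p q hle he
    rw [develop, develop] at he
    rcases eq_or_lt_of_le hle with h1 | h1
    · rw [h1] at he
      have h2 := congrArg C ((h ^ ⌊q.1⌋).injective he)
      have hp := hI p
      rw [h1] at hp
      rw [hE.left_inv _ ⟨hp.1, hp.2.le⟩, hE.left_inv _ ⟨(hI q).1, (hI q).2.le⟩] at h2
      exact (T ^ (-⌊q.1⌋)).injective h2
    · obtain ⟨k, hk⟩ : ∃ k : ℕ, ⌊q.1⌋ = ⌊p.1⌋ + k := ⟨(⌊q.1⌋ - ⌊p.1⌋).toNat, by omega⟩
      have hk1 : 1 ≤ k := by omega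
      rw [hk, zpow_add, Homeomorph.mul_apply, zpow_natCast] at he
      have h2 := (h ^ ⌊p.1⌋).injective he
      have hmem : ∀ r : ℝ × ℝ, E ((T ^ (-⌊r.1⌋)) r) ∈ U ∪ realSeg R := fun r =>
        union_subset_union_right _ (realSeg_mono hρR) (hE.mem_of_Ico (hI r))
      have h3 := hU.iterate_notMem hk1 (hmem q)
      have h4 : ∀ (k : ℕ) (z : ℂ), (h ^ k) z = h^[k] z := fun k z => by
        induction k generalizing z with
        | zero => rfl
        | succ k ih => rw [pow_succ, Homeomorph.mul_apply, ih, Function.iterate_succ_apply]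
      rw [← h4, hk, ← h2] at h3
      exact absurd (hmem p) h3
  intro p q he
  rcases le_total ⌊p.1⌋ ⌊q.1⌋ with h1 | h1
  · exact key p q h1 he
  · exact (key q p h1 he.symm).symm

theorem IsStrip.develop_of_Icc (hE : IsStrip h U ρ ε E C) (hε : ε ≠ 0) {p : ℝ × ℝ}
    (hp : p.1 ∈ Icc (0 : ℝ) 1) : develop h (shiftFlip ε hε) E p = E p := by
  rw [hE.develop_eq hε (n := 0) (by simpa using hp)]
  simp

theorem IsStrip.fst_mem_Icc (hE : IsStrip h U ρ ε E C) {z : ℂ} (hz : z ∈ U ∪ realSeg ρ) :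
    (C z).1 ∈ Icc (0 : ℝ) 1 := by
  rcases hz with hz | hz
  · exact ⟨(hE.fst_mem z hz).1.le, (hE.fst_mem z hz).2.le⟩
  · rw [hE.fst_eq z hz]
    exact ⟨le_rfl, zero_le_one⟩

theorem IsStrip.develop_symm (hE : IsStrip h U ρ ε E C) (hε : ε ≠ 0) {z : ℂ}
    (hz : z ∈ U ∪ realSeg ρ) : develop h (shiftFlip ε hε) E (C z) = z := by
  rw [hE.develop_of_Icc hε (hE.fst_mem_Icc hz)]
  exact hE.right_inv z (hz.imp id Or.inl)

theorem IsStrip.develop_symm_apply (hE : IsStrip h U ρ ε E C) (hε : ε ≠ 0) {z : ℂ} (hz : h z ∈ U) :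
    develop h (shiftFlip ε hε) E ((shiftFlip ε hε).symm (C (h z))) = z := by
  apply h.injective
  rw [← develop_shift, Homeomorph.apply_symm_apply, hE.develop_symm hε (Or.inl hz)]

theorem IsHalfDomain.mem_of_im_nonneg (hU : IsHalfDomain h U R) (hρR : ρ ≤ R) {z : ℂ}
    (hz : z ∈ Metric.ball (0 : ℂ) ρ) (h0 : 0 ≤ z.im) : z ∈ U ∪ realSeg ρ := by
  rcases eq_or_lt_of_le h0 with h1 | h1
  · exact Or.inr ⟨by simpa using hz, h1.symm⟩
  · exact Or.inl ((hU.mem_iff z (Metric.ball_subset_ball hρR hz)).2 h1)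

theorem IsStrip.isOpenMap_develop (hE : IsStrip h U ρ ε E C) (hU : IsHalfDomain h U R)
    (hρR : ρ ≤ R) (hε : ε ≠ 0) : IsOpenMap (develop h (shiftFlip ε hε) E) := by
  set T := shiftFlip ε hε with hT
  have main : ∀ p : ℝ × ℝ, p.1 ∈ Ico (0 : ℝ) 1 →
      𝓝 (develop h T E p) ≤ (𝓝 p).map (develop h T E) := by
    intro p hp
    suffices hg : ∃ g : ℂ → ℝ × ℝ, (∀ᶠ z in 𝓝 (E p), develop h T E (g z) = z) ∧
        Tendsto g (𝓝 (E p)) (𝓝 p) by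
      obtain ⟨g, hg1, hg2⟩ := hg
      rw [hT, hE.develop_of_Icc hε ⟨hp.1, hp.2.le⟩]
      intro S hS
      have h2 : ∀ᶠ z in 𝓝 (E p), g z ∈ develop h T E ⁻¹' S := hg2 hS
      filter_upwards [hg1, h2] with z h3 h4
      rw [← h3]
      exact h4
    have hCE := hE.left_inv p ⟨hp.1, hp.2.le⟩
    rcases eq_or_lt_of_le hp.1 with h0 | h0
    · have hp0 : p = (0, p.2) := Prod.ext h0.symm rfl
      have hreal : E p ∈ realSeg ρ := by rw [hp0]; exact hE.mem_realSeg _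
      have hball : Metric.ball (0 : ℂ) ρ ∈ 𝓝 (E p) :=
        Metric.isOpen_ball.mem_nhds (by simpa using hreal.1)
      classical
      refine ⟨fun z => if 0 ≤ z.im then C z else T.symm (C (h z)), ?_, ?_⟩
      · filter_upwards [hball] with z hz
        split_ifs with him
        · exact hE.develop_symm hε (hU.mem_of_im_nonneg hρR hz him)
        · exact hE.develop_symm_apply hε
            ((hU.apply_mem_iff z (Metric.ball_subset_ball hρR hz)).2 (not_le.1 him))
      · refine Tendsto.if ?_ ?_
        · have h1 := hE.continuousOn_symm (E p) (Or.inr (Or.inl hreal))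
          rw [ContinuousWithinAt, hCE] at h1
          refine h1.mono_left (le_inf inf_le_left ?_)
          rw [le_principal_iff, mem_inf_principal]
          filter_upwards [hball] with z hz him
          exact (hU.mem_of_im_nonneg hρR hz him).imp id Or.inl
        · have h1 := hE.continuousOn_symm (h (E p)) (Or.inr (Or.inr ⟨_, hreal, rfl⟩))
          have h2 : C (h (E p)) = T p := by
            rw [hp0, ← hE.apply_eq, hE.left_inv _ ⟨zero_le_one, le_rfl⟩, hT, shiftFlip_apply, zero_add]
          rw [ContinuousWithinAt, h2] at h1
          have h3 := (T.symm.continuous.tendsto _).comp h1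
          rw [Homeomorph.symm_apply_apply] at h3
          refine h3.comp (tendsto_inf.2 ⟨(h.continuous.tendsto _).mono_left inf_le_left, ?_⟩)
          rw [tendsto_principal, eventually_inf_principal]
          filter_upwards [hball] with z hz him
          exact Or.inl ((hU.apply_mem_iff z (Metric.ball_subset_ball hρR hz)).2 (not_le.1 him))
    · have hEp : E p ∈ U := hE.mem p ⟨h0, hp.2⟩
      have hUn : U ∈ 𝓝 (E p) := hU.isOpen.mem_nhds hEp
      refine ⟨C, ?_, ?_⟩
      · filter_upwards [hUn] with z hz using hE.develop_symm hε (Or.inl hz)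
      · have h1 := (hE.continuousOn_symm (E p) (Or.inl hEp)).continuousAt
          (mem_of_superset hUn subset_union_left)
        rwa [ContinuousAt, hCE] at h1
  rw [isOpenMap_iff_nhds_le]
  intro p
  set n := ⌊p.1⌋ with hn
  set q := (T ^ (-n)) p with hq
  have hpq : p = (T ^ n) q := by
    rw [hq, ← Homeomorph.mul_apply, ← zpow_add]
    simp
  have hqI : q.1 ∈ Ico (0 : ℝ) 1 := by
    rw [hq, hT, shiftFlip_zpow_fst]
    push_cast
    exact ⟨by linarith [Int.floor_le p.1], by linarith [Int.lt_floor_add_one p.1]⟩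
  have hcomm : develop h T E ∘ (T ^ n) = (h ^ n) ∘ develop h T E :=
    funext fun r => develop_zpow h E hε n r
  rw [hpq, ← (T ^ n).map_nhds_eq, Filter.map_map, hcomm, ← Filter.map_map, develop_zpow,
    ← (h ^ n).map_nhds_eq]
  exact Filter.map_mono (main q hqI)

theorem IsStrip.ball_subset_range_develop (hE : IsStrip h U ρ ε E C) (hU : IsHalfDomain h U R)
    (hρR : ρ ≤ R) (hε : ε ≠ 0) :
    Metric.ball 0 ρ ⊆ range (develop h (shiftFlip ε hε) E) := by
  intro z hz
  rcases le_or_gt 0 z.im with him | him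
  · exact ⟨_, hE.develop_symm hε (hU.mem_of_im_nonneg hρR hz him)⟩
  · exact ⟨_, hE.develop_symm_apply hε
      ((hU.apply_mem_iff z (Metric.ball_subset_ball hρR hz)).2 him)⟩

end Develop

end BrouwerPlane

namespace BrouwerPlane
open Complex

/-- `f` has a continuous logarithm which changes by `c` over every interval of length `2π`. -/
def HasLogChange (f : ℝ → ℂ) (c : ℂ) : Prop :=
  ∃ g : ℝ → ℂ, Continuous g ∧ (∀ θ, exp (g θ) = f θ) ∧ ∀ θ, g (θ + 2 * Real.pi) = g θ + c

theorem HasLogChange.unique {f : ℝ → ℂ} {c c' : ℂ} (h : HasLogChange f c)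
    (h' : HasLogChange f c') : c = c' := by
  obtain ⟨g, hg, he, hc⟩ := h
  obtain ⟨g', hg', he', hc'⟩ := h'
  have := log_sub_const_univ hg hg' (fun x => (he x).trans (he' x).symm) (0 + 2 * Real.pi) 0
  rw [hc, hc'] at this
  linear_combination this

theorem exists_hasLogChange {F : ℝ × ℝ → ℂ} (hF : Continuous F) (h0 : ∀ p, F p ≠ 0)
    (hper : ∀ s θ, F (s, θ + 2 * Real.pi) = F (s, θ)) :
    ∃ c, ∀ s, HasLogChange (fun θ => F (s, θ)) c := by
  obtain ⟨g, hg, he⟩ := exists_log hF h0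
  have hsh : Continuous fun p : ℝ × ℝ => g (p.1, p.2 + 2 * Real.pi) := by fun_prop
  refine ⟨g (0, 0 + 2 * Real.pi) - g (0, 0), fun s => ⟨fun θ => g (s, θ), by fun_prop,
    fun θ => he _, fun θ => ?_⟩⟩
  have := log_sub_const_univ hsh hg (fun p => by rw [he, he]; exact hper _ _) (s, θ) (0, 0)
  simp only at this
  linear_combination this

theorem HasLogChange.of_homotopy {F : ℝ × ℝ → ℂ} (hF : Continuous F) (h0 : ∀ p, F p ≠ 0)
    (hper : ∀ s θ, F (s, θ + 2 * Real.pi) = F (s, θ)) {c : ℂ} {s : ℝ}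
    (h : HasLogChange (fun θ => F (s, θ)) c) (s' : ℝ) : HasLogChange (fun θ => F (s', θ)) c := by
  obtain ⟨c', hc'⟩ := exists_hasLogChange hF h0 hper
  rw [h.unique (hc' s)]
  exact hc' s'

theorem HasLogChange.comp_neg {f : ℝ → ℂ} {c : ℂ} (h : HasLogChange f c) :
    HasLogChange (fun θ => f (-θ)) (-c) := by
  obtain ⟨g, hg, he, hc⟩ := h
  refine ⟨fun θ => g (-θ), by fun_prop, fun θ => he _, fun θ => ?_⟩
  have := hc (-(θ + 2 * Real.pi))
  rw [show -(θ + 2 * Real.pi) + 2 * Real.pi = -θ by ring] at this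
  simp only
  rw [this]
  ring

theorem HasLogChange.ne_zero_of_odd {f : ℝ → ℂ} {c : ℂ} (h : HasLogChange f c)
    (hodd : ∀ θ, f (θ + Real.pi) = -f θ) : c ≠ 0 := by
  rintro rfl
  obtain ⟨g, hg, he, hc⟩ := h
  have hsh : Continuous fun θ : ℝ => g (θ + Real.pi) + Real.pi * I := by fun_prop
  have h1 := log_sub_const_univ hsh hg (fun θ => by
    rw [exp_add, exp_pi_mul_I, he, he, hodd]; ring) (0 + Real.pi) 0
  have h2 := hc 0
  rw [two_mul, ← add_assoc] at h2
  have h3 : g (0 + Real.pi) = g 0 := by linear_combination h2 / 2 - h1 / 2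
  have h4 := he (0 + Real.pi)
  rw [h3, he, hodd] at h4
  have h5 : f 0 = 0 := by linear_combination h4 / 2
  exact exp_ne_zero (g 0) ((he 0).trans h5)

/-- A homeomorphism isotopic to the identity cannot act on an embedded plane as an orientation
reversing glide reflection. -/
theorem IsotopicId.not_glide_reflection {h : ℂ ≃ₜ ℂ} (hh : IsotopicId h) {ψ : ℝ × ℝ → ℂ}
    (hψ : Continuous ψ) (hi : Function.Injective ψ)
    (he : ∀ p : ℝ × ℝ, h (ψ p) = ψ (p.1 + 1, -p.2)) : False := by
  obtain ⟨H, hH, hH0, hH1⟩ := hh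
  have hcs : ∀ θ : ℝ, (Real.cos θ, Real.sin θ) ≠ (0, 0) := fun θ h0 => by
    have h1 := congrArg Prod.fst h0
    have h2 := congrArg Prod.snd h0
    simp only at h1 h2
    have := Real.cos_sq_add_sin_sq θ
    rw [h1, h2] at this
    norm_num at this
  set f : ℝ → ℂ := fun θ => ψ (Real.cos θ, Real.sin θ) - ψ (0, 0) with hf
  have hodd : Continuous fun p : ℝ × ℝ => ψ (Real.cos p.2, Real.sin p.2) -
      ψ (-p.1 ^ 2 * Real.cos p.2, -p.1 ^ 2 * Real.sin p.2) := by fun_prop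
  have hodd0 : ∀ p : ℝ × ℝ, ψ (Real.cos p.2, Real.sin p.2) -
      ψ (-p.1 ^ 2 * Real.cos p.2, -p.1 ^ 2 * Real.sin p.2) ≠ 0 := fun p h0 => by
    have h1 := hi (sub_eq_zero.1 h0)
    have h2 := congrArg Prod.fst h1
    have h3 := congrArg Prod.snd h1
    simp only at h2 h3
    have hp : (1 + p.1 ^ 2) ≠ 0 := by positivity
    refine hcs p.2 (Prod.ext ?_ ?_)
    · exact (mul_eq_zero.1 (show (1 + p.1 ^ 2) * Real.cos p.2 = 0 by linarith)).resolve_left hp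
    · exact (mul_eq_zero.1 (show (1 + p.1 ^ 2) * Real.sin p.2 = 0 by linarith)).resolve_left hp
  obtain ⟨c, hc⟩ := exists_hasLogChange hodd hodd0 (fun s θ => by
    simp only [Real.cos_add_two_pi, Real.sin_add_two_pi])
  have hc0 : c ≠ 0 := (hc 1).ne_zero_of_odd fun θ => by
    simp only [Real.cos_add_pi, Real.sin_add_pi]
    norm_num
  have hfc : HasLogChange f c := by simpa [hf] using hc 0
  have hiso : Continuous fun p : ℝ × ℝ =>
      H p.1 (ψ (Real.cos p.2, Real.sin p.2)) - H p.1 (ψ (0, 0)) :=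
    (hH.comp (by fun_prop : Continuous fun p : ℝ × ℝ => (p.1, ψ (Real.cos p.2, Real.sin p.2)))).sub
      (hH.comp (by fun_prop : Continuous fun p : ℝ × ℝ => (p.1, ψ (0, 0))))
  have h1 : HasLogChange (fun θ => ψ (1 + Real.cos θ, -Real.sin θ) - ψ (1, 0)) c := by
    have h2 := HasLogChange.of_homotopy hiso (fun p h0 =>
      hcs p.2 (hi ((H p.1).injective (sub_eq_zero.1 h0))))
      (fun s θ => by simp only [Real.cos_add_two_pi, Real.sin_add_two_pi]) (c := c) (s := 0)
      (by simpa [hH0] using hfc) 1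
    simp only [hH1, he] at h2
    simpa [add_comm] using h2
  have h3 : HasLogChange (fun θ => f (-θ)) c := by
    have htr : Continuous fun p : ℝ × ℝ =>
      ψ (1 - p.1 + Real.cos p.2, -Real.sin p.2) - ψ (1 - p.1, 0) := by fun_prop
    have h2 := HasLogChange.of_homotopy htr (fun p h0 => by
      have h4 := hi (sub_eq_zero.1 h0)
      have h5 := congrArg Prod.fst h4
      have h6 := congrArg Prod.snd h4
      simp only at h5 h6
      exact hcs p.2 (Prod.ext (by simp only; linarith) (by simp only; linarith)))
      (fun s θ => by simp only [Real.cos_add_two_pi, Real.sin_add_two_pi]) (c := c) (s := 0)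
      (by simpa using h1) 1
    simpa [hf] using h2
  have h4 := h3.unique hfc.comp_neg
  exact hc0 (by linear_combination h4 / 2)

end BrouwerPlane

namespace BrouwerPlane
open Complex

/-- `x` and `y` lie in the image of an open embedding of the plane which conjugates a translation
to the restriction of `h`. -/
def HasChart (h : ℂ ≃ₜ ℂ) (x y : ℂ) : Prop :=
  ∃ Ψ : ℝ × ℝ → ℂ, IsOpenEmbedding Ψ ∧ (∀ p : ℝ × ℝ, h (Ψ p) = Ψ (p.1 + 1, p.2)) ∧
    x ∈ range Ψ ∧ y ∈ range Ψ

theorem HasChart.of_conj {h k : ℂ ≃ₜ ℂ} {x y : ℂ}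
    (hc : HasChart ((k.symm.trans h).trans k) (k x) (k y)) : HasChart h x y := by
  obtain ⟨Ψ, hΨ, he, ⟨p, hp⟩, ⟨q, hq⟩⟩ := hc
  refine ⟨k.symm ∘ Ψ, k.symm.isOpenEmbedding.comp hΨ, fun p => ?_, ⟨p, by simp [hp]⟩,
    ⟨q, by simp [hq]⟩⟩
  rw [Function.comp_apply, Function.comp_apply, ← he]
  simp

theorem IsBrouwer.conj {h : ℂ ≃ₜ ℂ} (hh : IsBrouwer h) (k : ℂ ≃ₜ ℂ) :
    IsBrouwer ((k.symm.trans h).trans k) := by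
  refine ⟨hh.1.conj k, fun z hz => hh.2 (k.symm z) ?_⟩
  rw [← hz]
  simpa using congrArg k.symm hz

theorem IsHalfDomain.hasChart {h : ℂ ≃ₜ ℂ} (hh : IsotopicId h) {U : Set ℂ} {ρ R : ℝ}
    (hU : IsHalfDomain h U R) (hρ : 0 < ρ) (hρR : ρ < R) {x y : ℂ} (hx : ‖x‖ < ρ) (hy : ‖y‖ < ρ) :
    HasChart h x y := by
  obtain ⟨L, hL⟩ := hU.exists_isStripChart hρ hρR
  obtain ⟨ε, E, C, hε, hE⟩ := hL.exists_isStrip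
  have hε0 : ε ≠ 0 := by rcases hε with rfl | rfl <;> norm_num
  have hc := hE.continuous_develop hε0
  have hi := hE.injective_develop hU hρR.le hε0
  rcases hε with rfl | rfl
  · have hr := hE.ball_subset_range_develop hU hρR.le hε0
    refine ⟨_, .of_continuous_injective_isOpenMap hc hi (hE.isOpenMap_develop hU hρR.le hε0),
      fun p => ?_, hr (by simpa using hx), hr (by simpa using hy)⟩
    rw [← develop_shift, shiftFlip_apply, one_mul]
  · exact (hh.not_glide_reflection hc hi fun p => by
      rw [← develop_shift, shiftFlip_apply, neg_one_mul]).elim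

theorem IsBrouwer.hasChart_of_ball {h : ℂ ≃ₜ ℂ} (hh : IsBrouwer h) {c y : ℂ} {δ : ℝ}
    (hf : Free h (Metric.ball c δ)) (hy : y ∈ Metric.ball c δ) : HasChart h c y := by
  obtain ⟨z, r, hr, hz, hhz, hcrit⟩ := exists_critical hh.2 c
  have hyr : ‖y - c‖ < r := by
    refine (mem_ball_iff_norm.1 hy).trans_le (le_of_not_gt fun hlt => ?_)
    exact hf z (mem_ball_iff_norm.2 (hz.trans_lt hlt)) (mem_ball_iff_norm.2 (hhz.trans_lt hlt))
  set d := h z - z with hd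
  have hd0 : d ≠ 0 := sub_ne_zero.2 (hh.2 z)
  have hn0 : (‖d‖ : ℂ) ≠ 0 := by simpa using hd0
  set m : ℂ := ‖d‖ * I / d with hm
  have hm0 : m ≠ 0 := by simp [hm, hd0]
  have hm1 : ‖m‖ = 1 := by simp [hm, hd0]
  let k : ℂ ≃ₜ ℂ := (Homeomorph.subRight c).trans (Homeomorph.mulLeft₀ m hm0)
  have hk : ∀ w, k w = m * (w - c) := fun w => rfl
  have hkn : ∀ w, ‖k w‖ = ‖w - c‖ := fun w => by rw [hk, norm_mul, hm1, one_mul]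
  refine HasChart.of_conj (k := k) ?_
  have hh' := hh.conj k
  set h' := (k.symm.trans h).trans k with hh'd
  have happ : ∀ w, h' (k w) = k (h w) := fun w => by simp [hh'd]
  obtain ⟨ρ, hρ1, hρ2⟩ := exists_between hyr
  obtain ⟨R, hR1, hR2⟩ := exists_between hρ2
  have hρ0 : 0 < ρ := (norm_nonneg _).trans_lt hρ1
  obtain ⟨U, hU⟩ := hh'.exists_isHalfDomain (z := k z) (r := r) (t := ‖d‖) (hρ0.trans hR1) hR2
    (by rw [hkn, hz]) (by rw [happ, hkn, hhz]) (fun w => by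
      obtain ⟨v, rfl⟩ := k.surjective w
      rw [happ, hkn, hkn]
      exact hcrit v) (norm_pos_iff.2 hd0) (by
      rw [happ, hk, hk, ← mul_sub, sub_sub_sub_cancel_right, ← hd, hm]
      field_simp)
  refine hU.hasChart hh'.1 hρ0 hR1 ?_ ?_
  · rw [hkn]; simpa using hρ0
  · rwa [hkn]

theorem exists_homeomorph_ball {X : Set ℂ} (hX : IsOpen X) (hc : IsPreconnected X) {x y : ℂ}
    (hx : x ∈ X) (hy : y ∈ X) : ∃ (φ : ℂ ≃ₜ ℂ) (δ : ℝ), (∀ z ∉ X, φ z = z) ∧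
      Metric.ball (φ x) δ ⊆ X ∧ φ y ∈ Metric.ball (φ x) δ := by
  set S : Set ℂ := {y | ∃ (φ : ℂ ≃ₜ ℂ) (δ : ℝ), (∀ z ∉ X, φ z = z) ∧
      Metric.ball (φ x) δ ⊆ X ∧ φ y ∈ Metric.ball (φ x) δ} with hS
  have hxS : x ∈ S := by
    obtain ⟨δ, hδ, hb⟩ := Metric.isOpen_iff.1 hX x hx
    exact ⟨Homeomorph.refl ℂ, δ, fun _ _ => rfl, hb, Metric.mem_ball_self hδ⟩
  have hSo : IsOpen S := by
    rw [isOpen_iff_mem_nhds]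
    rintro y ⟨φ, δ, h1, h2, h3⟩
    filter_upwards [φ.continuous.continuousAt (Metric.isOpen_ball.mem_nhds h3)] with w hw
    exact ⟨φ, δ, h1, h2, hw⟩
  refine hc.subset_of_closure_inter_subset hSo ⟨x, hx, hxS⟩ ?_ hy
  rintro y ⟨hyS, hyX⟩
  by_cases hxy : x = y
  · rwa [← hxy]
  obtain ⟨δ, hδ, hb⟩ := Metric.isOpen_iff.1 hX y hyX
  set η := min δ (dist x y) with hη
  have hη0 : 0 < η := lt_min hδ (dist_pos.2 hxy)
  obtain ⟨w, hwS, hw⟩ := Metric.mem_closure_iff.1 hyS η hη0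
  obtain ⟨φ, δ', h1, h2, h3⟩ := hwS
  obtain ⟨θ, -, hθ, hθ'⟩ := exists_push (Metric.isOpen_ball (x := y) (ε := η))
    (convex_ball y η).isPreconnected (Metric.mem_ball_self hη0)
    (show w ∈ Metric.ball y η by rwa [Metric.mem_ball, dist_comm])
  have hx' : θ x = x := hθ' x fun h => by
    have := (Metric.mem_ball.1 h).trans_le (min_le_right _ _)
    exact lt_irrefl _ this
  refine ⟨θ.trans φ, δ', fun z hz => ?_, ?_, ?_⟩
  · rw [Homeomorph.trans_apply, hθ' z fun h => hz (hb (Metric.ball_subset_ball (min_le_left _ _) h)),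
      h1 z hz]
  · rwa [Homeomorph.trans_apply, hx']
  · rwa [Homeomorph.trans_apply, Homeomorph.trans_apply, hx', hθ]

/-- Two points of a free continuum lie in a common translation chart. -/
theorem IsBrouwer.hasChart_of_free {h : ℂ ≃ₜ ℂ} (hh : IsBrouwer h) {K : Set ℂ} (hK : IsCompact K)
    (hc : IsConnected K) (hf : Free h K) {x y : ℂ} (hx : x ∈ K) (hy : y ∈ K) : HasChart h x y := by
  obtain ⟨X, hXo, hXc, -, hXf, hKX⟩ := exists_free_nhd hK hc hf
  obtain ⟨φ, δ, hφ, hb, hyb⟩ := exists_homeomorph_ball hXo hXc.isPreconnected (hKX hx) (hKX hy)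
  refine HasChart.of_conj (k := φ) ((hh.conj φ).hasChart_of_ball (δ := δ) ?_ hyb)
  intro z hz hz'
  have h1 : φ.symm z ∈ X := by
    rw [← apply_mem_iff_of_eqOn_compl hφ, Homeomorph.apply_symm_apply]
    exact hb hz
  refine hXf _ h1 ?_
  rw [← apply_mem_iff_of_eqOn_compl hφ]
  exact hb hz'

end BrouwerPlane

namespace BrouwerPlane

/-- The conjugate of a plane homeomorphism by the identification of `ℂ` with `ℝ × ℝ`. -/
noncomputable def toComplex (h : Plane ≃ₜ Plane) : ℂ ≃ₜ ℂ :=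
  (Complex.equivRealProdCLM.toHomeomorph.trans h).trans Complex.equivRealProdCLM.toHomeomorph.symm

theorem equivRealProd_toComplex (h : Plane ≃ₜ Plane) (z : ℂ) :
    Complex.equivRealProdCLM.toHomeomorph (toComplex h z) =
      h (Complex.equivRealProdCLM.toHomeomorph z) := by
  simp [toComplex]

theorem isBrouwer_toComplex (h : BrouwerHomeo) : IsBrouwer (toComplex h.toHomeomorph) := by
  obtain ⟨H, hc, h0, h1⟩ := h.orientationPreserving
  refine ⟨⟨fun s => toComplex (H s), ?_, ?_, by simp only [h1]⟩, fun z hz => ?_⟩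
  · exact Complex.equivRealProdCLM.toHomeomorph.symm.continuous.comp (hc.comp
      (continuous_fst.prodMk
        (Complex.equivRealProdCLM.toHomeomorph.continuous.comp continuous_snd)))
  · ext z
    simp only [toComplex, h0]
    exact Complex.equivRealProdCLM.symm_apply_apply z
  · refine h.fixedPointFree (Complex.equivRealProdCLM.toHomeomorph z) ?_
    rw [← equivRealProd_toComplex, hz]

theorem isTranslationDomain_range {h : BrouwerHomeo} {Ψ : ℝ × ℝ → Plane} (hΨ : IsOpenEmbedding Ψ)
    (he : ∀ p : ℝ × ℝ, h.toHomeomorph (Ψ p) = Ψ (p.1 + 1, p.2)) :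
    IsTranslationDomain h (range Ψ) := by
  let Φ : range Ψ ≃ₜ Plane := hΨ.isEmbedding.toHomeomorph.symm
  have hΦ : ∀ p hp, Φ ⟨Ψ p, hp⟩ = p := fun p hp =>
    (hΨ.isEmbedding.toHomeomorph.symm_apply_eq).2 rfl
  have : ContractibleSpace (range Ψ) := Φ.contractibleSpace
  refine ⟨hΨ.isOpen_range, isConnected_range hΨ.continuous, inferInstance, ?_, Φ, ?_⟩
  · ext z
    constructor
    · rintro ⟨_, ⟨p, rfl⟩, rfl⟩
      exact ⟨_, (he p).symm⟩
    · rintro ⟨p, rfl⟩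
      exact ⟨_, ⟨(p.1 - 1, p.2), rfl⟩, by rw [he]; simp⟩
  · rintro _ ⟨p, rfl⟩ hx'
    simp only [he, hΦ]
    exact (congrArg (fun q : ℝ × ℝ => (q.1 + 1, q.2)) (hΦ p (mem_range_self p))).symm

theorem exists_isTranslationDomain {h : BrouwerHomeo} {K : Set Plane} (hK : IsCompact K)
    (hc : IsConnected K) (hf : IsFree h K) {x y : Plane} (hx : x ∈ K) (hy : y ∈ K) :
    ∃ O, IsTranslationDomain h O ∧ x ∈ O ∧ y ∈ O := by
  set e := Complex.equivRealProdCLM.toHomeomorph with hee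
  have hf' : Free (toComplex h.toHomeomorph) (e.symm '' K) := by
    rintro _ ⟨z, hz, rfl⟩ hz'
    obtain ⟨w, hw, hwe⟩ := hz'
    have h1 := congrArg e hwe
    rw [equivRealProd_toComplex, ← hee, e.apply_symm_apply, e.apply_symm_apply] at h1
    exact disjoint_left.1 hf ⟨z, hz, h1.symm⟩ hw
  obtain ⟨Ψ, hΨ, he, ⟨p, hp⟩, ⟨q, hq⟩⟩ := (isBrouwer_toComplex h).hasChart_of_free
    (hK.image e.symm.continuous) (hc.image _ e.symm.continuous.continuousOn) hf'
    (mem_image_of_mem _ hx) (mem_image_of_mem _ hy)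
  refine ⟨range (e ∘ Ψ), isTranslationDomain_range (e.isOpenEmbedding.comp hΨ) fun p => ?_,
    ⟨p, by simp [hp]⟩, ⟨q, by simp [hq]⟩⟩
  rw [Function.comp_apply, Function.comp_apply, ← he, equivRealProd_toComplex]

theorem connectsBy_of_arcLenLe {h : BrouwerHomeo} {x y : Plane} {k : ℕ} (hxy : ArcLenLe h x y k) :
    ConnectsBy h x y k := by
  obtain ⟨f, hf, -, rfl, rfl, t, ht, h0, h1, hfree⟩ := hxy
  have hO : ∀ i : Fin k, ∃ O, IsTranslationDomain h O ∧ f (t i.castSucc) ∈ O ∧ f (t i.succ) ∈ O := by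
    intro i
    have hle : t i.castSucc ≤ t i.succ := ht i.castSucc_lt_succ.le
    exact exists_isTranslationDomain (isCompact_Icc.image hf)
      ((isConnected_Icc hle).image f hf.continuousOn) (hfree i)
      (mem_image_of_mem f ⟨le_rfl, hle⟩) (mem_image_of_mem f ⟨hle, le_rfl⟩)
  choose O hO hl hr using hO
  obtain _ | n := k
  · rw [show Fin.last 0 = 0 from rfl, h0] at h1
    exact absurd h1 zero_ne_one
  refine ⟨O, hO, ⟨⟨_, mem_iUnion.2 ⟨0, hl 0⟩⟩, ?_⟩, mem_iUnion.2 ⟨0, ?_⟩, mem_iUnion.2 ⟨Fin.last n, ?_⟩⟩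
  · have hgen : ∀ i : Fin (n + 1),
        Relation.ReflTransGen (fun i j => (O i ∩ O j).Nonempty) 0 i := by
      intro i
      induction i using Fin.induction with
      | zero => exact .refl
      | succ i ih =>
        refine ih.tail ⟨f (t i.castSucc.succ), hr _, ?_⟩
        rw [Fin.succ_castSucc]
        exact hl i.succ
    refine IsPreconnected.iUnion_of_reflTransGen (fun i => (hO i).2.1.isPreconnected)
      fun i j => ?_
    refine Relation.ReflTransGen.trans ?_ (hgen j)
    have : Std.Symm fun i j => (O i ∩ O j).Nonempty := ⟨fun a b hab => by rwa [inter_comm]⟩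
    exact Std.Symm.symm _ _ (hgen i)
  · have := hl 0
    rwa [Fin.castSucc_zero, h0] at this
  · have := hr (Fin.last n)
    rwa [Fin.succ_last, h1] at this

end BrouwerPlane

namespace BrouwerPlane

/-- `x` and `y` are joined by an injective path, parametrized by an interval `[0, T]` which may be
degenerate, and decomposed into `k` free pieces. -/
def PathLenLe (h : BrouwerHomeo) (x y : Plane) (k : ℕ) : Prop :=
  ∃ (F : ℝ → Plane) (T : ℝ), 0 ≤ T ∧ ContinuousOn F (Icc 0 T) ∧ InjOn F (Icc 0 T) ∧ F 0 = x ∧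
    F T = y ∧ ∃ t : ℕ → ℝ, Monotone t ∧ t 0 = 0 ∧ t k = T ∧
      ∀ i < k, IsFree h (F '' Icc (t i) (t (i + 1)))

theorem isFree_mono {h : BrouwerHomeo} {A B : Set Plane} (hB : IsFree h B) (hAB : A ⊆ B) :
    IsFree h A :=
  hB.mono (image_mono hAB) hAB

theorem isFree_singleton (h : BrouwerHomeo) (x : Plane) : IsFree h {x} := by
  rw [IsFree, image_singleton, disjoint_singleton]
  exact h.fixedPointFree x

theorem PathLenLe.trans {h : BrouwerHomeo} {x y z : Plane} {m n : ℕ} (hm : PathLenLe h x y m)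
    (hn : PathLenLe h y z n) : PathLenLe h x z (m + n) := by
  obtain ⟨F, A, hA, hF, hFi, rfl, hFA, t, ht, ht0, htm, htf⟩ := hm
  obtain ⟨G, B, hB, hG, hGi, hG0, rfl, τ, hτ, hτ0, hτn, hτf⟩ := hn
  obtain ⟨s, ⟨⟨hs0, hsA⟩, hsG⟩, hmin⟩ : ∃ s ∈ {s ∈ Icc 0 A | F s ∈ G '' Icc 0 B},
      ∀ r ∈ {s ∈ Icc 0 A | F s ∈ G '' Icc 0 B}, s ≤ r := by
    have hcl : IsClosed {s ∈ Icc 0 A | F s ∈ G '' Icc 0 B} :=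
      hF.preimage_isClosed_of_isClosed isClosed_Icc (isCompact_Icc.image_of_continuousOn hG).isClosed
    have hcp : IsCompact {s ∈ Icc 0 A | F s ∈ G '' Icc 0 B} :=
      isCompact_Icc.of_isClosed_subset hcl fun s hs => hs.1
    obtain ⟨s, hs⟩ := hcp.exists_isLeast ⟨A, ⟨hA, le_rfl⟩, 0, ⟨le_rfl, hB⟩, hG0.trans hFA.symm⟩
    exact ⟨s, hs.1, fun r hr => hs.2 hr⟩
  obtain ⟨u, ⟨hu0, huB⟩, hu⟩ := hsG
  have hdis : ∀ r, 0 ≤ r → r < s → ∀ v ∈ Icc 0 B, F r ≠ G v := fun r hr hrs v hv he =>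
    not_le.2 hrs (hmin r ⟨⟨hr, hrs.le.trans hsA⟩, v, hv, he.symm⟩)
  classical
  set E : ℝ → Plane := fun r => if r ≤ s then F r else G (u + (r - s)) with hE
  have hE1 : ∀ r, r ≤ s → E r = F r := fun r hr => if_pos hr
  have hE2 : ∀ r, s ≤ r → E r = G (u + (r - s)) := fun r hr => by
    rcases eq_or_lt_of_le hr with rfl | hr
    · rw [hE1 _ le_rfl, ← hu]
      simp
    · exact if_neg (not_le.2 hr)
  refine ⟨E, s + (B - u), by linarith, ?_, ?_, hE1 0 hs0, ?_, ?_⟩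
  · have h1 : ContinuousOn E (Icc 0 s) :=
      (hF.mono (Icc_subset_Icc_right hsA)).congr fun r hr => hE1 r hr.2
    have h2 : ContinuousOn E (Icc s (s + (B - u))) := by
      refine ContinuousOn.congr (f := fun r => G (u + (r - s))) ?_ fun r hr => hE2 r hr.1
      refine hG.comp (by fun_prop) fun r hr => ⟨?_, ?_⟩
      · linarith [hr.1]
      · linarith [hr.2]
    have h3 := h1.union_of_isClosed h2 isClosed_Icc isClosed_Icc
    rwa [Icc_union_Icc_eq_Icc hs0 (by linarith)] at h3
  · have key : ∀ a ∈ Icc 0 (s + (B - u)), ∀ b ∈ Icc 0 (s + (B - u)), a ≤ b → E a = E b → a = b := by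
      intro a ha b hb hab he
      rcases lt_or_ge a s with has | has
      · rcases le_or_gt b s with hbs | hbs
        · rw [hE1 a has.le, hE1 b hbs] at he
          exact hFi ⟨ha.1, has.le.trans hsA⟩ ⟨hb.1, hbs.trans hsA⟩ he
        · rw [hE1 a has.le, hE2 b hbs.le] at he
          exact absurd he (hdis a ha.1 has _ ⟨by linarith, by linarith [hb.2]⟩)
      · rw [hE2 a has, hE2 b (has.trans hab)] at he
        have := hGi ⟨by linarith, by linarith [ha.2]⟩ ⟨by linarith, by linarith [hb.2]⟩ he
        linarith
    intro a ha b hb he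
    rcases le_total a b with hab | hab
    · exact key a ha b hb hab he
    · exact (key b hb a ha hab he.symm).symm
  · rw [hE2 _ (by linarith)]
    congr 1
    ring
  · refine ⟨fun i => if i ≤ m then min (t i) s else s + (max (τ (i - m)) u - u), ?_, ?_, ?_, ?_⟩
    · refine monotone_nat_of_le_succ fun i => ?_
      rcases lt_or_ge i m with hi | hi
      · rw [if_pos hi.le, if_pos (Nat.succ_le_of_lt hi)]
        exact min_le_min_right _ (ht (Nat.le_succ i))
      · rw [if_neg (show ¬i + 1 ≤ m by omega)]
        have h1 := le_max_right (τ (i + 1 - m)) u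
        split_ifs with h2
        · linarith [min_le_right (t i) s]
        · have h3 : max (τ (i - m)) u ≤ max (τ (i + 1 - m)) u :=
            max_le_max_right _ (hτ (by omega))
          linarith
    · simp [ht0, hs0]
    · rcases Nat.eq_zero_or_pos n with rfl | hn
      · rw [hτ0] at hτn
        have hB0 : u = B := by linarith
        simp [htm, hsA, hB0]
      · simp only
        rw [if_neg (by omega), Nat.add_sub_cancel_left, hτn, max_eq_left huB]
    · intro i hi
      simp only
      rcases lt_or_ge i m with him | him
      · rw [if_pos him.le, if_pos (Nat.succ_le_of_lt him)]
        rcases le_or_gt (t i) s with hts | hts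
        · refine isFree_mono (htf i him) ?_
          rintro _ ⟨r, hr, rfl⟩
          refine ⟨r, ⟨?_, hr.2.trans (min_le_left _ _)⟩, (hE1 r (hr.2.trans (min_le_right _ _))).symm⟩
          rw [← min_eq_left hts]
          exact hr.1
        · refine isFree_mono (isFree_singleton h (E s)) ?_
          rintro _ ⟨r, hr, rfl⟩
          rw [min_eq_right hts.le, min_eq_right (hts.le.trans (ht (Nat.le_succ i)))] at hr
          rw [mem_singleton_iff, le_antisymm hr.2 hr.1]
      · have hlow : (if i ≤ m then min (t i) s else s + (max (τ (i - m)) u - u)) =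
            s + (max (τ (i - m)) u - u) := by
          split_ifs with h1
          · have h2 : i = m := le_antisymm h1 him
            rw [h2, htm, Nat.sub_self, hτ0, min_eq_right hsA, max_eq_right hu0]
            ring
          · rfl
        rw [hlow, if_neg (show ¬i + 1 ≤ m by omega)]
        have hEG : ∀ r ∈ Icc (s + (max (τ (i - m)) u - u)) (s + (max (τ (i + 1 - m)) u - u)),
            E r = G (u + (r - s)) := fun r hr =>
          hE2 r (by linarith [hr.1, le_max_right (τ (i - m)) u])
        rcases le_or_gt u (τ (i + 1 - m)) with huτ | huτ
        · refine isFree_mono (hτf (i - m) (by omega)) ?_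
          rintro _ ⟨r, hr, rfl⟩
          refine ⟨_, ⟨?_, ?_⟩, (hEG r hr).symm⟩
          · linarith [hr.1, le_max_left (τ (i - m)) u]
          · rw [max_eq_left huτ] at hr
            rw [show i - m + 1 = i + 1 - m by omega]
            linarith [hr.2]
        · refine isFree_mono (isFree_singleton h (G u)) ?_
          rintro _ ⟨r, hr, rfl⟩
          rw [hEG r hr, mem_singleton_iff]
          congr 1
          rw [max_eq_right huτ.le] at hr
          linarith [hr.1, hr.2, le_max_right (τ (i - m)) u]

theorem PathLenLe.mono {h : BrouwerHomeo} {x y : Plane} {m n : ℕ} (hm : PathLenLe h x y m)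
    (hmn : m ≤ n) : PathLenLe h x y n := by
  obtain ⟨F, A, hA, hF, hFi, hF0, hFA, t, ht, ht0, htm, htf⟩ := hm
  refine ⟨F, A, hA, hF, hFi, hF0, hFA, fun i => t (min i m), fun i j hij =>
    ht (min_le_min_right _ hij), by simp [ht0], by simp [hmn, htm], fun i _ => ?_⟩
  rcases lt_or_ge i m with him | him
  · simp only
    rw [min_eq_left him.le, min_eq_left (Nat.succ_le_of_lt him)]
    exact htf i him
  · simp only
    rw [min_eq_right him, min_eq_right (him.trans (Nat.le_succ i)), Icc_self, image_singleton]
    exact isFree_singleton h _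

theorem PathLenLe.arcLenLe {h : BrouwerHomeo} {x y : Plane} {k : ℕ} (hk : PathLenLe h x y k)
    (hxy : x ≠ y) : ArcLenLe h x y k := by
  obtain ⟨F, A, hA, hF, hFi, rfl, rfl, t, ht, ht0, htm, htf⟩ := hk
  have hA0 : 0 < A := hA.lt_of_ne fun h0 => hxy (by rw [h0])
  have hI : ∀ s : unitInterval, A * s ∈ Icc 0 A := fun s =>
    ⟨mul_nonneg hA s.2.1, mul_le_of_le_one_right hA s.2.2⟩
  have htI : ∀ i ≤ k, t i / A ∈ Icc (0 : ℝ) 1 := fun i hi => by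
    have h1 := ht (Nat.zero_le i)
    have h2 := ht hi
    rw [ht0] at h1
    rw [htm] at h2
    exact ⟨div_nonneg h1 hA, div_le_one_of_le₀ h2 hA⟩
  refine ⟨fun s => F (A * s), hF.comp_continuous (by fun_prop) hI, fun s s' he => ?_, by simp,
    by simp, fun i => ⟨t i / A, htI i (Nat.lt_succ_iff.1 i.2)⟩, fun i j hij => ?_, ?_, ?_, fun i => ?_⟩
  · exact Subtype.ext (mul_left_cancel₀ hA0.ne' (hFi (hI s) (hI s') he))
  · exact div_le_div_of_nonneg_right (ht hij) hA
  · exact Subtype.ext (by simp [ht0])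
  · exact Subtype.ext (by simp [htm, hA0.ne'])
  · refine isFree_mono (htf i i.2) ?_
    rintro _ ⟨s, hs, rfl⟩
    have h1 : t i / A ≤ s := hs.1
    have h2 : (s : ℝ) ≤ t (i + 1) / A := hs.2
    rw [div_le_iff₀' hA0] at h1
    rw [le_div_iff₀' hA0] at h2
    exact ⟨_, ⟨h1, h2⟩, rfl⟩

theorem iter_apply_of_equivariant {h : BrouwerHomeo} {ψ : Plane → Plane}
    (he : ∀ p : Plane, h.toHomeomorph (ψ p) = ψ (p.1 + 1, p.2)) (n : ℤ) (p : Plane) :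
    h.iter n (ψ p) = ψ (p.1 + n, p.2) := by
  induction n with
  | zero => simp [BrouwerHomeo.iter]
  | succ n ih =>
    rw [BrouwerHomeo.iter] at ih ⊢
    rw [add_comm, zpow_add, zpow_one, Equiv.Perm.mul_apply, ih]
    refine (he _).trans ?_
    congr 2
    push_cast
    ring
  | pred n ih =>
    rw [BrouwerHomeo.iter] at ih ⊢
    rw [sub_eq_add_neg, add_comm, zpow_add, zpow_neg_one, Equiv.Perm.mul_apply, ih,
      Equiv.Perm.inv_eq_iff_eq]
    refine Eq.trans ?_ (he _).symm
    congr 2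
    push_cast
    ring

theorem pathLenLe_one_of_snd_ne {h : BrouwerHomeo} {ψ : Plane → Plane} (hc : Continuous ψ)
    (hi : Function.Injective ψ) (he : ∀ p : Plane, h.toHomeomorph (ψ p) = ψ (p.1 + 1, p.2))
    {p q : Plane} (hpq : p.2 ≠ q.2) : PathLenLe h (ψ p) (ψ q) 1 := by
  have hsub : q.2 - p.2 ≠ 0 := sub_ne_zero.2 hpq.symm
  have hinj : ∀ r r' : ℝ, p.2 + r * (q.2 - p.2) = p.2 + r' * (q.2 - p.2) → r = r' :=
    fun r r' h1 => mul_right_cancel₀ hsub (add_left_cancel h1)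
  refine ⟨fun r => ψ (p.1 + r * (q.1 - p.1), p.2 + r * (q.2 - p.2)), 1, zero_le_one,
    by fun_prop, fun r _ r' _ hr => hinj r r' (congrArg Prod.snd (hi hr)), by simp, by simp,
    fun i => i, Nat.mono_cast, by simp, by simp, fun i _ => ?_⟩
  rw [IsFree, disjoint_left]
  rintro _ ⟨_, ⟨r, -, rfl⟩, rfl⟩ ⟨r', -, hr'⟩
  simp only [he] at hr'
  have h1 := hi hr'
  have h2 := hinj _ _ (congrArg Prod.snd h1)
  have h3 := congrArg Prod.fst h1
  simp only [h2] at h3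
  linarith

theorem pathLenLe_one_of_chart {h : BrouwerHomeo} {ψ : Plane → Plane} (hc : Continuous ψ)
    (hi : Function.Injective ψ) (he : ∀ p : Plane, h.toHomeomorph (ψ p) = ψ (p.1 + 1, p.2))
    {p q : Plane} (hpq : ¬SameOrbit h (ψ p) (ψ q)) : PathLenLe h (ψ p) (ψ q) 1 := by
  by_cases h2 : p.2 = q.2
  · let φ : ℝ → ℝ := fun s => Real.cos ((s - p.1) * (2 * Real.pi))
    have hφ : ∀ s, φ (s + 1) = φ s := fun s =>
      (congrArg Real.cos (by ring)).trans (Real.cos_add_two_pi _)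
    have hφc : Continuous φ := by fun_prop
    have hne : φ p.1 ≠ φ q.1 := by
      intro h3
      have h4 : φ q.1 = 1 := by rw [← h3]; simp [φ]
      obtain ⟨n, hn⟩ := (Real.cos_eq_one_iff _).1 h4
      refine hpq ⟨n, ?_⟩
      rw [iter_apply_of_equivariant he]
      have h5 := mul_right_cancel₀ Real.two_pi_pos.ne' hn
      congr 1
      exact Prod.ext (by simp only; linarith) h2
    have h3 := pathLenLe_one_of_snd_ne (h := h) (ψ := fun r => ψ (r.1, r.2 - φ r.1)) (by fun_prop)
      (fun r r' hr => by
        have h4 : (r.1, r.2 - φ r.1) = (r'.1, r'.2 - φ r'.1) := hi hr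
        have h5 : r.1 = r'.1 := (Prod.ext_iff.1 h4).1
        have h6 : r.2 - φ r.1 = r'.2 - φ r'.1 := (Prod.ext_iff.1 h4).2
        rw [h5] at h6
        exact Prod.ext h5 (by linarith)) (fun r => by simp only [he, hφ])
      (p := (p.1, p.2 + φ p.1)) (q := (q.1, q.2 + φ q.1))
      (fun h4 => hne (by simp only at h4; linarith))
    simpa using h3
  · exact pathLenLe_one_of_snd_ne hc hi he h2

theorem pathLenLe_one_of_isTranslationDomain {h : BrouwerHomeo} {O : Set Plane}
    (hO : IsTranslationDomain h O) {x y : Plane} (hx : x ∈ O) (hy : y ∈ O)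
    (hxy : ¬SameOrbit h x y) : PathLenLe h x y 1 := by
  obtain ⟨-, -, -, hinv, Φ, hΦ⟩ := hO
  have he : ∀ p : Plane, h.toHomeomorph (Φ.symm p) = Φ.symm (p.1 + 1, p.2) := fun p => by
    have hmem : h.toHomeomorph (Φ.symm p) ∈ O :=
      hinv.subset (mem_image_of_mem _ (Φ.symm p).2)
    have h1 := hΦ (Φ.symm p) (Φ.symm p).2 hmem
    rw [Subtype.coe_eta, Φ.apply_symm_apply] at h1
    rw [← h1, Φ.symm_apply_apply]
  have h1 := pathLenLe_one_of_chart (h := h) (ψ := fun p => Φ.symm p) (p := Φ ⟨x, hx⟩)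
    (q := Φ ⟨y, hy⟩) (by fun_prop) (Subtype.val_injective.comp Φ.symm.injective) he
    (by simpa using hxy)
  simpa using h1

theorem exists_mem_not_sameOrbit (h : BrouwerHomeo) {V : Set Plane} (hV : IsOpen V)
    (hne : V.Nonempty) (x y : Plane) : ∃ a ∈ V, ¬SameOrbit h x a ∧ ¬SameOrbit h a y := by
  have hcount : ((range fun n : ℤ => h.iter n x) ∪ range fun n : ℤ => h.iter n y).Countable :=
    (countable_range _).union (countable_range _)
  obtain ⟨a, haV, ha⟩ := (hcount.dense_compl ℝ).inter_open_nonempty V hV hne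
  refine ⟨a, haV, fun ⟨n, hn⟩ => ha (Or.inl ⟨n, hn⟩), fun ⟨n, hn⟩ => ha (Or.inr ⟨-n, ?_⟩)⟩
  simp only [BrouwerHomeo.iter] at hn ⊢
  rw [zpow_neg, Equiv.Perm.inv_eq_iff_eq]
  exact hn.symm

theorem pathLenLe_of_walk {h : BrouwerHomeo} {k : ℕ} {O : Fin k → Set Plane}
    (hO : ∀ i, IsTranslationDomain h (O i)) {G : SimpleGraph (Fin k)}
    (hG : ∀ i j, G.Adj i j → (O i ∩ O j).Nonempty) {i j : Fin k} (w : G.Walk i j) :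
    ∀ x y : Plane, x ∈ O i → y ∈ O j → ¬SameOrbit h x y → PathLenLe h x y (w.length + 1) := by
  induction w with
  | nil => exact fun x y hx hy hxy => pathLenLe_one_of_isTranslationDomain (hO _) hx hy hxy
  | cons hadj w ih =>
    intro x y hx hy hxy
    obtain ⟨a, ⟨ha, ha'⟩, h1, h2⟩ :=
      exists_mem_not_sameOrbit h ((hO _).1.inter (hO _).1) (hG _ _ hadj) x y
    have h3 := (pathLenLe_one_of_isTranslationDomain (hO _) hx ha h1).trans (ih a y ha' hy h2)
    rw [SimpleGraph.Walk.length_cons, add_comm]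
    exact h3

theorem arcLenLe_of_connectsBy {h : BrouwerHomeo} {x y : Plane} {k : ℕ} (hxy : ¬SameOrbit h x y)
    (hk : ConnectsBy h x y k) : ArcLenLe h x y k := by
  obtain ⟨O, hO, hc, hx, hy⟩ := hk
  obtain ⟨i, hi⟩ := mem_iUnion.1 hx
  obtain ⟨j, hj⟩ := mem_iUnion.1 hy
  let G : SimpleGraph (Fin k) :=
    { Adj := fun a b => a ≠ b ∧ (O a ∩ O b).Nonempty
      symm := ⟨fun a b hab => ⟨hab.1.symm, by rw [inter_comm]; exact hab.2⟩⟩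
      loopless := ⟨fun a ha => ha.1 rfl⟩ }
  have hreach : G.Reachable i j := by
    by_contra hnr
    obtain ⟨z, -, hz1, hz2⟩ := hc.isPreconnected (⋃ a ∈ {a | G.Reachable i a}, O a)
      (⋃ a ∈ {a | ¬G.Reachable i a}, O a) (isOpen_biUnion fun a _ => (hO a).1)
      (isOpen_biUnion fun a _ => (hO a).1) (fun z hz => by
        obtain ⟨a, ha⟩ := mem_iUnion.1 hz
        by_cases hr : G.Reachable i a
        · exact Or.inl (mem_biUnion (show a ∈ {a | G.Reachable i a} from hr) ha)
        · exact Or.inr (mem_biUnion (show a ∈ {a | ¬G.Reachable i a} from hr) ha))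
      ⟨x, hx, mem_biUnion (show i ∈ {a | G.Reachable i a} from .refl i) hi⟩
      ⟨y, hy, mem_biUnion (show j ∈ {a | ¬G.Reachable i a} from hnr) hj⟩
    obtain ⟨a, ha, hza⟩ := mem_iUnion₂.1 hz1
    obtain ⟨b, hb, hzb⟩ := mem_iUnion₂.1 hz2
    have ha' : G.Reachable i a := ha
    have hb' : ¬G.Reachable i b := hb
    refine hb' (ha'.trans (SimpleGraph.Adj.reachable ⟨?_, z, hza, hzb⟩))
    rintro rfl
    exact hb' ha'
  obtain ⟨w, hw⟩ := hreach.exists_isPath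
  have h1 := pathLenLe_of_walk hO (fun a b hab => (show a ≠ b ∧ (O a ∩ O b).Nonempty from hab).2) w x y hi hj hxy
  refine (h1.mono ?_).arcLenLe fun he => hxy ⟨0, by simp [BrouwerHomeo.iter, he]⟩
  have := hw.length_lt
  rw [Fintype.card_fin] at this
  omega

end BrouwerPlane

/-- For `x`, `y` not in the same orbit, the translation distance
`d_h(x,y)` equals the minimal `h`-length of an arc joining `x` to `y`. -/
theorem transDist_eq_min_arc_length (h : BrouwerHomeo) (x y : Plane)
    (hxy : ¬ SameOrbit h x y) :
    transDist h x y = sInf {k : ℕ | ArcLenLe h x y k} := by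
  have hne : x ≠ y := fun he => hxy ⟨0, by simp [BrouwerHomeo.iter, he]⟩
  rw [transDist, if_neg hne]
  congr 1
  ext k
  exact ⟨BrouwerPlane.arcLenLe_of_connectsBy hxy, BrouwerPlane.connectsBy_of_arcLenLe⟩
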